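/- arXiv:2603.09144 — 2 statements merged into one kernel-verified Lean document; each statement's English description precedes it below -/
import Mathlib

section
/- Let G = (V, E, w) be a simple undirected edge-weighted graph, let APX be a triangle-free 2-matching of G, and let ε ∈ (0, 1] be a constant. If (1−ε)·opt(G) > w(APX), then there exists an augmenting trail P for APX with |P| ≤ 7/ε. -/
open Finset

variable {V : Type*}

/-- Degree of a vertex w.r.t. an edge set, self-loops counted twice. -/
def sym2Deg [DecidableEq V] (F : Finset (Sym2 V)) (v : V) : ℕ :=
  ∑ e ∈ F, (if e = s(v, v) then 2 else if v ∈ e then 1 else 0)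

def IsTwoMatching [DecidableEq V] (F : Finset (Sym2 V)) : Prop :=
  ∀ v : V, sym2Deg F v ≤ 2

def IsTriangle [DecidableEq V] (T : Finset (Sym2 V)) : Prop :=
  ∃ a b c : V, a ≠ b ∧ a ≠ c ∧ b ≠ c ∧ T = {s(a, b), s(b, c), s(a, c)}

def TriangleFree [DecidableEq V] (F : Finset (Sym2 V)) : Prop :=
  ∀ T : Finset (Sym2 V), IsTriangle T → ¬ T ⊆ F

def TFree [DecidableEq V] (𝒯 : Finset (Finset (Sym2 V))) (F : Finset (Sym2 V)) : Prop :=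
  ∀ T ∈ 𝒯, ¬ T ⊆ F

def wSum (w : Sym2 V → ℚ) (F : Finset (Sym2 V)) : ℚ := ∑ e ∈ F, w e

/-- A trail of length `k` in an edge set `E`: a sequence of distinct consecutive edges. -/
def IsTrail [DecidableEq V] (E : Finset (Sym2 V)) (k : ℕ) (u : ℕ → V) : Prop :=
  (∀ i < k, s(u i, u (i + 1)) ∈ E) ∧
  (∀ i < k, ∀ j < k, s(u i, u (i + 1)) = s(u j, u (j + 1)) → i = j)

def trailEdges [DecidableEq V] (k : ℕ) (u : ℕ → V) : Finset (Sym2 V) :=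
  (Finset.range k).image (fun i => s(u i, u (i + 1)))

def trailSl [DecidableEq V] (k : ℕ) (u : ℕ → V) : ℕ :=
  ((Finset.range k).filter (fun i => u i = u (i + 1))).card

def IsAltTrail [DecidableEq V] (A₁ A₂ : Finset (Sym2 V)) (k : ℕ) (u : ℕ → V) : Prop :=
  IsTrail (symmDiff A₁ A₂) k u ∧
  ∀ i, i + 1 < k →
    (s(u i, u (i + 1)) ∈ A₁ \ A₂ ↔ s(u (i + 1), u (i + 2)) ∈ A₂ \ A₁)

/-- Two superimposed graphs, seen as a colouring of the pairs of vertices: `R` only in the first,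
`B` only in the second, `G` in both. Both graphs have maximum degree two and no triangle. -/
structure ColoredPair (V : Type*) where
  R : V → V → Prop
  B : V → V → Prop
  G : V → V → Prop
  R_symm : ∀ {x y}, R x y → R y x
  B_symm : ∀ {x y}, B x y → B y x
  G_symm : ∀ {x y}, G x y → G y x
  R_irrefl : ∀ x, ¬ R x x
  B_irrefl : ∀ x, ¬ B x x
  not_R_B : ∀ x y, R x y → ¬ B x y
  not_R_G : ∀ x y, R x y → ¬ G x y
  not_B_G : ∀ x y, B x y → ¬ G x y
  deg_fst : ∀ x a b c, (R x a ∨ G x a) → (R x b ∨ G x b) → (R x c ∨ G x c) →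
    a = b ∨ a = c ∨ b = c
  deg_snd : ∀ x a b c, (B x a ∨ G x a) → (B x b ∨ G x b) → (B x c ∨ G x c) →
    a = b ∨ a = c ∨ b = c
  tri_fst : ∀ x y z, (R x y ∨ G x y) → (R y z ∨ G y z) → (R x z ∨ G x z) → False
  tri_snd : ∀ x y z, (B x y ∨ G x y) → (B y z ∨ G y z) → (B x z ∨ G x z) → False

namespace ColoredPair

variable (P : ColoredPair V)

/-- The pairing of red and blue edges at each vertex `p` in which the red edge to `(c p).1` is
paired with the blue edge to `(c p).2`, and the remaining red edge with the remaining blue one. -/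
def Link (c : V → V × V) (p x y : V) : Prop :=
  P.R p x ∧ P.B p y ∧ (x = (c p).1 ↔ y = (c p).2)

def IsCenter (c : V → V × V) : Prop :=
  ∀ p x y, P.R p x → P.B p y → P.R p (c p).1 ∧ P.B p (c p).2

/-- The pairs of a red edge `px` and a blue edge `py` spanning a triangle with `xy` in the first
graph which are allowed to remain unpaired at `p`. -/
def Exceptional (p x y : V) : Prop :=
  P.R x y ∧ ((∃ x', x' ≠ x ∧ P.R p x' ∧ (P.R x' y ∨ P.G x' y)) ∨
    ∃ q r, q ≠ x ∧ P.R p q ∧ P.R q r ∧ P.R r y ∧ P.B y q ∧ ¬ P.B p r ∧ ¬ P.B q x)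

def Admissible (c : V → V × V) : Prop :=
  P.IsCenter c ∧
  (∀ p x y, P.R p x → P.B p y → (P.R x y ∨ P.G x y) → ¬ P.Exceptional p x y → P.Link c p x y) ∧
  (∀ p x y, P.R p x → P.R x y → P.B p y → P.Link c p x y ∨ P.Link c y x p)

variable {P} {c : V → V × V}

lemma Link.right_unique (hc : P.IsCenter c) {p x y y' : V} (h : P.Link c p x y)
    (h' : P.Link c p x y') : y = y' := by
  obtain ⟨h1, h2, h3⟩ := h
  obtain ⟨h1', h2', h3'⟩ := h'
  obtain ⟨-, hb⟩ := hc p x y h1 h2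
  have := P.deg_snd p y y' (c p).2 (.inl h2) (.inl h2') (.inl hb)
  grind

lemma Link.left_unique (hc : P.IsCenter c) {p x x' y : V} (h : P.Link c p x y)
    (h' : P.Link c p x' y) : x = x' := by
  obtain ⟨h1, h2, h3⟩ := h
  obtain ⟨h1', h2', h3'⟩ := h'
  obtain ⟨hr, -⟩ := hc p x y h1 h2
  have := P.deg_fst p x x' (c p).1 (.inl h1) (.inl h1') (.inl hr)
  grind

lemma exists_link (hc : P.IsCenter c) {p x y : V} (hx : P.R p x) (hy : P.B p y) :
    (∃ y', P.Link c p x y') ∨ ∃ x', P.Link c p x' y := by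
  obtain ⟨hr, hb⟩ := hc p x y hx hy
  unfold Link
  by_cases h1 : x = (c p).1
  · exact .inl ⟨(c p).2, hx, hb, by simp [h1]⟩
  · by_cases h2 : y = (c p).2
    · exact .inr ⟨(c p).1, hr, hy, by simp [h2]⟩
    · exact .inl ⟨y, hx, hy, by simp [h1, h2]⟩

/-- A vertex with a second red and a second blue edge pairs these if it pairs the first ones. -/
lemma Link.other (hc : P.IsCenter c) {p x y x' y' : V} (h : P.Link c p x y) (hx : P.R p x')
    (hy : P.B p y') (hxx : x' ≠ x) (hyy : y' ≠ y) : P.Link c p x' y' := by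
  obtain ⟨h1, h2, h3⟩ := h
  obtain ⟨hr, hb⟩ := hc p x y h1 h2
  have := P.deg_fst p x x' (c p).1 (.inl h1) (.inl hx) (.inl hr)
  have := P.deg_snd p y y' (c p).2 (.inl h2) (.inl hy) (.inl hb)
  exact ⟨hx, hy, by grind⟩

lemma wanted_compat {p x y x' y' : V} (h1 : P.R p x) (h2 : P.B p y) (h3 : P.R x y ∨ P.G x y)
    (h4 : ¬ P.Exceptional p x y) (h1' : P.R p x') (h2' : P.B p y') (h3' : P.R x' y' ∨ P.G x' y')
    (h4' : ¬ P.Exceptional p x' y') : x = x' ↔ y = y' := by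
  constructor
  · rintro rfl
    have := P.deg_fst x p y y' (.inl (P.R_symm h1)) h3 h3'
    have := P.B_irrefl p
    grind
  · rintro rfl
    by_contra hne
    have e1 : ¬ P.R x y := fun h => h4 ⟨h, .inl ⟨x', Ne.symm hne, h1', h3'⟩⟩
    have e2 : ¬ P.R x' y := fun h => h4' ⟨h, .inl ⟨x, hne, h1, h3⟩⟩
    have h3 := h3.resolve_left e1
    have h3' := h3'.resolve_left e2
    have := P.deg_snd y p x x' (.inl (P.B_symm h2)) (.inr (P.G_symm h3)) (.inr (P.G_symm h3'))
    have := P.R_irrefl p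
    grind

lemma not_exceptional_of_pentagon {p x y q r : V} (hpx : P.R p x) (hxy : P.R x y) (hpy : P.B p y)
    (hqx : q ≠ x) (hpq : P.R p q) (hqr : P.R q r) (hry : P.R r y) (hyq : P.B y q)
    (hpr : ¬ P.B p r) : ¬ P.Exceptional y x p := by
  have hrx : r ≠ x := by
    rintro rfl
    have := P.deg_fst r p y q (.inl (P.R_symm hpx)) (.inl hxy) (.inl (P.R_symm hqr))
    have := P.R_irrefl p
    have := P.B_irrefl p
    have := P.B_irrefl y
    grind
  rintro ⟨-, ⟨x', h1, h2, h3⟩ | ⟨q', r', h1, h2, h3, h4, h5, h6, h7⟩⟩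
  · have := P.deg_fst y x x' r (.inl (P.R_symm hxy)) (.inl h2) (.inl (P.R_symm hry))
    have hx' : x' = r := by grind
    subst hx'
    have := P.deg_fst p x q x' (.inl hpx) (.inl hpq) (h3.imp P.R_symm P.G_symm)
    have := P.R_irrefl q
    grind
  · have := P.deg_fst y x q' r (.inl (P.R_symm hxy)) (.inl h2) (.inl (P.R_symm hry))
    have : q' = r := by grind
    subst this
    exact hpr h5

/-- In a red four-cycle through `p`, `x`, `y`, no wanted pair at `p` is unexceptional. -/
lemma exceptional_of_square {p x y x' a b : V} (hpx : P.R p x) (hxy : P.R x y) (hpy : P.B p y)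
    (hx : x' ≠ x) (hpx' : P.R p x') (hxy' : P.R x' y) (ha : P.R p a) (hb : P.B p b)
    (hab : P.R a b ∨ P.G a b) : b = y ∧ P.Exceptional p a b := by
  have h1 := P.deg_fst p x x' a (.inl hpx) (.inl hpx') (.inl ha)
  have hbp : b ≠ p := by rintro rfl; exact P.B_irrefl _ hb
  have hyp : y ≠ p := by rintro rfl; exact P.B_irrefl _ hpy
  have hay : P.R a y := by grind
  have hby : b = y := by
    have := P.deg_fst a p y b (.inl (P.R_symm ha)) (.inl hay) hab
    grind
  subst hby
  refine ⟨rfl, hay, .inl ?_⟩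
  rcases eq_or_ne x a with rfl | h
  · exact ⟨x', hx, hpx', .inl hxy'⟩
  · exact ⟨x, h, hpx, .inl hxy⟩

/-- The pairs required at `p` of an admissible pairing; `e` breaks ties in red four-cycles. -/
def Demand (P : ColoredPair V) (e : V → ℕ) (p x y : V) : Prop :=
  P.R p x ∧ P.B p y ∧ (((P.R x y ∨ P.G x y) ∧ ¬ P.Exceptional p x y) ∨
    P.R x y ∧ ∃ x', x' ≠ x ∧ P.R p x' ∧ P.R x' y ∧ (e p < e y ↔ e x < e x'))

lemma Demand.compat {e : V → ℕ} (he : Function.Injective e) {p x y x' y' : V}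
    (h : Demand P e p x y) (h' : Demand P e p x' y') : x = x' ↔ y = y' := by
  obtain ⟨hr, hb, ⟨h, hn⟩ | ⟨h, z, hz, hpz, hzy, ho⟩⟩ := h <;>
  obtain ⟨hr', hb', ⟨h', hn'⟩ | ⟨h', z', hz', hpz', hzy', ho'⟩⟩ := h'
  · exact wanted_compat hr hb h hn hr' hb' h' hn'
  · exact absurd (exceptional_of_square hr' h' hb' hz' hpz' hzy' hr hb h).2 hn
  · exact absurd (exceptional_of_square hr h hb hz hpz hzy hr' hb' (h')).2 hn'
  · obtain ⟨rfl, -⟩ := exceptional_of_square hr h hb hz hpz hzy hr' hb' (.inl h')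
    simp only [iff_true]
    by_contra hne
    have h1 := P.deg_fst p x x' z (.inl hr) (.inl hr') (.inl hpz)
    have h2 := P.deg_fst p x x' z' (.inl hr) (.inl hr') (.inl hpz')
    have := he.ne hne
    obtain rfl : x' = z := by grind
    obtain rfl : x = z' := by grind
    grind

lemma exists_admissible [Finite V] (P : ColoredPair V) : ∃ c, P.Admissible c := by
  classical
  cases nonempty_fintype V
  obtain ⟨e, he⟩ : ∃ e : V → ℕ, Function.Injective e :=
    ⟨fun v => Fintype.equivFin V v, Fin.val_injective.comp (Fintype.equivFin V).injective⟩
  have hc : ∀ p, ∃ d : V × V, (∀ x y, P.R p x → P.B p y → P.R p d.1 ∧ P.B p d.2) ∧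
      ∀ x y, Demand P e p x y → (x = d.1 ↔ y = d.2) := by
    intro p
    by_cases h : ∃ x y, Demand P e p x y
    · obtain ⟨x, y, h⟩ := h
      exact ⟨(x, y), fun _ _ _ _ => ⟨h.1, h.2.1⟩, fun _ _ h' => h'.compat he h⟩
    · push Not at h
      by_cases h' : ∃ x y, P.R p x ∧ P.B p y
      · obtain ⟨x, y, h'⟩ := h'
        exact ⟨(x, y), fun _ _ _ _ => h', fun _ _ hd => absurd hd (h _ _)⟩
      · exact ⟨(p, p), fun x y hx hy => absurd ⟨x, y, hx, hy⟩ h', fun _ _ hd => absurd hd (h _ _)⟩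
  choose c hc hd using hc
  have key : ∀ p x y, P.R p x → P.B p y → (P.R x y ∨ P.G x y) → ¬ P.Exceptional p x y →
      P.Link c p x y :=
    fun p x y hx hy h hn => ⟨hx, hy, hd p x y ⟨hx, hy, .inl ⟨h, hn⟩⟩⟩
  refine ⟨c, hc, key, fun p x y hx hxy hy => ?_⟩
  by_cases hE : P.Exceptional p x y
  swap
  · exact .inl (key p x y hx hy (.inl hxy) hE)
  obtain ⟨-, ⟨x', h1, h2, h3 | h3⟩ | ⟨q, r, h1, h2, h3, h4, h5, h6, h7⟩⟩ := hE
  · by_cases ho : e p < e y ↔ e x < e x'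
    · exact .inl ⟨hx, hy, hd p x y ⟨hx, hy, .inr ⟨hxy, x', h1, h2, h3, ho⟩⟩⟩
    · refine .inr ⟨P.R_symm hxy, P.B_symm hy, hd y x p ⟨P.R_symm hxy, P.B_symm hy,
        .inr ⟨P.R_symm hx, x', h1, P.R_symm h3, P.R_symm h2, ?_⟩⟩⟩
      have : e p ≠ e y := he.ne (by rintro rfl; exact P.B_irrefl _ hy)
      grind
  · refine .inr (key y x p (P.R_symm hxy) (P.B_symm hy) (.inl (P.R_symm hx)) ?_)
    have hn := P.not_R_G
    have hs := @P.R_symm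
    have hg := @P.G_symm
    have hd := fun z => P.deg_fst y x x' z (.inl (P.R_symm hxy)) (.inr (P.G_symm h3))
    rintro ⟨-, ⟨z, k1, k2, -⟩ | ⟨z, r, k1, k2, -⟩⟩ <;>
    · have := hd z (.inl k2)
      grind
  · exact .inr (key y x p (P.R_symm hxy) (P.B_symm hy) (.inl (P.R_symm hx))
      (not_exceptional_of_pentagon hx hxy hy h1 h2 h3 h4 h5 h6))

/-- A triangle with two blue edges `pv`, `vq` and a red edge `pq`, which is paired with one of the
blue edges. -/
def Sat (P : ColoredPair V) (c : V → V × V) (p v q : V) : Prop :=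
  P.R p q ∧ P.B p v ∧ P.B v q ∧ (P.Link c p q v ∨ P.Link c q p v)

/-- An unpaired red edge `pq` of such a triangle whose end `p` is met by a blue edge `pp'` with
`qp'` red, all paired in the way that rules out shortening at `v`. -/
def Locked (P : ColoredPair V) (c : V → V × V) (p v q : V) : Prop :=
  ∃ p', P.Link c p q p' ∧ P.Link c p' q p ∧ P.Link c q p' v

/-- A red four-cycle `p`, `q`, `p'`, `x'` with a blue diagonal paired at `p` only. -/
def Square (P : ColoredPair V) (c : V → V × V) (p v q : V) : Prop :=
  ∃ p' x', P.R p x' ∧ P.B p p' ∧ p' ≠ v ∧ x' ≠ q ∧ P.R q p' ∧ P.R p' x' ∧ P.Link c p q p' ∧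
    ¬ P.Link c p' q p

def Maximal (P : ColoredPair V) (c : V → V × V) : Prop :=
  P.Admissible c ∧ ∀ c', P.Admissible c' → (∀ p v q, P.Sat c p v q → P.Sat c' p v q) →
    ∀ p v q, P.Sat c' p v q → P.Sat c p v q

lemma Sat.symm {p v q : V} (h : P.Sat c p v q) : P.Sat c q v p :=
  ⟨P.R_symm h.1, P.B_symm h.2.2.1, P.B_symm h.2.1, h.2.2.2.symm⟩

lemma exists_maximal [Finite V] (P : ColoredPair V) : ∃ c, P.Maximal c := by
  obtain ⟨c, hc, hm⟩ := (Set.toFinite {c | P.Admissible c}).exists_maximalFor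
    (fun c => {t : V × V × V | P.Sat c t.1 t.2.1 t.2.2}) _ P.exists_admissible
  exact ⟨c, hc, fun c' hc' h p v q hs => hm hc' (fun t ht => h _ _ _ ht) (a := (p, v, q)) hs⟩

lemma link_of_not_link_left (hc : P.IsCenter c) {p x y x' : V} (hx : P.R p x) (hx' : P.R p x')
    (hy : P.B p y) (hxx : x ≠ x') (hn : ¬ P.Link c p x y) : P.Link c p x' y := by
  have h1 := P.deg_fst p x x' (c p).1 (.inl hx) (.inl hx') (.inl (hc p x y hx hy).1)
  have h2 := hc p x y hx hy
  unfold Link at *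
  grind

lemma link_of_not_link_right (hc : P.IsCenter c) {p x y y' : V} (hx : P.R p x)
    (hy : P.B p y) (hy' : P.B p y') (hyy : y ≠ y') (hn : ¬ P.Link c p x y) : P.Link c p x y' := by
  have h2 := P.deg_snd p y y' (c p).2 (.inl hy) (.inl hy') (.inl (hc p x y hx hy).2)
  have h1 := hc p x y hx hy
  unfold Link at *
  grind

lemma locked_of_wanted (hc : P.Admissible c) {p v q p' : V} (hpq : P.R p q) (hpv : P.B p v)
    (hvq : P.B v q) (hp : ¬ P.Link c p q v) (hq : ¬ P.Link c q p v) (hpp : P.B p p')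
    (hne : p' ≠ v) (hqp : P.R q p' ∨ P.G q p') (hex : ¬ P.Exceptional p q p') :
    P.Locked c p v q := by
  obtain ⟨h0, h1, h2⟩ := hc
  have hpv' : p ≠ v := by rintro rfl; exact P.B_irrefl _ hpv
  have hpp' : p ≠ p' := by rintro rfl; exact P.B_irrefl _ hpp
  have hlp : P.Link c p q p' := h1 p q p' hpq hpp hqp hex
  have hred : P.R q p' := by
    refine hqp.resolve_right fun hG => hq ?_
    have ha := (h0 q p v (P.R_symm hpq) (P.B_symm hvq))
    have := P.deg_snd q v p' (c q).2 (.inl (P.B_symm hvq)) (.inr hG) (.inl ha.2)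
    have := P.deg_fst q p p' (c q).1 (.inl (P.R_symm hpq)) (.inr hG) (.inl ha.1)
    have := P.not_R_G q p'
    have := P.not_B_G q p'
    exact ⟨P.R_symm hpq, P.B_symm hvq, by grind⟩
  refine ⟨p', hlp, h1 p' q p (P.R_symm hred) (P.B_symm hpp) (.inl (P.R_symm hpq)) ?_,
    link_of_not_link_left h0 (P.R_symm hpq) hred (P.B_symm hvq) hpp' hq⟩
  rintro ⟨-, ⟨x', k1, k2, k3 | k3⟩ | ⟨Q, r, k1, k2, k3, k4, k5, k6, k7⟩⟩
  · exact hex ⟨hred, .inl ⟨x', k1, P.R_symm k3, .inl (P.R_symm k2)⟩⟩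
  · have := P.deg_snd p v p' x' (.inl hpv) (.inl hpp) (.inr (P.G_symm k3))
    have := P.R_irrefl p'
    have := P.not_B_G p v hpv
    have := @P.G_symm
    grind
  · have := P.deg_snd p v p' Q (.inl hpv) (.inl hpp) (.inl k5)
    have := P.R_irrefl p'
    grind

section Update

variable [DecidableEq V]

lemma link_update {p q v a x y : V} : P.Link (Function.update c p (q, v)) a x y ↔
    (a ≠ p ∧ P.Link c a x y) ∨ (a = p ∧ P.R p x ∧ P.B p y ∧ (x = q ↔ y = v)) := by
  unfold Link
  by_cases h : a = p
  · subst h; simp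
  · simp [h]

lemma isCenter_update (hc : P.IsCenter c) {p q v : V} (hpq : P.R p q) (hpv : P.B p v) :
    P.IsCenter (Function.update c p (q, v)) := by
  intro a x y hx hy
  by_cases h : a = p
  · subst h; simp [hpq, hpv]
  · simpa [h] using hc a x y hx hy

lemma sat_of_update (hc : P.IsCenter c) {p v q : V} (hpq : P.R p q) (hpv : P.B p v)
    (hvq : P.B v q) (hp : ¬ P.Link c p q v) (hq : ¬ P.Link c q p v) {a b d : V}
    (h : P.Sat c a b d) : P.Sat (Function.update c p (q, v)) a b d := by
  wlog hl : P.Link c a d b generalizing a d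
  · exact (this h.symm (h.2.2.2.resolve_left hl)).symm
  obtain ⟨k1, k2, k3, -⟩ := h
  refine ⟨k1, k2, k3, ?_⟩
  simp only [link_update]
  by_cases hap : a = p
  swap
  · exact .inl (.inl ⟨hap, hl⟩)
  subst hap
  have hqa : q ≠ a := by rintro rfl; exact P.R_irrefl _ hpq
  by_cases hd : d = q
  · subst hd
    have hb : v ≠ b := by rintro rfl; exact hp hl
    exact .inr (.inl ⟨hqa, link_of_not_link_right hc (P.R_symm hpq) (P.B_symm hvq) (P.B_symm k3)
      hb hq⟩)
  · refine .inl (.inr ⟨rfl, k1, k2, ?_⟩)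
    have := P.deg_snd v a q d (.inl (P.B_symm hpv)) (.inl hvq)
    have := P.R_irrefl a
    grind

end Update

/-- What keeps an optimal pairing from pairing `pq` with `pv` at `p`. -/
lemma obstruction (hm : P.Maximal c) {p v q : V} (hpq : P.R p q) (hpv : P.B p v)
    (hvq : P.B v q) (hp : ¬ P.Link c p q v) (hq : ¬ P.Link c q p v) :
    P.Locked c p v q ∨ P.Square c p v q ∨
    ∃ p₁, p₁ ≠ q ∧ P.R p p₁ ∧ (P.R p₁ v ∨ P.G p₁ v) ∧ ¬ P.Exceptional p p₁ v := by
  classical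
  obtain ⟨⟨h0, h1, h2⟩, hmax⟩ := hm
  set c' := Function.update c p (q, v) with hc'
  have hlk : ∀ a x y, P.Link c' a x y ↔
      (a ≠ p ∧ P.Link c a x y) ∨ (a = p ∧ P.R p x ∧ P.B p y ∧ (x = q ↔ y = v)) :=
    fun a x y => link_update
  have hna : ¬ P.Admissible c' := by
    intro ha
    have := hmax c' ha (fun _ _ _ => sat_of_update h0 hpq hpv hvq hp hq) p v q
      ⟨hpq, hpv, hvq, .inl ((hlk _ _ _).2 (.inr ⟨rfl, hpq, hpv, by simp⟩))⟩
    exact this.2.2.2.elim hp hq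
  have hloc : ∀ p', P.B p p' → p' ≠ v → (P.R q p' ∨ P.G q p') → ¬ P.Exceptional p q p' →
      P.Locked c p v q := fun p' a b d e =>
    locked_of_wanted ⟨h0, h1, h2⟩ hpq hpv hvq hp hq a b d e
  by_contra! hcon
  obtain ⟨n1, n2, n3⟩ := hcon
  refine hna ⟨isCenter_update h0 hpq hpv, fun a x y hx hy hxy he => ?_, fun a x y hx hxy hy => ?_⟩
  · rw [hlk]
    by_cases hap : a = p
    swap
    · exact .inl ⟨hap, h1 a x y hx hy hxy he⟩
    subst hap
    refine .inr ⟨rfl, hx, hy, ?_, ?_⟩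
    · rintro rfl
      by_contra hyv
      exact n1 (hloc y hy hyv hxy he)
    · rintro rfl
      by_contra hyv
      exact he (n3 x hyv hx hxy)
  · by_contra hcon
    obtain ⟨a1, a2⟩ := not_or.1 hcon
    wlog hl : P.Link c a x y generalizing a y
    · exact this y a (P.R_symm hxy) (P.R_symm hx) (P.B_symm hy) (fun h => hcon h.symm) a2 a1
        ((h2 a x y hx hxy hy).resolve_left hl)
    rw [hlk] at a1 a2
    obtain rfl : a = p := by by_contra hap; exact a1 (.inl ⟨hap, hl⟩)
    have hya : y ≠ a := by rintro rfl; exact P.B_irrefl _ hy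
    have hny : ¬ P.Link c y x a := fun h => a2 (.inl ⟨hya, h⟩)
    have hnq : ¬ (x = q ↔ y = v) := fun h => a1 (.inr ⟨rfl, hx, hy, h⟩)
    have hexy : P.Exceptional y x a := by
      by_contra h
      exact hny (h1 y x a (P.R_symm hxy) (P.B_symm hy) (.inl (P.R_symm hx)) h)
    have hpent : ∀ Q r, Q ≠ x → P.R a Q → P.R Q r → P.R r y → P.B y Q → ¬ P.B a r → False :=
      fun Q r k1 k2 k3 k4 k5 k6 =>
        not_exceptional_of_pentagon hx hxy hy k1 k2 k3 k4 k5 k6 hexy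
    by_cases hxq : x = q
    · subst hxq
      have hyv : y ≠ v := by simpa using hnq
      have hex : P.Exceptional a x y := by
        by_contra h
        exact n1 (hloc y hy hyv (.inl hxy) h)
      obtain ⟨-, ⟨x', k1, k2, k3 | k3⟩ | ⟨Q, r, k1, k2, k3, k4, k5, k6, k7⟩⟩ := hex
      · exact n2 ⟨y, x', k2, hy, hyv, k1, hxy, P.R_symm k3, hl, hny⟩
      · have hn := P.not_R_G
        have hs := @P.R_symm
        have hg := @P.G_symm
        have hd := fun z => P.deg_fst y x x' z (.inl (P.R_symm hxy)) (.inr (P.G_symm k3))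
        obtain ⟨-, ⟨z, j1, j2, -⟩ | ⟨z, r, j1, j2, -⟩⟩ := hexy <;>
        · have := hd z (.inl j2)
          grind
      · exact hpent Q r k1 k2 k3 k4 k5 k6
    · have hyv : y = v := by simpa [hxq] using hnq
      subst hyv
      obtain ⟨-, ⟨x', k1, k2, k3⟩ | ⟨Q, r, k1, k2, k3, k4, k5, k6, k7⟩⟩ := n3 x hxq hx (.inl hxy)
      · have := P.deg_fst a x q x' (.inl hx) (.inl hpq) (.inl k2)
        obtain rfl : q = x' := by grind
        exact k3.elim (fun h => P.not_R_B _ _ h (P.B_symm hvq))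
          (fun h => P.not_B_G _ _ (P.B_symm hvq) h)
      · exact hpent Q r k1 k2 k3 k4 k5 k6

lemma not_square_square (hm : P.Maximal c) {p v q : V} (hpq : P.R p q) (hpv : P.B p v)
    (hvq : P.B v q) (hp : ¬ P.Link c p q v) (hq : ¬ P.Link c q p v) (h : P.Square c p v q)
    (h' : P.Square c q v p) : False := by
  classical
  obtain ⟨⟨h0, h1, h2⟩, hmax⟩ := hm
  obtain ⟨p', x', k1, k2, k3, k4, k5, k6, k7, k8⟩ := h
  obtain ⟨q', y', j1, j2, j3, j4, j5, j6, j7, j8⟩ := h'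
  have dq := P.deg_fst q p p' y' (.inl (P.R_symm hpq)) (.inl k5) (.inl j1)
  have dp := P.deg_fst p q x' q' (.inl hpq) (.inl k1) (.inl j5)
  have hpp' : p' ≠ p := by rintro rfl; exact P.B_irrefl _ k2
  have hqq' : q' ≠ q := by rintro rfl; exact P.B_irrefl _ j2
  obtain rfl : p' = y' := by grind
  obtain rfl : x' = q' := by grind
  have hqp : q ≠ p := by rintro rfl; exact P.R_irrefl _ hpq
  have hqp' : q ≠ p' := by rintro rfl; exact P.R_irrefl _ k5
  have hqv := P.B_symm hvq
  set c' := Function.update (Function.update c p (q, v)) p' (q, p) with hc'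
  have hc1 : P.IsCenter (Function.update c p (q, v)) := isCenter_update h0 hpq hpv
  have hlk : ∀ a x y, P.Link c' a x y ↔ (a ≠ p' ∧ a ≠ p ∧ P.Link c a x y) ∨
      (a = p ∧ P.R p x ∧ P.B p y ∧ (x = q ↔ y = v)) ∨
      (a = p' ∧ P.R p' x ∧ P.B p' y ∧ (x = q ↔ y = p)) := by
    intro a x y
    rw [hc', link_update, link_update]
    grind
  have hsat : ∀ a b d, P.Sat c a b d → P.Sat c' a b d := by
    intro a b d h
    wlog hl : P.Link c a d b generalizing a d
    · exact (this d a h.symm (h.2.2.2.resolve_left hl)).symm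
    obtain ⟨l1, l2, l3, -⟩ := h
    refine ⟨l1, l2, l3, ?_⟩
    simp only [hlk]
    have hv := P.deg_snd v p q
    have hs := @P.B_symm
    have hr := @P.R_symm
    have hn := P.not_R_B
    by_cases hap : a = p
    · subst hap
      have := P.deg_fst a q x' d (.inl hpq) (.inl k1) (.inl l1)
      have := P.deg_snd a v p' b (.inl hpv) (.inl k2) (.inl l2)
      have := hv d (.inl (P.B_symm hpv)) (.inl hvq)
      grind
    by_cases hap' : a = p'
    · subst hap'
      have := P.deg_fst a q x' d (.inl (P.R_symm k5)) (.inl k6) (.inl l1)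
      have := P.deg_snd q v x' b (.inl hqv) (.inl j2)
      have := hv a (.inl (P.B_symm hpv)) (.inl hvq)
      refine .inl (.inr (.inr ⟨rfl, l1, l2, ?_⟩))
      grind
    · exact .inl (.inl ⟨hap', hap, hl⟩)
  refine (hmax c' ⟨?_, fun a x y hx hy hxy he => ?_, fun a x y hx hxy hy => ?_⟩ hsat p v q
    ⟨hpq, hpv, hvq, .inl ((hlk _ _ _).2 (.inr (.inl ⟨rfl, hpq, hpv, by simp⟩)))⟩).2.2.2.elim hp hq
  · exact isCenter_update hc1 (P.R_symm k5) (P.B_symm k2)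
  · rw [hlk]
    by_cases hap : a = p
    · subst hap
      exact absurd (exceptional_of_square hpq k5 k2 k4 k1 (P.R_symm k6) hx hy hxy).2 he
    by_cases hap' : a = p'
    · subst hap'
      exact absurd (exceptional_of_square (P.R_symm k5) (P.R_symm hpq) (P.B_symm k2) k4 k6
        (P.R_symm k1) hx hy hxy).2 he
    · exact .inl ⟨hap', hap, h1 a x y hx hy hxy he⟩
  · have key : ∀ a y, P.R a x → P.R x y → P.B a y → (a = p ∨ a = p') →
        P.Link c' a x y ∨ P.Link c' y x a := by
      rintro a y hx hxy hy (rfl | rfl)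
      · obtain ⟨rfl, -⟩ := exceptional_of_square hpq k5 k2 k4 k1 (P.R_symm k6) hx hy (.inl hxy)
        have := P.deg_fst a q x' x (.inl hpq) (.inl k1) (.inl hx)
        simp only [hlk]
        have hr := @P.R_symm
        have hs := @P.B_symm
        grind
      · obtain ⟨rfl, -⟩ := exceptional_of_square (P.R_symm k5) (P.R_symm hpq) (P.B_symm k2) k4 k6
          (P.R_symm k1) hx hy (.inl hxy)
        have := P.deg_fst a q x' x (.inl (P.R_symm k5)) (.inl k6) (.inl hx)
        simp only [hlk]
        have hr := @P.R_symm
        have hs := @P.B_symm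
        grind
    by_cases ha : a = p ∨ a = p'
    · exact key a y hx hxy hy ha
    by_cases hy' : y = p ∨ y = p'
    · exact (key y a (P.R_symm hxy) (P.R_symm hx) (P.B_symm hy) hy').symm
    have := h2 a x y hx hxy hy
    simp only [hlk]
    grind

lemma not_square_of_wanted {p v q : V} (hpq : P.R p q) (hpv : P.B p v) (h : P.Square c p v q)
    {q₁ : V} (hne : q₁ ≠ p) (hq₁ : P.R q q₁) (hv : P.R q₁ v ∨ P.G q₁ v) : False := by
  obtain ⟨p', x', k1, k2, k3, k4, k5, k6, k7, k8⟩ := h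
  have hpp' : p' ≠ p := by rintro rfl; exact P.B_irrefl _ k2
  have := P.deg_fst q p p' q₁ (.inl (P.R_symm hpq)) (.inl k5) (.inl hq₁)
  obtain rfl : p' = q₁ := by grind
  have := P.deg_fst p' q x' v (.inl (P.R_symm k5)) (.inl k6) hv
  have := P.not_R_B p v
  have := P.B_irrefl q
  grind

lemma locked_of_pentagon (hc : P.Admissible c) {p v q p₁ q₁ : V} (hpq : P.R p q)
    (hpv : P.B p v) (hvq : P.B v q) (hp₁ : P.R p p₁) (hpne : p₁ ≠ q) (hq₁ : P.R q q₁)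
    (hp₁v : P.R p₁ v) (hq₁v : P.R q₁ v) (hex : ¬ P.Exceptional p p₁ v)
    (hex' : ¬ P.Exceptional q q₁ v) (hb : P.B p q₁) : P.Locked c p v q := by
  obtain ⟨h0, h1, h2⟩ := hc
  have hq₁v' : q₁ ≠ v := by rintro rfl; exact P.R_irrefl _ hq₁v
  have hqv' : q ≠ v := by rintro rfl; exact P.B_irrefl _ hvq
  refine ⟨q₁, (h1 p p₁ v hp₁ hpv (.inl hp₁v) hex).other h0 hpq hb hpne.symm hq₁v',
    h1 q₁ q p (P.R_symm hq₁) (P.B_symm hb) (.inl (P.R_symm hpq)) ?_,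
    h1 q q₁ v hq₁ (P.B_symm hvq) (.inl hq₁v) hex'⟩
  have hd := fun z => P.deg_fst q₁ q v z (.inl (P.R_symm hq₁)) (.inl hq₁v)
  rintro ⟨-, ⟨x', j1, j2, j3⟩ | ⟨Q, r, j1, j2, j3, j4, j5, j6, j7⟩⟩
  · have := hd x' (.inl j2)
    obtain rfl : x' = v := by grind
    exact j3.elim (fun h => P.not_R_B _ _ h (P.B_symm hpv))
      (fun h => P.not_B_G _ _ (P.B_symm hpv) h)
  · have := hd Q (.inl j2)
    obtain rfl : Q = v := by grind
    exact j7 hvq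

lemma sat_or_locked (hm : P.Maximal c) {p v q : V} (hpq : P.R p q) (hpv : P.B p v)
    (hvq : P.B v q) : P.Link c p q v ∨ P.Link c q p v ∨ P.Locked c p v q ∨ P.Locked c q v p := by
  by_contra! hcon
  obtain ⟨hp, hq, n1, n2⟩ := hcon
  have o1 := (obstruction hm hpq hpv hvq hp hq).resolve_left n1
  have o2 := (obstruction hm (P.R_symm hpq) (P.B_symm hvq) (P.B_symm hpv) hq hp).resolve_left n2
  rcases o1 with s1 | ⟨p₁, a1, a2, a3, a4⟩ <;> rcases o2 with s2 | ⟨q₁, b1, b2, b3, b4⟩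
  · exact not_square_square hm hpq hpv hvq hp hq s1 s2
  · exact not_square_of_wanted hpq hpv s1 b1 b2 b3
  · exact not_square_of_wanted (P.R_symm hpq) (P.B_symm hvq) s2 a1 a2 a3
  · have hG : ∀ z, P.G v z → z = p ∨ z = q := fun z hz => by
      have := P.deg_snd v p q z (.inl (P.B_symm hpv)) (.inl hvq) (.inr hz)
      have := P.R_irrefl p
      grind
    have hpv' := P.B_symm hpv
    have hrp : P.R p₁ v := a3.resolve_right fun h => by
      have := P.not_B_G v
      rcases hG _ (P.G_symm h) with rfl | rfl
      · exact P.R_irrefl _ a2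
      · exact a1 rfl
    have hrq : P.R q₁ v := b3.resolve_right fun h => by
      rcases hG _ (P.G_symm h) with rfl | rfl
      · exact b1 rfl
      · exact P.R_irrefl _ b2
    have hne : p₁ ≠ q₁ := by
      rintro rfl
      exact P.tri_fst p q p₁ (.inl hpq) (.inl b2) (.inl a2)
    have : P.B p q₁ ∨ P.B q p₁ := by
      by_contra! h
      exact a4 ⟨hrp, .inr ⟨q, q₁, a1.symm, hpq, b2, hrq, hvq, h.1, h.2⟩⟩
    rcases this with h | h
    · exact n1 (locked_of_pentagon hm.1 hpq hpv hvq a2 a1 b2 hrp hrq a4 b4 h)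
    · exact n2 (locked_of_pentagon hm.1 (P.R_symm hpq) (P.B_symm hvq) (P.B_symm hpv) b2 b1 a2
        hrq hrp b4 a4 h)

/-- The red edge `e` is paired with the blue edge `d` at its second vertex. -/
def Red (P : ColoredPair V) (c : V → V × V) (d : V × V) (e : Sym2 V) : Prop :=
  ∃ z, P.Link c d.2 z d.1 ∧ e = s(d.2, z)

/-- The red edges paired with an edge in `S`. -/
def Partner (P : ColoredPair V) (c : V → V × V) (S : Set (Sym2 V)) (e : Sym2 V) : Prop :=
  ∃ d : V × V, s(d.1, d.2) ∈ S ∧ P.Red c d e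

/-- Adjacency after exchanging the edges in `S` and their partners. -/
def Exchanged (P : ColoredPair V) (c : V → V × V) (S : Set (Sym2 V)) (x y : V) : Prop :=
  (P.R x y ∨ P.G x y) ∧ ¬ P.Partner c S s(x, y) ∨ s(x, y) ∈ S

/-- A triangle with two edges in `S` and a red edge that survives the exchange. -/
def Fail (P : ColoredPair V) (c : V → V × V) (S : Set (Sym2 V)) (p v q p' : V) : Prop :=
  P.Link c p q p' ∧ P.Link c p' q p ∧ P.Link c q p' v ∧ s(p, v) ∈ S ∧ s(v, q) ∈ S ∧
    ¬ P.Partner c S s(p, q)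

lemma partner_of_link {S : Set (Sym2 V)} {x y z : V} (h : P.Link c y z x) (hS : s(x, y) ∈ S) :
    P.Partner c S s(y, z) :=
  ⟨(x, y), hS, z, h, rfl⟩

lemma exchanged_deg (hc : P.IsCenter c) {S : Set (Sym2 V)} (hS : ∀ x y, s(x, y) ∈ S → P.B x y)
    {x a b d : V} (ha : P.Exchanged c S x a) (hb : P.Exchanged c S x b)
    (hd : P.Exchanged c S x d) : a = b ∨ a = d ∨ b = d := by
  have fin : ∀ φ : V → V → Prop, (∀ y, P.Exchanged c S x y → ∃ y', φ y y') →
      (∀ y₁ y₂ y', φ y₁ y' → φ y₂ y' → y₁ = y₂) →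
      (∀ a' b' d', (∃ a, φ a a') → (∃ b, φ b b') → (∃ d, φ d d') → a' = b' ∨ a' = d' ∨ b' = d') →
      a = b ∨ a = d ∨ b = d := by
    intro φ h1 h2 h3
    obtain ⟨a', ha'⟩ := h1 a ha
    obtain ⟨b', hb'⟩ := h1 b hb
    obtain ⟨d', hd'⟩ := h1 d hd
    rcases h3 a' b' d' ⟨_, ha'⟩ ⟨_, hb'⟩ ⟨_, hd'⟩ with rfl | rfl | rfl
    · exact .inl (h2 _ _ _ ha' hb')
    · exact .inr (.inl (h2 _ _ _ ha' hd'))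
    · exact .inr (.inr (h2 _ _ _ hb' hd'))
  by_cases hall : ∀ y, P.B x y → ∃ z, P.Link c x z y
  · refine fin (fun y y' => (y = y' ∧ (P.R x y ∨ P.G x y) ∧ ¬ P.Partner c S s(x, y)) ∨
      s(x, y) ∈ S ∧ P.Link c x y' y) ?_ ?_ ?_
    · rintro y (⟨h1, h2⟩ | h)
      · exact ⟨y, .inl ⟨rfl, h1, h2⟩⟩
      · obtain ⟨z, hz⟩ := hall y (hS _ _ h)
        exact ⟨z, .inr ⟨h, hz⟩⟩
    · rintro y₁ y₂ y' (⟨rfl, h1, h2⟩ | ⟨h1, h2⟩) (⟨rfl, h3, h4⟩ | ⟨h3, h4⟩)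
      · rfl
      · exact absurd (partner_of_link h4 (Sym2.eq_swap ▸ h3)) h2
      · exact absurd (partner_of_link h2 (Sym2.eq_swap ▸ h1)) h4
      · exact h2.right_unique hc h4
    · have : ∀ a', (∃ a, (a = a' ∧ (P.R x a ∨ P.G x a) ∧ ¬ P.Partner c S s(x, a)) ∨
          s(x, a) ∈ S ∧ P.Link c x a' a) → P.R x a' ∨ P.G x a' := by
        rintro a' ⟨a, ⟨rfl, h, -⟩ | ⟨-, h⟩⟩
        exacts [h, .inl h.1]
      exact fun a' b' d' h1 h2 h3 => P.deg_fst x _ _ _ (this _ h1) (this _ h2) (this _ h3)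
  · push Not at hall
    obtain ⟨y₀, hy₀, hno⟩ := hall
    have hall : ∀ z, P.R x z → ∃ y, P.Link c x z y := fun z hz =>
      (exists_link hc hz hy₀).resolve_right fun ⟨z', h⟩ => hno z' h
    refine fin (fun y y' => (y = y' ∧ (s(x, y) ∈ S ∨ P.G x y)) ∨
      s(x, y') ∉ S ∧ P.Link c x y y') ?_ ?_ ?_
    · rintro y (⟨h1 | h1, h2⟩ | h)
      · obtain ⟨z, hz⟩ := hall y h1
        exact ⟨z, .inr ⟨fun h => h2 (partner_of_link hz (Sym2.eq_swap ▸ h)), hz⟩⟩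
      · exact ⟨y, .inl ⟨rfl, .inr h1⟩⟩
      · exact ⟨y, .inl ⟨rfl, .inl h⟩⟩
    · have := P.not_B_G x
      rintro y₁ y₂ y' (⟨rfl, h1⟩ | ⟨h1, h2⟩) (⟨rfl, h3⟩ | ⟨h3, h4⟩)
      · rfl
      · have := h4.2.1
        grind
      · have := h2.2.1
        grind
      · exact h2.left_unique hc h4
    · have : ∀ a', (∃ a, (a = a' ∧ (s(x, a) ∈ S ∨ P.G x a)) ∨
          s(x, a') ∉ S ∧ P.Link c x a a') → P.B x a' ∨ P.G x a' := by
        rintro a' ⟨a, ⟨rfl, h⟩ | ⟨-, h⟩⟩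
        exacts [h.imp_left (hS _ _), .inl h.2.1]
      exact fun a' b' d' h1 h2 h3 => P.deg_snd x _ _ _ (this _ h1) (this _ h2) (this _ h3)

lemma Exchanged.symm {S : Set (Sym2 V)} {x y : V} (h : P.Exchanged c S x y) :
    P.Exchanged c S y x := by
  unfold Exchanged at *
  rw [Sym2.eq_swap (a := y)]
  exact h.imp_left (And.imp_left (Or.imp P.R_symm P.G_symm))

lemma exists_fail (hm : P.Maximal c) {S : Set (Sym2 V)} (hS : ∀ x y, s(x, y) ∈ S → P.B x y)
    {x y z : V} (hxy : P.Exchanged c S x y) (hyz : P.Exchanged c S y z)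
    (hxz : P.Exchanged c S x z) : ∃ p v q p', P.Fail c S p v q p' := by
  have hsw : ∀ {x y : V}, s(x, y) ∈ S → s(y, x) ∈ S := fun h => Sym2.eq_swap ▸ h
  have hpw : ∀ {x y : V}, P.Partner c S s(x, y) → P.Partner c S s(y, x) :=
    fun h => Sym2.eq_swap ▸ h
  have one : ∀ x y z, (P.R x y ∨ P.G x y) → ¬ P.Partner c S s(x, y) → (P.R x z ∨ P.G x z) →
      ¬ P.Partner c S s(x, z) → s(y, z) ∈ S → False := by
    rintro x y z (h1 | h1) h2 (h3 | h3) h4 h5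
    · rcases hm.1.2.2 y x z (P.R_symm h1) h3 (hS _ _ h5) with h | h
      · exact h2 (hpw (partner_of_link h (hsw h5)))
      · exact h4 (hpw (partner_of_link h h5))
    · exact h2 (hpw (partner_of_link (hm.1.2.1 y x z (P.R_symm h1) (hS _ _ h5) (.inr h3)
        fun h => P.not_R_G _ _ h.1 h3) (hsw h5)))
    · exact h4 (hpw (partner_of_link (hm.1.2.1 z x y (P.R_symm h3) (P.B_symm (hS _ _ h5)) (.inr h1)
        fun h => P.not_R_G _ _ h.1 h1) h5))
    · exact P.tri_snd x y z (.inr h1) (.inl (hS _ _ h5)) (.inr h3)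
  have two : ∀ p v q, (P.R p q ∨ P.G p q) → ¬ P.Partner c S s(p, q) → s(p, v) ∈ S → s(v, q) ∈ S →
      ∃ p v q p', P.Fail c S p v q p' := by
    rintro p v q (h1 | h1) h2 h3 h4
    · rcases sat_or_locked hm h1 (hS _ _ h3) (hS _ _ h4) with h | h | ⟨p', k1, k2, k3⟩ |
        ⟨p', k1, k2, k3⟩
      · exact absurd (partner_of_link h (hsw h3)) h2
      · exact absurd (hpw (partner_of_link h h4)) h2
      · exact ⟨p, v, q, p', k1, k2, k3, h3, h4, h2⟩
      · exact ⟨q, v, p, p', k1, k2, k3, hsw h4, hsw h3, fun h => h2 (hpw h)⟩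
    · exact (P.tri_snd p v q (.inl (hS _ _ h3)) (.inl (hS _ _ h4)) (.inr h1)).elim
  have hs : ∀ {x y : V}, (P.R x y ∨ P.G x y) → (P.R y x ∨ P.G y x) := Or.imp P.R_symm P.G_symm
  rcases hxy with ⟨a1, a2⟩ | a <;> rcases hyz with ⟨b1, b2⟩ | b <;> rcases hxz with ⟨d1, d2⟩ | d
  · exact (P.tri_fst x y z a1 b1 d1).elim
  · exact (one y x z (hs a1) (fun h => a2 (hpw h)) b1 b2 d).elim
  · exact (one x y z a1 a2 d1 d2 b).elim
  · exact two x z y a1 a2 d (hsw b)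
  · exact (one z x y (hs d1) (fun h => d2 (hpw h)) (hs b1) (fun h => b2 (hpw h)) a).elim
  · exact two y x z b1 b2 (hsw a) d
  · exact two x y z d1 d2 a b
  · exact (P.tri_snd x y z (.inl (hS _ _ a)) (.inl (hS _ _ b)) (.inl (hS _ _ d))).elim

open Classical in
/-- The blue dart reached from the end of the blue dart `d` through a red edge paired at both
ends, oriented towards that red edge; or `d` itself if there is none. -/
noncomputable def gate (P : ColoredPair V) (c : V → V × V) (d : V × V) : V × V :=
  if h : ∃ e : V × V, P.Link c d.2 e.2 d.1 ∧ P.Link c e.2 d.2 e.1 then h.choose else d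

noncomputable def next (P : ColoredPair V) (c : V → V × V) (d : V × V) : V × V :=
  (P.gate c d).swap

lemma gate_eq (hc : P.IsCenter c) {d e : V × V} (h₁ : P.Link c d.2 e.2 d.1)
    (h₂ : P.Link c e.2 d.2 e.1) : P.gate c d = e := by
  have h : ∃ e : V × V, P.Link c d.2 e.2 d.1 ∧ P.Link c e.2 d.2 e.1 := ⟨e, h₁, h₂⟩
  rw [gate, dif_pos h]
  obtain ⟨k₁, k₂⟩ := h.choose_spec
  have h2 := k₁.left_unique hc h₁
  rw [h2] at k₂
  exact Prod.ext (k₂.right_unique hc h₂) h2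

lemma gate_spec {d : V × V} (h : P.gate c d ≠ d) :
    P.Link c d.2 (P.gate c d).2 d.1 ∧ P.Link c (P.gate c d).2 d.2 (P.gate c d).1 := by
  unfold gate at *
  split_ifs at * with h'
  · exact h'.choose_spec
  · exact absurd rfl h

lemma gate_gate (hc : P.IsCenter c) (d : V × V) : P.gate c (P.gate c d) = d := by
  by_cases h : P.gate c d = d
  · rw [h, h]
  · exact gate_eq hc (gate_spec h).2 (gate_spec h).1

lemma gate_swap_next (hc : P.IsCenter c) (d : V × V) : P.gate c (P.next c d).swap = d := by
  simp [next, gate_gate hc]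

lemma next_injective (hc : P.IsCenter c) : Function.Injective (P.next c) := fun d e h => by
  rw [← gate_swap_next hc d, ← gate_swap_next hc e, h]

lemma blue_of_gate_ne {d : V × V} (h : P.gate c d ≠ d) :
    P.B d.1 d.2 ∧ P.B (P.gate c d).1 (P.gate c d).2 :=
  ⟨P.B_symm (gate_spec h).1.2.1, P.B_symm (gate_spec h).2.2.1⟩

lemma blue_gate {d : V × V} (h : P.B d.1 d.2) : P.B (P.gate c d).1 (P.gate c d).2 := by
  by_cases hd : P.gate c d = d
  · rwa [hd]
  · exact (blue_of_gate_ne hd).2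

lemma blue_next {d : V × V} (h : P.B d.1 d.2) : P.B (P.next c d).1 (P.next c d).2 :=
  P.B_symm (blue_gate h)

lemma blue_iterate {d : V × V} (h : P.B d.1 d.2) (i : ℕ) :
    P.B ((P.next c)^[i] d).1 ((P.next c)^[i] d).2 := by
  induction i with
  | zero => exact h
  | succ i ih =>
    rw [Function.iterate_succ_apply']
    exact blue_next ih

lemma Red.unique (hc : P.IsCenter c) {d : V × V} {e e' : Sym2 V} (h : P.Red c d e)
    (h' : P.Red c d e') : e = e' := by
  obtain ⟨z, h, rfl⟩ := h
  obtain ⟨z', h', rfl⟩ := h'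
  rw [h.left_unique hc h']

lemma red_gate (hc : P.IsCenter c) (d : V × V) (e : Sym2 V) :
    P.Red c (P.gate c d) e ↔ P.Red c d e := by
  by_cases h : P.gate c d = d
  · rw [h]
  obtain ⟨h1, h2⟩ := gate_spec h
  constructor
  · intro h'
    have := Red.unique hc h' ⟨_, h2, rfl⟩
    exact ⟨_, h1, this.trans Sym2.eq_swap⟩
  · intro h'
    have := Red.unique hc h' ⟨_, h1, rfl⟩
    exact ⟨_, h2, this.trans Sym2.eq_swap⟩

lemma Red.eq_or_gate (hc : P.IsCenter c) {d d' : V × V} {e : Sym2 V} (h : P.Red c d e)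
    (h' : P.Red c d' e) : d' = d ∨ P.gate c d = d' := by
  obtain ⟨z, h, rfl⟩ := h
  obtain ⟨z', h', he⟩ := h'
  rcases Sym2.eq_iff.1 he with ⟨h1, h2⟩ | ⟨h1, h2⟩
  · rw [← h1, ← h2] at h'
    exact .inl (Prod.ext (h'.right_unique hc h) h1.symm)
  · refine .inr (gate_eq hc ?_ ?_)
    · rwa [← h2]
    · rwa [h1]

lemma ed_swap (d : V × V) : s(d.swap.1, d.swap.2) = s(d.1, d.2) := Sym2.eq_swap

lemma ed_eq_iff {d d' : V × V} : s(d.1, d.2) = s(d'.1, d'.2) ↔ d = d' ∨ d = d'.swap := by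
  rw [Sym2.eq_iff, Prod.ext_iff, Prod.ext_iff]
  rfl

/-- A walk along `next` that is never reflected does not turn back. -/
lemma iterate_ne_swap (hc : P.IsCenter c) {d : V × V} (hd : P.B d.1 d.2) {m : ℕ}
    (hg : ∀ i, i + 1 < m → P.gate c ((P.next c)^[i] d) ≠ (P.next c)^[i] d) {i j : ℕ}
    (hij : i ≤ j) (hj : j < m) : (P.next c)^[i] d ≠ ((P.next c)^[j] d).swap := by
  intro h
  induction hk : j - i using Nat.strong_induction_on generalizing i j with
  | _ k ih =>
    rcases hij.eq_or_lt with rfl | hlt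
    · have h1 := congrArg Prod.fst h
      have := blue_iterate (c := c) hd i
      rw [h1] at this
      exact P.B_irrefl _ this
    · obtain ⟨j, rfl⟩ : ∃ j', j = j' + 1 := ⟨j - 1, by omega⟩
      have h2 : P.gate c ((P.next c)^[i] d) = (P.next c)^[j] d := by
        rw [h, Function.iterate_succ_apply', gate_swap_next hc]
      rcases (Nat.lt_succ_iff.1 hlt).eq_or_lt with rfl | hlt'
      · exact hg i hj h2
      · refine ih (j - (i + 1)) (by omega) hlt' (by omega) ?_ rfl
        rw [Function.iterate_succ_apply', next, h2]

end ColoredPair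

section Trail

variable [DecidableEq V] {E : Finset (Sym2 V)}

/-- `F` is the edge set of a trail of length `k` from `a` to `b`. -/
def HasTrail (E : Finset (Sym2 V)) (a b : V) (k : ℕ) (F : Finset (Sym2 V)) : Prop :=
  ∃ u, IsTrail E k u ∧ u 0 = a ∧ u k = b ∧ trailEdges k u = F

lemma hasTrail_nil (a : V) : HasTrail E a a 0 ∅ :=
  ⟨fun _ => a, ⟨by simp, by simp⟩, rfl, rfl, by simp [trailEdges]⟩

lemma HasTrail.snoc {a b x : V} {k : ℕ} {F : Finset (Sym2 V)} (h : HasTrail E a b k F)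
    (hE : s(b, x) ∈ E) (hF : s(b, x) ∉ F) : HasTrail E a x (k + 1) (insert s(b, x) F) := by
  obtain ⟨u, ⟨h1, h2⟩, h3, h4, rfl⟩ := h
  have hu : ∀ i ≤ k, (if i ≤ k then u i else x) = u i := fun i hi => if_pos hi
  have hlast : (if k + 1 ≤ k then u (k + 1) else x) = x := if_neg (by omega)
  simp only [trailEdges, mem_image, Finset.mem_range, not_exists, not_and] at hF
  refine ⟨fun i => if i ≤ k then u i else x, ⟨fun i hi => ?_, fun i hi j hj he => ?_⟩, by simpa,
    hlast, ?_⟩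
  · rcases (Nat.lt_succ_iff.1 hi).eq_or_lt with rfl | hi
    · simpa [h4] using hE
    · simpa only [hu i hi.le, hu (i + 1) hi] using h1 i hi
  · dsimp only at he
    rcases (Nat.lt_succ_iff.1 hi).eq_or_lt with rfl | hi <;>
    rcases (Nat.lt_succ_iff.1 hj).eq_or_lt with rfl | hj
    · rfl
    · rw [hlast, hu i le_rfl, hu j hj.le, hu (j + 1) hj, h4] at he
      exact absurd he.symm (hF j hj)
    · rw [hlast, hu j le_rfl, hu i hi.le, hu (i + 1) hi, h4] at he
      exact absurd he (hF i hi)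
    · rw [hu i hi.le, hu (i + 1) hi, hu j hj.le, hu (j + 1) hj] at he
      exact h2 i hi j hj he
  · rw [trailEdges, Finset.range_add_one, image_insert, hlast, hu k le_rfl, h4]
    congr 1
    refine image_congr fun i hi => ?_
    have hi : i < k := by simpa using hi
    simp only [hu i hi.le, hu (i + 1) hi]

lemma HasTrail.reverse {a b : V} {k : ℕ} {F : Finset (Sym2 V)} (h : HasTrail E a b k F) :
    HasTrail E b a k F := by
  obtain ⟨u, ⟨h1, h2⟩, h3, h4, rfl⟩ := h
  have he : ∀ i < k, s(u (k - i), u (k - (i + 1))) = s(u (k - 1 - i), u (k - 1 - i + 1)) := by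
    intro i hi
    rw [Sym2.eq_swap, show k - (i + 1) = k - 1 - i by omega, show k - i = k - 1 - i + 1 by omega]
  refine ⟨fun i => u (k - i), ⟨fun i hi => ?_, fun i hi j hj h => ?_⟩, by simpa, by simpa, ?_⟩
  · rw [he i hi]
    exact h1 _ (by omega)
  · rw [he i hi, he j hj] at h
    have := h2 _ (by omega) _ (by omega) h
    omega
  · ext e
    simp only [trailEdges, mem_image, Finset.mem_range]
    constructor
    · rintro ⟨i, hi, rfl⟩
      exact ⟨k - 1 - i, by omega, (he i hi).symm⟩
    · rintro ⟨i, hi, rfl⟩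
      refine ⟨k - 1 - i, by omega, ?_⟩
      rw [he _ (by omega), show k - 1 - (k - 1 - i) = i by omega]

end Trail

/-- The weight change caused by exchanging the edges in `F`. -/
def exchangeValue [DecidableEq V] (A : Finset (Sym2 V)) (w : Sym2 V → ℚ) (F : Finset (Sym2 V)) :
    ℚ :=
  ∑ e ∈ F, if e ∈ A then -w e else w e

namespace ColoredPair

variable {P : ColoredPair V} {c : V → V × V}

open Classical in
noncomputable def cost [Fintype V] (P : ColoredPair V) (c : V → V × V) (w : Sym2 V → ℚ)
    (d : V × V) : ℚ :=
  ∑ z, if P.Link c d.2 z d.1 then w s(d.2, z) else 0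

open Classical in
noncomputable def gain (P : ColoredPair V) (w : Sym2 V → ℚ) (d : V × V) : ℚ :=
  if P.B d.1 d.2 then w s(d.1, d.2) else 0

lemma cost_of_red [Fintype V] (hc : P.IsCenter c) {w : Sym2 V → ℚ} {d : V × V} {e : Sym2 V}
    (h : P.Red c d e) : P.cost c w d = w e := by
  obtain ⟨z, h, rfl⟩ := h
  rw [cost, Finset.sum_eq_single z, if_pos h]
  · exact fun z' _ hz => if_neg fun h' => hz (h'.left_unique hc h)
  · simp

lemma cost_of_not_red [Fintype V] {w : Sym2 V → ℚ} {d : V × V}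
    (h : ∀ e, ¬ P.Red c d e) : P.cost c w d = 0 :=
  Finset.sum_eq_zero fun z _ => if_neg fun h' => h _ ⟨z, h', rfl⟩

lemma cost_gate [Fintype V] (hc : P.IsCenter c) (w : Sym2 V → ℚ) (d : V × V) :
    P.cost c w (P.gate c d) = P.cost c w d := by
  by_cases h : ∃ e, P.Red c d e
  · obtain ⟨e, h⟩ := h
    rw [cost_of_red hc h, cost_of_red hc ((red_gate hc d e).2 h)]
  · rw [not_exists] at h
    rw [cost_of_not_red h, cost_of_not_red fun e => by rw [red_gate hc]; exact h e]

lemma cost_nonneg [Fintype V] {w : Sym2 V → ℚ} (hw : ∀ e, 0 ≤ w e) (d : V × V) :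
    0 ≤ P.cost c w d :=
  Finset.sum_nonneg fun z _ => by split_ifs <;> simp [hw]

lemma gain_nonneg {w : Sym2 V → ℚ} (hw : ∀ e, 0 ≤ w e) (d : V × V) : 0 ≤ P.gain w d := by
  unfold gain
  split_ifs <;> simp [hw]

lemma Red.ne_of_lt (hc : P.IsCenter c) {d : V × V} (hd : P.B d.1 d.2) {m : ℕ}
    (hinj : ∀ i ≤ m, ∀ j ≤ m, s(((P.next c)^[i] d).1, ((P.next c)^[i] d).2) =
      s(((P.next c)^[j] d).1, ((P.next c)^[j] d).2) → i = j) {i j : ℕ} (hij : i < j)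
    (hj : j ≤ m) {e : Sym2 V} (h : P.Red c ((P.next c)^[i] d) e) :
    ¬ P.Red c ((P.next c)^[j] d) e := by
  intro h'
  rcases h.eq_or_gate hc h' with h1 | h1
  · exact hij.ne' (hinj j hj i (by omega) (by rw [h1]))
  · have h2 : (P.next c)^[j] d = ((P.next c)^[i + 1] d).swap := by
      rw [Function.iterate_succ_apply', next, h1, Prod.swap_swap]
    obtain rfl := hinj j hj (i + 1) (by omega) (by rw [h2, ed_swap])
    have h3 := blue_iterate (c := c) hd (i + 1)
    rw [show ((P.next c)^[i + 1] d).1 = ((P.next c)^[i + 1] d).2 from congrArg Prod.fst h2] at h3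
    exact P.B_irrefl _ h3

lemma red_mem {A E : Finset (Sym2 V)} (hR : ∀ x y, P.R x y → s(x, y) ∈ E ∧ s(x, y) ∈ A)
    {d : V × V} {e : Sym2 V} (h : P.Red c d e) : e ∈ E ∧ e ∈ A := by
  obtain ⟨z, h, rfl⟩ := h
  exact hR _ _ h.1

lemma gain_of_blue (w : Sym2 V → ℚ) {d : V × V} (hd : P.B d.1 d.2) :
    P.gain w d = w s(d.1, d.2) := if_pos hd

section Segment

variable [DecidableEq V] [Fintype V] {A E : Finset (Sym2 V)} {w : Sym2 V → ℚ}

/-- The trail traversed by the first `m + 1` blue edges of a walk that is not reflected. -/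
lemma exists_segment (hc : P.IsCenter c)
    (hR : ∀ x y, P.R x y → s(x, y) ∈ E ∧ s(x, y) ∈ A)
    (hB : ∀ x y, P.B x y → s(x, y) ∈ E ∧ s(x, y) ∉ A) {d : V × V} (hd : P.B d.1 d.2) (m : ℕ)
    (hg : ∀ i < m, P.gate c ((P.next c)^[i] d) ≠ (P.next c)^[i] d)
    (hinj : ∀ i ≤ m, ∀ j ≤ m, s(((P.next c)^[i] d).1, ((P.next c)^[i] d).2) =
      s(((P.next c)^[j] d).1, ((P.next c)^[j] d).2) → i = j) :
    ∃ F, HasTrail E d.1 ((P.next c)^[m] d).2 (2 * m + 1) F ∧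
      (∀ e, e ∈ F ↔ (∃ i ≤ m, e = s(((P.next c)^[i] d).1, ((P.next c)^[i] d).2)) ∨
        ∃ i < m, P.Red c ((P.next c)^[i] d) e) ∧
      exchangeValue A w F = ∑ i ∈ range (m + 1), P.gain w ((P.next c)^[i] d) -
        ∑ i ∈ range m, P.cost c w ((P.next c)^[i] d) := by
  induction m with
  | zero =>
    refine ⟨_, (hasTrail_nil d.1).snoc (hB _ _ hd).1 (by simp), by simp, ?_⟩
    simp [exchangeValue, (hB _ _ hd).2, gain, hd]
  | succ m ih =>
    obtain ⟨F, hF, hmem, hval⟩ := ih (fun i hi => hg i (by omega))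
      (fun i hi j hj => hinj i (by omega) j (by omega))
    have hd' := blue_iterate (c := c) hd (m + 1)
    have hblue : ∀ i, s(((P.next c)^[i] d).1, ((P.next c)^[i] d).2) ∉ A := fun i =>
      (hB _ _ (blue_iterate hd i)).2
    have hlink := (gate_spec (hg m (by omega))).1
    have hred : P.Red c ((P.next c)^[m] d) s(((P.next c)^[m] d).2, ((P.next c)^[m + 1] d).1) := by
      rw [Function.iterate_succ_apply']
      exact ⟨_, hlink, rfl⟩
    have hA := red_mem hR hred
    have h1 : s(((P.next c)^[m] d).2, ((P.next c)^[m + 1] d).1) ∉ F := by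
      rw [hmem]
      rintro (⟨i, -, h⟩ | ⟨i, hi, h⟩)
      · exact hblue i (h ▸ hA.2)
      · exact h.ne_of_lt hc hd hinj hi (by omega) hred
    have h2 : s(((P.next c)^[m + 1] d).1, ((P.next c)^[m + 1] d).2) ∉
        insert s(((P.next c)^[m] d).2, ((P.next c)^[m + 1] d).1) F := by
      rw [Finset.mem_insert, hmem]
      rintro (h | ⟨i, hi, h⟩ | ⟨i, hi, h⟩)
      · exact hblue (m + 1) (h ▸ hA.2)
      · exact absurd (hinj _ le_rfl _ (by omega) h) (by omega)
      · exact hblue (m + 1) (red_mem hR h).2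
    refine ⟨_, (hF.snoc hA.1 h1).snoc (hB _ _ hd').1 h2, fun e => ?_, ?_⟩
    · rw [Finset.mem_insert, Finset.mem_insert, hmem]
      constructor
      · rintro (rfl | rfl | ⟨i, hi, h⟩ | ⟨i, hi, h⟩)
        · exact .inl ⟨m + 1, le_rfl, rfl⟩
        · exact .inr ⟨m, by omega, hred⟩
        · exact .inl ⟨i, by omega, h⟩
        · exact .inr ⟨i, by omega, h⟩
      · rintro (⟨i, hi, rfl⟩ | ⟨i, hi, h⟩)
        · rcases Nat.lt_or_eq_of_le hi with hi | rfl
          · exact .inr (.inr (.inl ⟨i, by omega, rfl⟩))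
          · exact .inl rfl
        · rcases Nat.lt_or_eq_of_le (Nat.lt_succ_iff.1 hi) with hi | rfl
          · exact .inr (.inr (.inr ⟨i, hi, h⟩))
          · exact .inr (.inl (h.unique hc hred))
    · rw [exchangeValue, Finset.sum_insert h2, Finset.sum_insert h1, if_neg (hblue _),
        if_pos hA.2, ← exchangeValue, hval, Finset.sum_range_succ _ (m + 1),
        Finset.sum_range_succ (fun i => P.cost c w ((P.next c)^[i] d)), gain_of_blue w hd',
        cost_of_red hc hred]
      ring

lemma exists_extend (hc : P.IsCenter c)
    (hR : ∀ x y, P.R x y → s(x, y) ∈ E ∧ s(x, y) ∈ A) {a : V} {k : ℕ} {F : Finset (Sym2 V)}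
    {d : V × V} (hF : HasTrail E a d.2 k F) (hn : ∀ e, P.Red c d e → e ∉ F) :
    ∃ b k' F', k' ≤ k + 1 ∧ HasTrail E a b k' F' ∧ (∀ e, e ∈ F' ↔ e ∈ F ∨ P.Red c d e) ∧
      exchangeValue A w F' = exchangeValue A w F - P.cost c w d := by
  by_cases h : ∃ e, P.Red c d e
  · obtain ⟨e, h⟩ := h
    have h' := h
    obtain ⟨z, hz, rfl⟩ := h'
    have hA := red_mem hR h
    refine ⟨_, _, _, le_rfl, hF.snoc hA.1 (hn _ h), fun e => ?_, ?_⟩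
    · rw [Finset.mem_insert, or_comm]
      exact or_congr_right ⟨fun he => he ▸ h, fun he => he.unique hc h⟩
    · rw [exchangeValue, Finset.sum_insert (hn _ h), if_pos hA.2, ← exchangeValue,
        cost_of_red hc h]
      ring
  · rw [not_exists] at h
    exact ⟨_, _, F, k.le_succ, hF, by simp [h], by simp [cost_of_not_red h]⟩

end Segment

/-- The blue edges met by the first `m` steps of the walk from `d`. -/
def walkEdges (P : ColoredPair V) (c : V → V × V) (d : V × V) (m : ℕ) : Set (Sym2 V) :=
  {e | ∃ i ≤ m, e = s(((P.next c)^[i] d).1, ((P.next c)^[i] d).2)}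

/-- The first `m` steps of the walk from `d` are neither reflected nor periodic. -/
def Free (P : ColoredPair V) (c : V → V × V) (d : V × V) (m : ℕ) : Prop :=
  (∀ i < m, P.gate c ((P.next c)^[i] d) ≠ (P.next c)^[i] d) ∧
    ∀ n, 0 < n → n ≤ m + 1 → (P.next c)^[n] d ≠ d

lemma Free.dropLast {d : V × V} {m : ℕ} (h : P.Free c d (m + 1)) : P.Free c d m :=
  ⟨fun i hi => h.1 i (by omega), fun n hn hm => h.2 n hn (by omega)⟩

lemma Free.tail (hc : P.IsCenter c) {d : V × V} {m : ℕ} (h : P.Free c d (m + 1)) :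
    P.Free c (P.next c d) m := by
  refine ⟨fun i hi => ?_, fun n hn hm he => h.2 n hn (by omega) (next_injective hc ?_)⟩
  · rw [← Function.iterate_succ_apply]
    exact h.1 (i + 1) (by omega)
  · rwa [← Function.iterate_succ_apply, Function.iterate_succ_apply'] at he

lemma walk_injective (hc : P.IsCenter c) {d : V × V} (hd : P.B d.1 d.2) {m : ℕ}
    (hg : ∀ i < m, P.gate c ((P.next c)^[i] d) ≠ (P.next c)^[i] d)
    (hp : ∀ n, 0 < n → n ≤ m → (P.next c)^[n] d ≠ d) :
    ∀ i ≤ m, ∀ j ≤ m, s(((P.next c)^[i] d).1, ((P.next c)^[i] d).2) =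
      s(((P.next c)^[j] d).1, ((P.next c)^[j] d).2) → i = j := by
  intro i hi j hj h
  wlog hij : i ≤ j generalizing i j
  · exact (this j hj i hi h.symm (by omega)).symm
  rcases ed_eq_iff.1 h with h | h
  · by_contra hne
    obtain ⟨n, rfl⟩ : ∃ n, j = i + n := ⟨j - i, by omega⟩
    rw [Function.iterate_add_apply] at h
    exact hp n (by omega) (by omega) ((next_injective hc).iterate i h).symm
  · exact absurd h (iterate_ne_swap hc hd (m := m + 1) (fun k hk => hg k (by omega)) hij (by omega))

lemma blue_of_mem_walkEdges {d : V × V} (hd : P.B d.1 d.2) {m : ℕ} {x y : V}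
    (h : s(x, y) ∈ P.walkEdges c d m) : P.B x y := by
  obtain ⟨i, -, h⟩ := h
  have hb := blue_iterate (c := c) hd i
  rcases Sym2.eq_iff.1 h with ⟨rfl, rfl⟩ | ⟨rfl, rfl⟩
  exacts [hb, P.B_symm hb]

lemma partner_walkEdges (hc : P.IsCenter c) {d : V × V} {m : ℕ} {e : Sym2 V} :
    P.Partner c (P.walkEdges c d m) e ↔
      P.Red c d.swap e ∨ ∃ i ≤ m, P.Red c ((P.next c)^[i] d) e := by
  constructor
  · rintro ⟨d', ⟨i, hi, h⟩, hr⟩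
    rcases ed_eq_iff.1 h with rfl | rfl
    · exact .inr ⟨i, hi, hr⟩
    · cases i with
      | zero => exact .inl hr
      | succ i =>
        rw [Function.iterate_succ_apply', next, Prod.swap_swap, red_gate hc] at hr
        exact .inr ⟨i, by omega, hr⟩
  · rintro (h | ⟨i, hi, h⟩)
    · exact ⟨_, ⟨0, by omega, ed_swap d⟩, h⟩
    · exact ⟨_, ⟨i, hi, rfl⟩, h⟩

lemma Fail.gate_eq (hc : P.IsCenter c) {S : Set (Sym2 V)} {p v q p' : V}
    (h : P.Fail c S p v q p') : P.gate c (v, q) = (p, p') ∧ P.gate c (v, q) ≠ (v, q) ∧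
      s(p', p) ∉ S := by
  obtain ⟨h1, h2, h3, -, -, h6⟩ := h
  have hg : P.gate c (v, q) = (p, p') := ColoredPair.gate_eq hc h3 h2
  refine ⟨hg, ?_, fun h => h6 (partner_of_link h1 h)⟩
  rw [hg]
  intro h
  obtain ⟨rfl, rfl⟩ := Prod.mk.inj h
  exact P.R_irrefl _ h3.1

lemma Fail.not_fail (hc : P.IsCenter c) {S S' : Set (Sym2 V)}
    (hS : ∀ x y, s(x, y) ∈ S → P.B x y) (hSS : S' ⊆ S) {p v q p' a b x a' : V}
    (h : P.Fail c S p v q p') (h' : P.Fail c S' a b x a') (hn : P.next c (b, x) = (v, q)) :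
    False := by
  rw [next, (h'.gate_eq hc).1] at hn
  obtain ⟨rfl, rfl⟩ := Prod.mk.inj hn
  obtain ⟨h1, h2, h3, h4, h5, h6⟩ := h
  obtain ⟨k1, k2, k3, k4, k5, k6⟩ := h'
  obtain rfl := k1.left_unique hc h3
  have hb := hS _ _ (hSS k4)
  have hpp : p ≠ x := by
    rintro rfl
    exact P.B_irrefl _ h1.2.1
  have hbv : b ≠ a' := by
    rintro rfl
    exact P.not_R_B _ _ k3.1 k3.2.1
  have := h3.other hc (P.R_symm h1.1) hb hpp hbv
  exact h6 (Sym2.eq_swap ▸ partner_of_link this (Sym2.eq_swap ▸ hSS k4))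

/-- A failure along a walk happens at the last or at the first edge. -/
lemma Fail.eq_last_or_first (hc : P.IsCenter c) {d : V × V} {m : ℕ} {p v q p' : V}
    (h : P.Fail c (P.walkEdges c d m) p v q p') : (v, q) = (P.next c)^[m] d ∨ (v, q) = d.swap := by
  obtain ⟨hg, -, hn⟩ := h.gate_eq hc
  obtain ⟨i, hi, he⟩ := h.2.2.2.2.1
  rcases ed_eq_iff (d := (v, q)).1 he with he | he
  · rcases hi.eq_or_lt with rfl | hi
    · exact .inl he
    · refine absurd ⟨i + 1, hi, ?_⟩ hn
      rw [Function.iterate_succ_apply', ← he, next, hg]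
      rfl
  · cases i with
    | zero => exact .inr he
    | succ i =>
      refine absurd ⟨i, by omega, ?_⟩ hn
      rw [Function.iterate_succ_apply', next, Prod.swap_swap] at he
      rw [← gate_gate hc ((P.next c)^[i] d), ← he, hg]
      exact Sym2.eq_swap

lemma Fail.pos {d : V × V} {m : ℕ} {p v q p' : V}
    (h : P.Fail c (P.walkEdges c d m) p v q p') : 0 < m := by
  by_contra hm
  obtain ⟨i, hi, he⟩ := h.2.2.2.1
  obtain ⟨j, hj, he'⟩ := h.2.2.2.2.1
  obtain rfl : i = 0 := by omega
  obtain rfl : j = 0 := by omega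
  have hpq : p ≠ q := by
    rintro rfl
    exact P.R_irrefl _ h.1.1
  rcases Sym2.eq_iff.1 (he.trans he'.symm) with ⟨rfl, rfl⟩ | ⟨h, -⟩
  · exact hpq rfl
  · exact hpq h

lemma walkEdges_mono {d : V × V} {m n : ℕ} (h : m ≤ n) :
    P.walkEdges c d m ⊆ P.walkEdges c d n :=
  fun _ ⟨i, hi, he⟩ => ⟨i, hi.trans h, he⟩

lemma walkEdges_next (d : V × V) (m : ℕ) :
    P.walkEdges c (P.next c d) m ⊆ P.walkEdges c d (m + 1) :=
  fun _ ⟨i, hi, he⟩ => ⟨i + 1, by omega, he⟩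

/-- No trail of length at most `k` that alternately exchanges blue edges and their partners
without leaving a failure has positive value. -/
def LocallyOptimal [DecidableEq V] (P : ColoredPair V) (c : V → V × V) (A E : Finset (Sym2 V))
    (w : Sym2 V → ℚ) (l : ℕ) : Prop :=
  ∀ a b k F (S : Set (Sym2 V)), HasTrail E a b k F → k ≤ l → (∀ x y, s(x, y) ∈ S → P.B x y) →
    (∀ e, e ∈ F ↔ e ∈ S ∨ P.Partner c S e) → (∀ p v q p', ¬ P.Fail c S p v q p') →
    exchangeValue A w F ≤ 0

open Classical in
/-- The gain from a dart at the end of a window, if it may have to be dropped. -/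
noncomputable def loss (P : ColoredPair V) (c : V → V × V) (w : Sym2 V → ℚ) (d : V × V) : ℚ :=
  if P.gate c d = d then 0 else P.gain w d

open Classical in
/-- The cost of passing the end of a dart, in both directions if the walk is reflected. -/
noncomputable def toll [Fintype V] (P : ColoredPair V) (c : V → V × V) (w : Sym2 V → ℚ)
    (d : V × V) : ℚ :=
  if P.gate c d = d then 2 * P.cost c w d else P.cost c w d

lemma gain_swap (w : Sym2 V → ℚ) (d : V × V) : P.gain w d.swap = P.gain w d := by
  by_cases h : P.B d.1 d.2
  · rw [gain_of_blue w h, gain_of_blue w (P.B_symm h), ed_swap]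
  · rw [gain, gain, if_neg h, if_neg (show ¬ P.B d.swap.1 d.swap.2 from fun h' => h (P.B_symm h'))]

lemma cost_next_swap [Fintype V] (hc : P.IsCenter c) (w : Sym2 V → ℚ) (d : V × V) :
    P.cost c w (P.next c d).swap = P.cost c w d := cost_gate hc w d

lemma loss_nonneg {w : Sym2 V → ℚ} (hw : ∀ e, 0 ≤ w e) (d : V × V) : 0 ≤ P.loss c w d := by
  unfold loss
  split_ifs
  exacts [le_rfl, gain_nonneg hw d]

lemma loss_le_gain {w : Sym2 V → ℚ} (hw : ∀ e, 0 ≤ w e) (d : V × V) :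
    P.loss c w d ≤ P.gain w d := by
  unfold loss
  split_ifs
  exacts [gain_nonneg hw d, le_rfl]

lemma cost_le_toll [Fintype V] {w : Sym2 V → ℚ} (hw : ∀ e, 0 ≤ w e) (d : V × V) :
    P.cost c w d ≤ P.toll c w d := by
  have := cost_nonneg (P := P) (c := c) hw d
  unfold toll
  split_ifs <;> linarith

lemma Fail.loss_eq (hc : P.IsCenter c) {S : Set (Sym2 V)} {p v q p' : V}
    (h : P.Fail c S p v q p') (w : Sym2 V → ℚ) : P.loss c w (v, q) = P.gain w (v, q) :=
  if_neg (h.gate_eq hc).2.1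

section Window

variable [DecidableEq V] [Fintype V] {A E : Finset (Sym2 V)} {w : Sym2 V → ℚ} {M : ℕ}

lemma segment_bound (hc : P.IsCenter c)
    (hR : ∀ x y, P.R x y → s(x, y) ∈ E ∧ s(x, y) ∈ A)
    (hB : ∀ x y, P.B x y → s(x, y) ∈ E ∧ s(x, y) ∉ A)
    (hopt : P.LocallyOptimal c A E w (2 * M + 1)) {d : V × V} (hd : P.B d.1 d.2) {m : ℕ}
    (hm : m + 1 ≤ M) (hF : P.Free c d m)
    (hfail : ∀ p v q p', ¬ P.Fail c (P.walkEdges c d m) p v q p') :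
    ∑ i ∈ range (m + 1), P.gain w ((P.next c)^[i] d) ≤ P.cost c w d.swap +
      ∑ i ∈ range m, P.cost c w ((P.next c)^[i] d) + P.cost c w ((P.next c)^[m] d) := by
  have hinj := walk_injective hc hd hF.1 fun n hn hm => hF.2 n hn (by omega)
  obtain ⟨F, hT, hmem, hval⟩ := exists_segment hc hR hB hd m hF.1 hinj (w := w)
  have hblue : ∀ i, s(((P.next c)^[i] d).1, ((P.next c)^[i] d).2) ∉ A := fun i =>
    (hB _ _ (blue_iterate hd i)).2
  obtain ⟨b, k, F', hk, hT', hmem', hval'⟩ := exists_extend hc hR hT (w := w) fun e he => by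
    rw [hmem]
    rintro (⟨i, -, rfl⟩ | ⟨i, hi, h⟩)
    · exact hblue i (red_mem hR he).2
    · exact h.ne_of_lt hc hd hinj hi le_rfl he
  have hmem' : ∀ e, e ∈ F' ↔ e ∈ P.walkEdges c d m ∨ ∃ i ≤ m, P.Red c ((P.next c)^[i] d) e := by
    intro e
    rw [hmem', hmem, or_assoc]
    refine or_congr_right ⟨?_, ?_⟩
    · rintro (⟨i, hi, h⟩ | h)
      exacts [⟨i, hi.le, h⟩, ⟨m, le_rfl, h⟩]
    · rintro ⟨i, hi, h⟩
      rcases hi.eq_or_lt with rfl | hi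
      exacts [.inr h, .inl ⟨i, hi, h⟩]
  obtain ⟨b', k', F'', hk', hT'', hmem'', hval''⟩ :=
    exists_extend (d := d.swap) hc hR hT'.reverse (w := w) fun e he => by
      rw [hmem']
      rintro (⟨i, -, rfl⟩ | ⟨i, hi, h⟩)
      · exact hblue i (red_mem hR he).2
      · rcases h.eq_or_gate hc he with h | h
        · exact iterate_ne_swap hc hd (m := m + 1) (fun k hk => hF.1 k (by omega)) i.zero_le
            (by omega) (by rw [← h, Prod.swap_swap]; rfl)
        · refine hF.2 (i + 1) (by omega) (by omega) ?_
          rw [Function.iterate_succ_apply', next, h, Prod.swap_swap]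
  have := hopt _ _ _ F'' (P.walkEdges c d m) hT'' (by omega) (fun x y => blue_of_mem_walkEdges hd)
    (fun e => by
      rw [hmem'', hmem', partner_walkEdges hc, or_assoc]
      exact or_congr_right or_comm) hfail
  linarith

lemma cycle_bound (hc : P.IsCenter c)
    (hR : ∀ x y, P.R x y → s(x, y) ∈ E ∧ s(x, y) ∈ A)
    (hB : ∀ x y, P.B x y → s(x, y) ∈ E ∧ s(x, y) ∉ A)
    (hopt : P.LocallyOptimal c A E w (2 * M + 1)) {d : V × V} (hd : P.B d.1 d.2) {m : ℕ}
    (hm : m + 1 ≤ M) (hg : ∀ i < m, P.gate c ((P.next c)^[i] d) ≠ (P.next c)^[i] d)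
    (hp : ∀ n, 0 < n → n ≤ m → (P.next c)^[n] d ≠ d) (hn : (P.next c)^[m + 1] d = d) :
    ∑ i ∈ range (m + 1), P.gain w ((P.next c)^[i] d) ≤
      ∑ i ∈ range (m + 1), P.cost c w ((P.next c)^[i] d) := by
  have hinj := walk_injective hc hd hg hp
  obtain ⟨F, hT, hmem, hval⟩ := exists_segment hc hR hB hd m hg hinj (w := w)
  have hblue : ∀ i, s(((P.next c)^[i] d).1, ((P.next c)^[i] d).2) ∉ A := fun i =>
    (hB _ _ (blue_iterate hd i)).2
  obtain ⟨b, k, F', hk, hT', hmem', hval'⟩ := exists_extend hc hR hT (w := w) fun e he => by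
    rw [hmem]
    rintro (⟨i, -, rfl⟩ | ⟨i, hi, h⟩)
    · exact hblue i (red_mem hR he).2
    · exact h.ne_of_lt hc hd hinj hi le_rfl he
  have hgate : P.gate c ((P.next c)^[m] d) = d.swap := by
    conv_rhs => rw [← hn, Function.iterate_succ_apply', next, Prod.swap_swap]
  have := hopt _ _ _ F' (P.walkEdges c d m) hT' (by omega) (fun x y => blue_of_mem_walkEdges hd)
    (fun e => by
      rw [hmem', hmem, partner_walkEdges hc, or_assoc, ← hgate, red_gate hc]
      refine or_congr_right ⟨?_, ?_⟩
      · rintro (⟨i, hi, h⟩ | h)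
        exacts [.inr ⟨i, hi.le, h⟩, .inl h]
      · rintro (h | ⟨i, hi, h⟩)
        · exact .inr h
        · rcases hi.eq_or_lt with rfl | hi
          exacts [.inr h, .inl ⟨i, hi, h⟩])
    (fun p v q p' h => by
      obtain ⟨h1, -, h3⟩ := h.gate_eq hc
      refine h3 ?_
      rcases h.eq_last_or_first hc with h2 | h2
      · rw [h2, hgate] at h1
        obtain ⟨rfl, rfl⟩ := Prod.mk.inj h1
        exact ⟨0, by omega, rfl⟩
      · rw [h2, ← hgate, gate_gate hc] at h1
        exact ⟨m, le_rfl, by rw [h1]; exact Sym2.eq_swap⟩)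
  rw [Finset.sum_range_succ (fun i => P.cost c w ((P.next c)^[i] d))]
  linarith

/-- Failures cannot persist when a window that is neither reflected nor periodic is shrunk by one
dart at either end. -/
lemma free_bound (hc : P.IsCenter c) (hw : ∀ e, 0 ≤ w e)
    (hR : ∀ x y, P.R x y → s(x, y) ∈ E ∧ s(x, y) ∈ A)
    (hB : ∀ x y, P.B x y → s(x, y) ∈ E ∧ s(x, y) ∉ A)
    (hopt : P.LocallyOptimal c A E w (2 * M + 1)) {d : V × V} (hd : P.B d.1 d.2) {m : ℕ}
    (hm : m + 1 ≤ M) (hF : P.Free c d m) :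
    ∑ i ∈ range (m + 1), P.gain w ((P.next c)^[i] d) ≤
      P.loss c w d.swap + P.loss c w ((P.next c)^[m] d) + P.cost c w d.swap +
      ∑ i ∈ range m, P.cost c w ((P.next c)^[i] d) + P.cost c w ((P.next c)^[m] d) := by
  have hl1 := loss_nonneg (P := P) (c := c) hw d.swap
  have hl2 := loss_nonneg (P := P) (c := c) hw ((P.next c)^[m] d)
  have hc1 := cost_nonneg (P := P) (c := c) hw d.swap
  have hc2 := cost_nonneg (P := P) (c := c) hw ((P.next c)^[m] d)
  by_cases h0 : ∀ p v q p', ¬ P.Fail c (P.walkEdges c d m) p v q p'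
  · have := segment_bound hc hR hB hopt hd hm hF h0
    linarith
  push Not at h0
  obtain ⟨p, v, q, p', h0⟩ := h0
  obtain ⟨m, rfl⟩ : ∃ n, m = n + 1 := ⟨m - 1, by have := h0.pos; omega⟩
  have hd1 := blue_next (c := c) hd
  have hS : ∀ x y, s(x, y) ∈ P.walkEdges c d (m + 1) → P.B x y :=
    fun x y => blue_of_mem_walkEdges hd
  have hsub := walkEdges_mono (P := P) (c := c) (d := d) m.le_succ
  have hsub' := walkEdges_next (P := P) (c := c) d m
  have hgs := gain_swap (P := P) w d
  rw [Finset.sum_range_succ _ (m + 1)]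
  rcases h0.eq_last_or_first hc with hv | hv
  · have hl := h0.loss_eq hc w
    rw [hv] at hl
    by_cases h1 : ∀ p v q p', ¬ P.Fail c (P.walkEdges c d m) p v q p'
    · have := segment_bound hc hR hB hopt hd (by omega) hF.dropLast h1
      rw [Finset.sum_range_succ (fun i => P.cost c w ((P.next c)^[i] d))]
      linarith
    push Not at h1
    obtain ⟨p₁, v₁, q₁, p₁', h1⟩ := h1
    have hv1 := (h1.eq_last_or_first hc).resolve_left fun h => h0.not_fail hc hS hsub h1 (by
      rw [h, hv, Function.iterate_succ_apply'])
    have hl' := h1.loss_eq hc w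
    rw [hv1] at hl'
    obtain ⟨m, rfl⟩ : ∃ n, m = n + 1 := ⟨m - 1, by have := h1.pos; omega⟩
    have h2 : ∀ p v q p', ¬ P.Fail c (P.walkEdges c (P.next c d) m) p v q p' := by
      intro p₂ v₂ q₂ p₂' h2
      have hsub2 := walkEdges_next (P := P) (c := c) d m
      rcases h2.eq_last_or_first hc with hv2 | hv2
      · refine h0.not_fail hc hS (hsub2.trans hsub) h2 ?_
        rw [hv2, hv, ← Function.iterate_succ_apply, Function.iterate_succ_apply' _ (m + 1)]
      · refine h1.not_fail hc (fun x y => blue_of_mem_walkEdges hd) hsub2 h2 ?_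
        rw [hv1, hv2, next, gate_swap_next hc]
    have := segment_bound hc hR hB hopt hd1 (by omega) (hF.dropLast.tail hc) h2
    simp only [← Function.iterate_succ_apply, cost_next_swap hc, Nat.succ_eq_add_one] at this
    rw [Finset.sum_range_succ', Finset.sum_range_succ' (fun i => P.cost c w ((P.next c)^[i] d)),
      Finset.sum_range_succ (fun i => P.cost c w ((P.next c)^[i + 1] d))]
    simp only [Function.iterate_zero, id]
    have := cost_nonneg (P := P) (c := c) hw ((P.next c)^[m + 1] d)
    linarith
  · have hl := h0.loss_eq hc w
    rw [hv] at hl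
    by_cases h1 : ∀ p v q p', ¬ P.Fail c (P.walkEdges c (P.next c d) m) p v q p'
    · have := segment_bound hc hR hB hopt hd1 (by omega) (hF.tail hc) h1
      simp only [← Function.iterate_succ_apply, cost_next_swap hc, Nat.succ_eq_add_one] at this
      rw [← Finset.sum_range_succ, Finset.sum_range_succ',
        Finset.sum_range_succ' (fun i => P.cost c w ((P.next c)^[i] d))]
      simp only [Function.iterate_zero, id]
      linarith
    push Not at h1
    obtain ⟨p₁, v₁, q₁, p₁', h1⟩ := h1
    have hv1 := (h1.eq_last_or_first hc).resolve_right fun h => h0.not_fail hc hS hsub' h1 (by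
      rw [h, hv, next, gate_swap_next hc])
    have hl' := h1.loss_eq hc w
    rw [hv1, ← Function.iterate_succ_apply] at hl'
    obtain ⟨m, rfl⟩ : ∃ n, m = n + 1 := ⟨m - 1, by have := h1.pos; omega⟩
    have hsub2 := walkEdges_mono (P := P) (c := c) (d := P.next c d) m.le_succ
    have h2 : ∀ p v q p', ¬ P.Fail c (P.walkEdges c (P.next c d) m) p v q p' := by
      intro p₂ v₂ q₂ p₂' h2
      rcases h2.eq_last_or_first hc with hv2 | hv2
      · refine h1.not_fail hc (fun x y => blue_of_mem_walkEdges hd1) hsub2 h2 ?_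
        rw [hv2, hv1, Function.iterate_succ_apply']
      · refine h0.not_fail hc hS (hsub2.trans hsub') h2 ?_
        rw [hv, hv2, next, gate_swap_next hc]
    have := segment_bound hc hR hB hopt hd1 (by omega) (hF.dropLast.tail hc) h2
    simp only [← Function.iterate_succ_apply, cost_next_swap hc, Nat.succ_eq_add_one] at this
    rw [Finset.sum_range_succ', Finset.sum_range_succ' (fun i => P.cost c w ((P.next c)^[i] d)),
      Finset.sum_range_succ (fun i => P.cost c w ((P.next c)^[i + 1] d))]
    simp only [Function.iterate_zero, id]
    have := cost_nonneg (P := P) (c := c) hw ((P.next c)^[m + 1] d)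
    linarith

end Window

/-- Summing a function along a walk, split after the first `n` steps. -/
lemma sum_walk_add (f : V × V → ℚ) (d : V × V) (n m : ℕ) :
    ∑ i ∈ range (n + m), f ((P.next c)^[i] d) = ∑ i ∈ range n, f ((P.next c)^[i] d) +
      ∑ i ∈ range m, f ((P.next c)^[i] ((P.next c)^[n] d)) := by
  rw [Finset.sum_range_add]
  refine congrArg₂ _ rfl (Finset.sum_congr rfl fun i _ => ?_)
  rw [add_comm, Function.iterate_add_apply]

lemma sum_iterate [Fintype V] (hc : P.IsCenter c) (f : V × V → ℚ) (i : ℕ) :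
    ∑ d, f ((P.next c)^[i] d) = ∑ d, f d :=
  Function.Bijective.sum_comp (Finite.injective_iff_bijective.1 ((next_injective hc).iterate i)) f

lemma sum_swap [Fintype V] (f : V × V → ℚ) : ∑ d : V × V, f d.swap = ∑ d, f d :=
  Equiv.sum_comp (Equiv.prodComm V V) f

section Window

variable [DecidableEq V] [Fintype V] {A E : Finset (Sym2 V)} {w : Sym2 V → ℚ} {M : ℕ}

lemma window_bound (hc : P.IsCenter c) (hw : ∀ e, 0 ≤ w e)
    (hR : ∀ x y, P.R x y → s(x, y) ∈ E ∧ s(x, y) ∈ A)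
    (hB : ∀ x y, P.B x y → s(x, y) ∈ E ∧ s(x, y) ∉ A)
    (hopt : P.LocallyOptimal c A E w (2 * M + 1)) (m : ℕ) (hm : m + 1 ≤ M) (d : V × V) :
    ∑ i ∈ range (m + 1), P.gain w ((P.next c)^[i] d) ≤
      P.loss c w d.swap + P.loss c w ((P.next c)^[m] d) + P.cost c w d.swap +
      ∑ i ∈ range m, P.toll c w ((P.next c)^[i] d) + P.cost c w ((P.next c)^[m] d) := by
  induction m using Nat.strong_induction_on generalizing d with
  | _ m ih =>
  by_cases hg : ∀ i < m, P.gate c ((P.next c)^[i] d) ≠ (P.next c)^[i] d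
  · have hle : ∀ n d, ∑ i ∈ range n, P.cost c w ((P.next c)^[i] d) ≤
        ∑ i ∈ range n, P.toll c w ((P.next c)^[i] d) :=
      fun n d => Finset.sum_le_sum fun i _ => cost_le_toll hw _
    have h1 := loss_nonneg (P := P) (c := c) hw d.swap
    have h2 := loss_nonneg (P := P) (c := c) hw ((P.next c)^[m] d)
    have h3 := cost_nonneg (P := P) (c := c) hw d.swap
    have h4 := cost_nonneg (P := P) (c := c) hw ((P.next c)^[m] d)
    have h5 := hle m d
    by_cases hd : P.B d.1 d.2
    · by_cases hp : ∃ n, 0 < n ∧ n ≤ m + 1 ∧ (P.next c)^[n] d = d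
      · classical
        obtain ⟨hn, hnm, hper⟩ := Nat.find_spec hp
        have hmin : ∀ k, 0 < k → k < Nat.find hp → (P.next c)^[k] d ≠ d := fun k hk hkn h =>
          Nat.find_min hp hkn ⟨hk, by omega, h⟩
        obtain ⟨n, hnn⟩ : ∃ n, Nat.find hp = n + 1 := ⟨Nat.find hp - 1, by omega⟩
        rw [hnn] at hnm hper hmin
        have hcyc := cycle_bound hc hR hB hopt hd (by omega) (fun i hi => hg i (by omega))
          (fun k hk hkn => hmin k hk (by omega)) hper
        rcases hnm.eq_or_lt with h | h
        · obtain rfl : n = m := by omega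
          rw [Finset.sum_range_succ (fun i => P.cost c w ((P.next c)^[i] d))] at hcyc
          linarith
        · obtain ⟨k, rfl⟩ : ∃ k, m = n + 1 + k := ⟨m - (n + 1), by omega⟩
          have := ih k (by omega) (by omega) d
          have hlast : (P.next c)^[n + 1 + k] d = (P.next c)^[k] d := by
            rw [add_comm, Function.iterate_add_apply, hper]
          rw [add_assoc (n + 1), sum_walk_add (P.gain w), sum_walk_add (P.toll c w), hper, hlast]
          have := hle (n + 1) d
          linarith
      · push Not at hp
        have := free_bound hc hw hR hB hopt hd hm ⟨hg, hp⟩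
        linarith
    · obtain rfl : m = 0 := by
        by_contra hm0
        exact hd (blue_of_gate_ne (hg 0 (by omega))).1
      simp only [zero_add, Finset.sum_range_one, Finset.sum_range_zero,
        Function.iterate_zero, id] at *
      have : P.gain w d = 0 := if_neg hd
      linarith
  · push Not at hg
    obtain ⟨i, hi, hgi⟩ := hg
    obtain ⟨k, rfl⟩ : ∃ k, m = i + 1 + k := ⟨m - (i + 1), by omega⟩
    have h1 := ih i (by omega) (by omega) d
    have h2 := ih k (by omega) (by omega) ((P.next c)^[i + 1] d)
    have hsw : (P.next c)^[i + 1] d = ((P.next c)^[i] d).swap := by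
      rw [Function.iterate_succ_apply', next, hgi]
    have hl : P.loss c w ((P.next c)^[i] d) = 0 := if_pos hgi
    have ht : P.toll c w ((P.next c)^[i] d) = 2 * P.cost c w ((P.next c)^[i] d) := if_pos hgi
    have hlast : (P.next c)^[i + 1 + k] d = (P.next c)^[k] ((P.next c)^[i + 1] d) := by
      rw [add_comm, Function.iterate_add_apply]
    rw [add_assoc (i + 1), sum_walk_add (P.gain w), sum_walk_add (P.toll c w), hlast,
      Finset.sum_range_succ (fun i => P.toll c w ((P.next c)^[i] d)), ht]
    rw [hl] at h1
    rw [show ((P.next c)^[i + 1] d).swap = (P.next c)^[i] d by rw [hsw, Prod.swap_swap], hl] at h2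
    linarith

lemma sum_gain_le (hc : P.IsCenter c) (hw : ∀ e, 0 ≤ w e)
    (hR : ∀ x y, P.R x y → s(x, y) ∈ E ∧ s(x, y) ∈ A)
    (hB : ∀ x y, P.B x y → s(x, y) ∈ E ∧ s(x, y) ∉ A) (hM : 0 < M)
    (hopt : P.LocallyOptimal c A E w (2 * M + 1)) :
    (M - 2 : ℚ) * ∑ d, P.gain w d ≤ (M + 1) * ∑ d, P.toll c w d := by
  obtain ⟨m, rfl⟩ : ∃ m, M = m + 1 := ⟨M - 1, by omega⟩
  have h := Finset.sum_le_sum fun d (_ : d ∈ Finset.univ) =>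
    window_bound hc hw hR hB hopt m le_rfl d
  simp only [Finset.sum_add_distrib] at h
  rw [Finset.sum_comm, Finset.sum_comm (t := range m), sum_swap (P.loss c w),
    sum_swap (P.cost c w), sum_iterate hc (P.loss c w), sum_iterate hc (P.cost c w)] at h
  simp only [sum_iterate hc, Finset.sum_const, Finset.card_range, nsmul_eq_mul] at h
  have h1 : ∑ d, P.loss c w d ≤ ∑ d, P.gain w d := Finset.sum_le_sum fun d _ => loss_le_gain hw d
  have h2 : ∑ d, P.cost c w d ≤ ∑ d, P.toll c w d := Finset.sum_le_sum fun d _ => cost_le_toll hw d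
  push_cast at h ⊢
  linarith

end Window

end ColoredPair

lemma sum_darts [DecidableEq V] [Fintype V] (S : Finset (Sym2 V)) (hS : ∀ e ∈ S, ¬ e.IsDiag)
    (w : Sym2 V → ℚ) :
    (∑ d : V × V, if s(d.1, d.2) ∈ S then w s(d.1, d.2) else 0) = 2 * ∑ e ∈ S, w e := by
  rw [← Finset.sum_filter, ← Finset.sum_fiberwise_of_maps_to
    (g := fun d : V × V => s(d.1, d.2)) (t := S) (by simp), Finset.mul_sum]
  refine Finset.sum_congr rfl fun e he => ?_
  induction e with
  | _ a b =>
    have hab : (a, b) ≠ (b, a) := fun h => hS _ he (Sym2.mk_isDiag_iff.2 (Prod.ext_iff.1 h).1)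
    have : {d ∈ Finset.univ.filter (fun d : V × V => s(d.1, d.2) ∈ S) | s(d.1, d.2) = s(a, b)} =
        {(a, b), (b, a)} := by
      ext ⟨x, y⟩
      simp only [Finset.mem_filter, Finset.mem_univ, true_and, Finset.mem_insert,
        Finset.mem_singleton, Prod.mk.injEq, Sym2.eq_iff]
      refine ⟨fun h => h.2, fun h => ⟨?_, h⟩⟩
      rcases h with ⟨rfl, rfl⟩ | ⟨rfl, rfl⟩
      exacts [he, Sym2.eq_swap ▸ he]
    rw [this, Finset.sum_pair hab, Sym2.eq_swap (a := b), two_mul]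

namespace ColoredPair

variable {P : ColoredPair V} {c : V → V × V}

open Classical in
/-- The share of the cost of a red edge charged at its first vertex. -/
noncomputable def charge (P : ColoredPair V) (c : V → V × V) (w : Sym2 V → ℚ) (y z : V) : ℚ :=
  w s(y, z) * if ∃ t, P.Link c z y t then 1 else 2

open Classical in
lemma toll_le [Fintype V] (hc : P.IsCenter c) {w : Sym2 V → ℚ} (hw : ∀ e, 0 ≤ w e) (d : V × V) :
    P.toll c w d ≤ ∑ z, if P.Link c d.2 z d.1 then P.charge c w d.2 z else 0 := by
  rw [toll, cost, Finset.mul_sum]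
  split_ifs with hg
  · refine (Finset.sum_le_sum fun z _ => ?_)
    split_ifs with hz
    · rw [charge, if_neg, mul_comm]
      rintro ⟨t, ht⟩
      have hgt := gate_eq (e := (t, z)) hc hz ht
      rw [hg] at hgt
      rw [hgt] at hz
      exact P.R_irrefl _ hz.1
    · simp
  · refine (Finset.sum_le_sum fun z _ => ?_)
    have := hw s(d.2, z)
    unfold charge
    split_ifs <;> linarith

open Classical in
lemma sum_toll_le [Fintype V] (hc : P.IsCenter c) {w : Sym2 V → ℚ} (hw : ∀ e, 0 ≤ w e) :
    ∑ d, P.toll c w d ≤ ∑ d : V × V, if P.R d.1 d.2 then w s(d.1, d.2) else 0 := by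
  have h1 : ∑ d, P.toll c w d ≤
      ∑ d : V × V, if ∃ t, P.Link c d.1 d.2 t then P.charge c w d.1 d.2 else 0 := by
    refine (Finset.sum_le_sum fun d _ => toll_le hc hw d).trans_eq ?_
    rw [Fintype.sum_prod_type, Finset.sum_comm, Fintype.sum_prod_type]
    refine Finset.sum_congr rfl fun y _ => ?_
    rw [Finset.sum_comm]
    refine Finset.sum_congr rfl fun z _ => ?_
    split_ifs with h
    · obtain ⟨t, h⟩ := h
      rw [Finset.sum_eq_single t, if_pos h]
      · exact fun t' _ ht => if_neg fun h' => ht (h'.right_unique hc h)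
      · simp
    · exact Finset.sum_eq_zero fun t _ => if_neg fun h' => h ⟨t, h'⟩
  have h2 := sum_swap fun d : V × V =>
    if ∃ t, P.Link c d.1 d.2 t then P.charge c w d.1 d.2 else 0
  have h3 : ∑ d : V × V, ((if ∃ t, P.Link c d.1 d.2 t then P.charge c w d.1 d.2 else 0) +
      if ∃ t, P.Link c d.swap.1 d.swap.2 t then P.charge c w d.swap.1 d.swap.2 else 0) ≤
      ∑ d : V × V, 2 * if P.R d.1 d.2 then w s(d.1, d.2) else 0 := by
    refine Finset.sum_le_sum fun d _ => ?_
    have hd := hw s(d.1, d.2)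
    by_cases hR : P.R d.1 d.2
    · simp only [charge, Prod.fst_swap, Prod.snd_swap, Sym2.eq_swap (a := d.2), if_pos hR]
      split_ifs <;> linarith
    · rw [if_neg hR, if_neg, if_neg]
      · simp
      · exact fun ⟨t, h⟩ => hR (P.R_symm h.1)
      · exact fun ⟨t, h⟩ => hR h.1
  rw [Finset.sum_add_distrib, h2, ← Finset.mul_sum] at h3
  linarith

/-- A locally optimal pairing bounds the weight of the blue edges by that of the red ones. -/
lemma weight_bound [DecidableEq V] [Fintype V] {A E : Finset (Sym2 V)} {w : Sym2 V → ℚ} {M : ℕ}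
    (hc : P.IsCenter c) (hw : ∀ e, 0 ≤ w e) {R B : Finset (Sym2 V)}
    (hR : ∀ x y, P.R x y ↔ s(x, y) ∈ R) (hB : ∀ x y, P.B x y ↔ s(x, y) ∈ B)
    (hRE : R ⊆ E) (hBE : B ⊆ E) (hRA : R ⊆ A) (hBA : Disjoint B A) (hM : 0 < M)
    (hopt : P.LocallyOptimal c A E w (2 * M + 1)) :
    (M - 2 : ℚ) * ∑ e ∈ B, w e ≤ (M + 1) * ∑ e ∈ R, w e := by
  have h1 := sum_gain_le hc hw (fun x y h => ⟨hRE ((hR x y).1 h), hRA ((hR x y).1 h)⟩)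
    (fun x y h => ⟨hBE ((hB x y).1 h), Finset.disjoint_left.1 hBA ((hB x y).1 h)⟩) hM hopt
  have h2 : ∑ d, P.gain w d = 2 * ∑ e ∈ B, w e := by
    rw [← sum_darts B _ w]
    · exact Finset.sum_congr rfl fun d _ => by simp only [gain, hB]
    · rintro ⟨x, y⟩ he hd
      obtain rfl := Sym2.mk_isDiag_iff.1 hd
      exact P.B_irrefl _ ((hB _ _).2 he)
  have h3 : ∑ d, P.toll c w d ≤ 2 * ∑ e ∈ R, w e := by
    rw [← sum_darts R _ w]
    · exact (sum_toll_le hc hw).trans_eq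
        (Finset.sum_congr rfl fun d _ => by simp only [hR])
    · rintro ⟨x, y⟩ he hd
      obtain rfl := Sym2.mk_isDiag_iff.1 hd
      exact P.R_irrefl _ ((hR _ _).2 he)
  have h4 : (0 : ℚ) ≤ M + 1 := by positivity
  have := mul_le_mul_of_nonneg_left h3 h4
  rw [h2] at h1
  linarith

end ColoredPair

lemma isTwoMatching_iff [DecidableEq V] {F : Finset (Sym2 V)} (hF : ∀ e ∈ F, ¬ e.IsDiag) :
    IsTwoMatching F ↔ ∀ x a b c, s(x, a) ∈ F → s(x, b) ∈ F → s(x, c) ∈ F →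
      a = b ∨ a = c ∨ b = c := by
  have hdeg : ∀ v, sym2Deg F v = #{e ∈ F | v ∈ e} := fun v => by
    rw [sym2Deg, Finset.card_filter]
    refine Finset.sum_congr rfl fun e he => if_neg ?_
    rintro rfl
    exact hF _ he (Sym2.mk_isDiag_iff.2 rfl)
  refine forall_congr' fun x => ?_
  rw [hdeg, ← not_lt, Finset.two_lt_card]
  simp only [Finset.mem_filter]
  constructor
  · intro h a b c ha hb hc
    by_contra! hne
    refine h ⟨_, ⟨ha, by simp⟩, _, ⟨hb, by simp⟩, _, ⟨hc, by simp⟩, ?_, ?_, ?_⟩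
    exacts [fun e => hne.1 (Sym2.congr_right.1 e), fun e => hne.2.1 (Sym2.congr_right.1 e),
      fun e => hne.2.2 (Sym2.congr_right.1 e)]
  · rintro h ⟨_, ⟨h1, a, rfl⟩, _, ⟨h2, b, rfl⟩, _, ⟨h3, c, rfl⟩, h4, h5, h6⟩
    rcases h a b c h1 h2 h3 with rfl | rfl | rfl
    exacts [h4 rfl, h5 rfl, h6 rfl]

lemma triangleFree_iff [DecidableEq V] {F : Finset (Sym2 V)} (hF : ∀ e ∈ F, ¬ e.IsDiag) :
    TriangleFree F ↔ ∀ x y z, s(x, y) ∈ F → s(y, z) ∈ F → s(x, z) ∈ F → False := by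
  have hne : ∀ x y, s(x, y) ∈ F → x ≠ y := fun x y h he => hF _ h (Sym2.mk_isDiag_iff.2 he)
  constructor
  · intro h x y z h1 h2 h3
    refine h _ ⟨x, y, z, hne _ _ h1, hne _ _ h3, hne _ _ h2, rfl⟩ ?_
    simp [Finset.insert_subset_iff, h1, h2, h3]
  · rintro h T ⟨x, y, z, -, -, -, rfl⟩ hT
    exact h x y z (hT (by simp)) (hT (by simp)) (hT (by simp))

/-- The coloured pair of two triangle-free 2-matchings. -/
def ColoredPair.ofMatchings [DecidableEq V] {A O : Finset (Sym2 V)} (hA : ∀ e ∈ A, ¬ e.IsDiag)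
    (hO : ∀ e ∈ O, ¬ e.IsDiag) (hAm : IsTwoMatching A) (hOm : IsTwoMatching O)
    (hAt : TriangleFree A) (hOt : TriangleFree O) : ColoredPair V where
  R x y := s(x, y) ∈ A \ O
  B x y := s(x, y) ∈ O \ A
  G x y := s(x, y) ∈ A ∩ O
  R_symm h := Sym2.eq_swap ▸ h
  B_symm h := Sym2.eq_swap ▸ h
  G_symm h := Sym2.eq_swap ▸ h
  R_irrefl x h := hA _ (Finset.mem_sdiff.1 h).1 (Sym2.mk_isDiag_iff.2 rfl)
  B_irrefl x h := hO _ (Finset.mem_sdiff.1 h).1 (Sym2.mk_isDiag_iff.2 rfl)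
  not_R_B x y h h' := (Finset.mem_sdiff.1 h).2 (Finset.mem_sdiff.1 h').1
  not_R_G x y h h' := (Finset.mem_sdiff.1 h).2 (Finset.mem_inter.1 h').2
  not_B_G x y h h' := (Finset.mem_sdiff.1 h).2 (Finset.mem_inter.1 h').1
  deg_fst x a b c ha hb hc := (isTwoMatching_iff hA).1 hAm x a b c (by grind) (by grind) (by grind)
  deg_snd x a b c ha hb hc := (isTwoMatching_iff hO).1 hOm x a b c (by grind) (by grind) (by grind)
  tri_fst x y z h1 h2 h3 := (triangleFree_iff hA).1 hAt x y z (by grind) (by grind) (by grind)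
  tri_snd x y z h1 h2 h3 := (triangleFree_iff hO).1 hOt x y z (by grind) (by grind) (by grind)

lemma wSum_symmDiff [DecidableEq V] (A F : Finset (Sym2 V)) (w : Sym2 V → ℚ) :
    wSum w (symmDiff A F) = wSum w A + exchangeValue A w F := by
  have h1 : wSum w (symmDiff A F) = ∑ e ∈ A \ F, w e + ∑ e ∈ F \ A, w e :=
    Finset.sum_union (Finset.disjoint_left.2 (by grind))
  have h2 : wSum w A = ∑ e ∈ A ∩ F, w e + ∑ e ∈ A \ F, w e :=
    (Finset.sum_inter_add_sum_sdiff A F w).symm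
  rw [h1, h2, exchangeValue, Finset.sum_ite, Finset.sum_neg_distrib, Finset.filter_mem_eq_inter,
    Finset.inter_comm F A, ← Finset.sdiff_eq_filter]
  ring

/-- Theorem 2 of the paper: if `APX` is a triangle-free 2-matching of a
simple edge-weighted graph `G = (V, E, w)` and `(1-ε) opt(G) > w(APX)` for some `ε ∈ (0,1]`,
then there is an augmenting trail `P` for `APX` with `|P| ≤ 7/ε`. -/
theorem stmt0 [Fintype V] [DecidableEq V]
    (E : Finset (Sym2 V)) (w : Sym2 V → ℚ) (hw : ∀ e, 0 ≤ w e)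
    (hsimple : ∀ e ∈ E, ¬ e.IsDiag)
    (APX : Finset (Sym2 V)) (hAPXE : APX ⊆ E)
    (hAPXm : IsTwoMatching APX) (hAPXtf : TriangleFree APX)
    (OPT : Finset (Sym2 V)) (hOPTE : OPT ⊆ E)
    (hOPTm : IsTwoMatching OPT) (hOPTtf : TriangleFree OPT)
    (hOPTmax : ∀ M ⊆ E, IsTwoMatching M → TriangleFree M → wSum w M ≤ wSum w OPT)
    (ε : ℚ) (hε0 : 0 < ε) (hε1 : ε ≤ 1)
    (hgap : (1 - ε) * wSum w OPT > wSum w APX) :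
    ∃ (k : ℕ) (u : ℕ → V), IsTrail E k u ∧ (k : ℚ) ≤ 7 / ε ∧
      IsTwoMatching (symmDiff APX (trailEdges k u)) ∧
      TriangleFree (symmDiff APX (trailEdges k u)) ∧
      wSum w APX < wSum w (symmDiff APX (trailEdges k u)) := by
  by_contra hno
  have hA : ∀ e ∈ APX, ¬ e.IsDiag := fun e he => hsimple e (hAPXE he)
  have hO : ∀ e ∈ OPT, ¬ e.IsDiag := fun e he => hsimple e (hOPTE he)
  obtain ⟨c, hm⟩ := (ColoredPair.ofMatchings hA hO hAPXm hOPTm hAPXtf hOPTtf).exists_maximal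
  set P := ColoredPair.ofMatchings hA hO hAPXm hOPTm hAPXtf hOPTtf
  have hc := hm.1.1
  have hR : ∀ x y, P.R x y ↔ s(x, y) ∈ APX \ OPT := fun _ _ => Iff.rfl
  have hB : ∀ x y, P.B x y ↔ s(x, y) ∈ OPT \ APX := fun _ _ => Iff.rfl
  have hG : ∀ x y, P.G x y ↔ s(x, y) ∈ APX ∩ OPT := fun _ _ => Iff.rfl
  clear_value P
  obtain ⟨M, hM⟩ : ∃ M, ⌈3 / ε⌉₊ = M + 1 := Nat.exists_eq_succ_of_ne_zero (by positivity)
  have h3 : (3 : ℚ) ≤ 3 / ε := by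
    rw [le_div_iff₀ hε0]
    linarith
  have hM1 : 3 / ε ≤ (M + 1 : ℚ) := by
    have := Nat.le_ceil (3 / ε)
    rw [hM] at this
    exact_mod_cast this
  have hM2 : (M : ℚ) < 3 / ε := by
    have := Nat.ceil_lt_add_one (a := 3 / ε) (by positivity)
    rw [hM] at this
    push_cast at this
    linarith
  have hopt : P.LocallyOptimal c APX E w (2 * M + 1) := by
    rintro a b k F S ⟨u, hu, -, -, rfl⟩ hk hS hF hfail
    by_contra hpos
    have hex : ∀ x y, s(x, y) ∈ symmDiff APX (trailEdges k u) → P.Exchanged c S x y := by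
      intro x y h
      rcases Finset.mem_symmDiff.1 h with ⟨h1, h2⟩ | ⟨h1, h2⟩
      · rw [hF, not_or] at h2
        exact .inl ⟨by rw [hR, hG]; grind, h2.2⟩
      · refine .inr (((hF _).1 h1).resolve_right ?_)
        rintro ⟨d, -, z, hl, he⟩
        rw [he] at h2
        exact h2 (Finset.mem_sdiff.1 ((hR _ _).1 hl.1)).1
    have hdiag : ∀ e ∈ symmDiff APX (trailEdges k u), ¬ e.IsDiag := by
      intro e he
      rcases Finset.mem_symmDiff.1 he with ⟨h1, -⟩ | ⟨h1, -⟩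
      · exact hA e h1
      · obtain ⟨i, hi, rfl⟩ := Finset.mem_image.1 h1
        exact hsimple _ (hu.1 i (Finset.mem_range.1 hi))
    refine hno ⟨k, u, hu, ?_, ?_, ?_, ?_⟩
    · have h7 : (7 : ℚ) / ε = 2 * (3 / ε) + 1 / ε := by ring
      have h1 : (1 : ℚ) ≤ 1 / ε := by rwa [le_div_iff₀ hε0, one_mul]
      have : (k : ℚ) ≤ 2 * M + 1 := by exact_mod_cast hk
      linarith
    · exact (isTwoMatching_iff hdiag).2 fun x a b d ha hb hd =>
        ColoredPair.exchanged_deg hc hS (hex _ _ ha) (hex _ _ hb) (hex _ _ hd)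
    · refine (triangleFree_iff hdiag).2 fun x y z h1 h2 h3 => ?_
      obtain ⟨p, v, q, p', h⟩ := ColoredPair.exists_fail hm hS (hex _ _ h1) (hex _ _ h2)
        (hex _ _ h3)
      exact hfail _ _ _ _ h
    · rw [wSum_symmDiff]
      linarith
  have hbound := ColoredPair.weight_bound hc hw hR hB (Finset.sdiff_subset.trans hAPXE)
    (Finset.sdiff_subset.trans hOPTE) Finset.sdiff_subset Finset.sdiff_disjoint
    (by have : (0 : ℚ) < M := by linarith
        exact_mod_cast this) hopt
  have hwA : wSum w APX = ∑ e ∈ APX ∩ OPT, w e + ∑ e ∈ APX \ OPT, w e :=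
    (Finset.sum_inter_add_sum_sdiff _ _ w).symm
  have hwO : wSum w OPT = ∑ e ∈ OPT ∩ APX, w e + ∑ e ∈ OPT \ APX, w e :=
    (Finset.sum_inter_add_sum_sdiff _ _ w).symm
  rw [Finset.inter_comm] at hwO
  have hwG : 0 ≤ ∑ e ∈ APX ∩ OPT, w e := Finset.sum_nonneg fun e _ => hw e
  have hwB : 0 ≤ ∑ e ∈ OPT \ APX, w e := Finset.sum_nonneg fun e _ => hw e
  have hRB : ∑ e ∈ APX \ OPT, w e < (1 - ε) * ∑ e ∈ OPT \ APX, w e := by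
    rw [hwA, hwO] at hgap
    linarith [mul_nonneg hε0.le hwG]
  have h1 := mul_lt_mul_of_pos_left hRB (show (0 : ℚ) < M + 1 by positivity)
  have h2 : 0 ≤ (((M : ℚ) + 1) * ε - 3) * ∑ e ∈ OPT \ APX, w e :=
    mul_nonneg (by rw [div_le_iff₀ hε0] at hM1; linarith) hwB
  linarith
end

section
/- Let G = (V, E, w) be a finite undirected edge-weighted graph that may contain self-loops but has no parallel edges. Let 𝒯 be a subset of the triangles of G, let A₁ and A₂ be two 𝒯-free 2-matchings of G, and let ε ∈ (0, 1] be a constant. If (1−ε)·w(A₁) > w(A₂), then there exists an alternating trail P w.r.t. (A₁, A₂) such that: (1) A₂ΔP is a 𝒯-free 2-matching, (2) w(A₂ΔP) > w(A₂), and (3) |P| + 2·sl(P) ≤ 7/ε. -/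
open Finset

variable {V : Type*}

/-- `NoSwitch E F` excludes the alternating 4-cycles `p₀ p₁ p₂ p₃` (starting with an edge of
`E \ F`) with a chord `p₀ p₂` in `F \ E` that can be switched without creating triangles. -/
def NoSwitch {V : Type*} (E F : V → V → Prop) : Prop :=
  ∀ p₀ p₁ p₂ p₃ : V, p₀ ≠ p₁ → p₀ ≠ p₂ → p₀ ≠ p₃ → p₁ ≠ p₂ → p₁ ≠ p₃ → p₂ ≠ p₃ →
    (E p₀ p₁ ∧ ¬ F p₀ p₁) → (F p₁ p₂ ∧ ¬ E p₁ p₂) → (E p₂ p₃ ∧ ¬ F p₂ p₃) →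
    (F p₃ p₀ ∧ ¬ E p₃ p₀) → (F p₀ p₂ ∧ ¬ E p₀ p₂) →
    ((E p₁ p₃ ∧ ¬ F p₁ p₃) ∨ ∃ b, (E p₀ b ∧ ¬ F p₀ b) ∧ (E b p₂ ∧ ¬ F b p₂)) → False

/-- A symmetric relation in which every element has at most two neighbours. -/
structure DegTwo {V : Type*} (E : V → V → Prop) : Prop where
  symm : ∀ {x y}, E x y → E y x
  deg : ∀ {v a b c}, E v a → E v b → E v c → a = b ∨ a = c ∨ b = c

/-- The angle at `v` between `v x ∈ E \ F` and `v y ∈ F \ E` of a triangle `v x y` in `t`. -/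
def IsAngle {V : Type*} (E F : V → V → Prop) (t : V → V → V → Prop) (v x y : V) : Prop :=
  t v x y ∧ (E v x ∧ ¬ F v x) ∧ (F v y ∧ ¬ E v y)

structure MixedTriangles {V : Type*} (E F : V → V → Prop) (t : V → V → V → Prop) : Prop where
  rot : ∀ {x y z}, t x y z → t y z x
  swap : ∀ {x y z}, t x y z → t x z y
  ne : ∀ {x y z}, t x y z → x ≠ y
  mem : ∀ {x y z}, t x y z → E x y ∨ F x y
  not_left : ∀ {x y z}, t x y z → ¬ (E x y ∧ E y z ∧ E x z)
  not_right : ∀ {x y z}, t x y z → ¬ (F x y ∧ F y z ∧ F x z)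

structure Stuck {V : Type*} (E F : V → V → Prop) (t : V → V → V → Prop) : Prop where
  left : DegTwo E
  right : DegTwo F
  tri : MixedTriangles E F t
  noSwitch : NoSwitch E F
  noSwitch' : NoSwitch F E
  conflict : ∀ {v x y}, IsAngle E F t v x y →
    ∃ z, (IsAngle E F t v x z ∧ z ≠ y) ∨ (IsAngle E F t v z y ∧ z ≠ x)

namespace Stuck
variable {V : Type*} {E F : V → V → Prop} {t : V → V → V → Prop}

theorem swapColors (h : Stuck E F t) : Stuck F E t where
  left := h.right
  right := h.left
  tri :=
   { rot := h.tri.rot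
     swap := h.tri.swap
     ne := h.tri.ne
     mem := fun a => (h.tri.mem a).symm
     not_left := h.tri.not_right
     not_right := h.tri.not_left }
  noSwitch := h.noSwitch'
  noSwitch' := h.noSwitch
  conflict := by
    intro v x y ⟨a, b, c⟩
    obtain ⟨z, ⟨⟨a, b, c⟩, d⟩ | ⟨⟨a, b, c⟩, d⟩⟩ := h.conflict ⟨h.tri.swap a, c, b⟩
    · exact ⟨z, Or.inr ⟨⟨h.tri.swap a, c, b⟩, d⟩⟩
    · exact ⟨z, Or.inl ⟨⟨h.tri.swap a, c, b⟩, d⟩⟩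

/-- No triangle has a common edge. -/
theorem not_common (h : Stuck E F t) {v x y : V} (ha : IsAngle E F t v x y) :
    ¬ (E x y ∧ F x y) := by
  obtain ⟨s1, d1⟩ := h.left
  obtain ⟨s2, d2⟩ := h.right
  obtain ⟨rot, swap, ne, mem, nl, nr⟩ := h.tri
  rintro ⟨e1, e2⟩
  obtain ⟨t1, ⟨r1, r2⟩, b1, b2⟩ := ha
  obtain ⟨z, ⟨⟨t2, -, b3, b4⟩, hz⟩ | ⟨⟨t2, ⟨r3, r4⟩, -⟩, hz⟩⟩ :=
    h.conflict (v := v) (x := x) (y := y) ⟨t1, ⟨r1, r2⟩, b1, b2⟩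
  · have k : F x z ∧ ¬ E x z := by grind
    obtain ⟨u, ⟨⟨t3, -, b5, b6⟩, hu⟩ | ⟨⟨t3, ⟨r5, r6⟩, -⟩, hu⟩⟩ :=
      h.conflict (v := x) (x := v) (y := z) ⟨by grind, by grind, k⟩
    · grind
    · grind
  · have k : E y z ∧ ¬ F y z := by grind
    obtain ⟨u, ⟨⟨t3, -, b5, b6⟩, hu⟩ | ⟨⟨t3, ⟨r5, r6⟩, -⟩, hu⟩⟩ :=
      h.conflict (v := y) (x := z) (y := v) ⟨by grind, k, by grind⟩
    · grind
    · grind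

end Stuck

/-- `Stuck` for two disjoint edge colors. -/
structure StuckPure {V : Type*} (R B : V → V → Prop) (t : V → V → V → Prop) : Prop where
  left : DegTwo R
  right : DegTwo B
  disj : ∀ {x y}, R x y → ¬ B x y
  rot : ∀ {x y z}, t x y z → t y z x
  swap : ∀ {x y z}, t x y z → t x z y
  ne : ∀ {x y z}, t x y z → x ≠ y
  mem : ∀ {x y z}, t x y z → R x y ∨ B x y
  not_left : ∀ {x y z}, t x y z → ¬ (R x y ∧ R y z ∧ R x z)
  not_right : ∀ {x y z}, t x y z → ¬ (B x y ∧ B y z ∧ B x z)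
  noSwitch : ∀ {p₀ p₁ p₂ p₃}, p₀ ≠ p₁ → p₀ ≠ p₂ → p₀ ≠ p₃ → p₁ ≠ p₂ → p₁ ≠ p₃ → p₂ ≠ p₃ →
    R p₀ p₁ → B p₁ p₂ → R p₂ p₃ → B p₃ p₀ → B p₀ p₂ →
    ¬ (R p₁ p₃ ∨ ∃ b, R p₀ b ∧ R b p₂)
  noSwitch' : ∀ {p₀ p₁ p₂ p₃}, p₀ ≠ p₁ → p₀ ≠ p₂ → p₀ ≠ p₃ → p₁ ≠ p₂ → p₁ ≠ p₃ → p₂ ≠ p₃ →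
    B p₀ p₁ → R p₁ p₂ → B p₂ p₃ → R p₃ p₀ → R p₀ p₂ →
    ¬ (B p₁ p₃ ∨ ∃ b, B p₀ b ∧ B b p₂)
  conflict : ∀ {v x y}, t v x y → R v x → B v y →
    ∃ z, (t v x z ∧ B v z ∧ z ≠ y) ∨ (t v z y ∧ R v z ∧ z ≠ x)

namespace StuckPure
variable {V : Type*} {R B : V → V → Prop} {t : V → V → V → Prop}

theorem swapColors (h : StuckPure R B t) : StuckPure B R t where
  left := h.right
  right := h.left
  disj := fun a b => h.disj b a
  rot := h.rot
  swap := h.swap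
  ne := h.ne
  mem := fun a => (h.mem a).symm
  not_left := h.not_right
  not_right := h.not_left
  noSwitch := h.noSwitch'
  noSwitch' := h.noSwitch
  conflict := by
    intro v x y a b c
    obtain ⟨z, ⟨a, b, d⟩ | ⟨a, b, d⟩⟩ := h.conflict (h.swap a) c b
    · exact ⟨z, Or.inr ⟨h.swap a, b, d⟩⟩
    · exact ⟨z, Or.inl ⟨h.swap a, b, d⟩⟩

theorem corner (h : StuckPure R B t) {a b c : V} (ht : t a b c) (hab : R a b) (hbc : R b c)
    (hac : B a c) :
    (∃ d, d ≠ c ∧ t a b d ∧ B a d ∧ B b d) ∨ (∃ e, e ≠ b ∧ t a e c ∧ R a e ∧ B e c) ∨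
      ∃ e, e ≠ b ∧ t a e c ∧ R a e ∧ R e c := by
  obtain ⟨z, ⟨h1, h2, h3⟩ | ⟨h1, h2, h3⟩⟩ := h.conflict ht hab hac
  · refine Or.inl ⟨z, h3, h1, h2, (h.mem (h.rot h1)).resolve_left fun h4 => ?_⟩
    have h5 := h.ne (h.rot (h.rot h1))
    have h6 := h.ne (h.rot (h.rot ht))
    have := h.left.deg (h.left.symm hab) hbc h4
    grind
  · have := h.mem (h.rot h1)
    grind

theorem symm_B (h : StuckPure R B t) {a b : V} (hb : B a b) : B b a := h.right.symm hb

theorem symm_R (h : StuckPure R B t) {a b : V} (hb : R a b) : R b a := h.left.symm hb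

/-- The two angles of a two-red triangle cannot both avoid a conflict along the blue edge with
another two-red triangle. -/
theorem not_skew (h : StuckPure R B t) {a b c e : V} (hab : R a b) (hbc : R b c)
    (hac : B a c) (hbc' : a ≠ b ∧ b ≠ c ∧ a ≠ c) (hce : R c e) (hea : B e a) (hce' : e ≠ a ∧ e ≠ c)
    (hd : (∃ d, d ≠ c ∧ d ≠ a ∧ d ≠ b ∧ B a d ∧ B b d) ∨
      (∃ e, e ≠ a ∧ e ≠ c ∧ R a e ∧ B e c)) : False := by
  obtain ⟨d, h1, h2, h3, h4, h5⟩ | ⟨d, h1, h2, h3, h4⟩ := hd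
  · have hde : d = e := by
      have := h.right.deg hac h4 (h.symm_B hea)
      grind
    subst hde
    exact h.noSwitch (p₀ := a) (p₁ := b) (p₂ := d) (p₃ := c) hbc'.1 h2.symm hbc'.2.2 h3.symm
      hbc'.2.1 h1 hab h5 (h.symm_R hce) (h.symm_B hac) h4 (Or.inl hbc)
  · have hde : d ≠ e := by
      rintro rfl
      exact h.disj h3 (h.symm_B hea)
    exact h.noSwitch (p₀ := a) (p₁ := d) (p₂ := c) (p₃ := e) h1.symm hbc'.2.2 hce'.1.symm h2 hde
      hce'.2.symm h3 h4 hce hea hac (Or.inr ⟨b, hab, hbc⟩)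

theorem distinct (h : StuckPure R B t) {a b c : V} (ht : t a b c) : a ≠ b ∧ b ≠ c ∧ a ≠ c :=
  ⟨h.ne ht, h.ne (h.rot ht), h.ne (h.swap ht)⟩

theorem exists_twin (h : StuckPure R B t) {a b c : V} (ht : t a b c) (hab : R a b) (hbc : R b c)
    (hac : B a c) : ∃ e, e ≠ b ∧ t a e c ∧ R a e ∧ R e c := by
  have hd := h.distinct ht
  have ht' : t c b a := h.rot (h.swap ht)
  obtain ⟨d, h1, h2, h3, h4⟩ | ⟨d, h1, h2, h3, h4⟩ | hz := h.corner ht hab hbc hac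
  · have hd2 := h.distinct h2
    obtain ⟨e, g1, g2, g3, g4⟩ | ⟨e, g1, g2, g3, g4⟩ | ⟨e, g1, g2, g3, g4⟩ :=
      h.corner ht' (h.symm_R hbc) (h.symm_R hab) (h.symm_B hac)
    · exfalso
      have hd3 := h.distinct g2
      have htd : t b d a := h.rot h2
      obtain ⟨f, k1, k2, k3, k4⟩ | ⟨f, k1, k2, k3, k4⟩ | ⟨f, k1, k2, k3, k4⟩ :=
        h.swapColors.corner htd h4 (h.symm_B h3) (h.symm_R hab)
      · have hd4 := h.distinct k2
        have := h.left.deg (h.symm_R hab) hbc k3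
        refine h.swapColors.not_skew (a := b) (b := d) (c := a) (e := c) h4 (h.symm_B h3)
          (h.symm_R hab) ⟨hd2.2.1, hd2.2.2.symm, hd2.1.symm⟩ hac (h.symm_R hbc)
          ⟨hd.2.1.symm, hd.2.2.symm⟩ (Or.inl ⟨f, by grind⟩)
      · have hd4 := h.distinct k2
        refine h.swapColors.not_skew (a := b) (b := d) (c := a) (e := c) h4 (h.symm_B h3)
          (h.symm_R hab) ⟨hd2.2.1, hd2.2.2.symm, hd2.1.symm⟩ hac (h.symm_R hbc)
          ⟨hd.2.1.symm, hd.2.2.symm⟩ (Or.inr ⟨f, by grind⟩)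
      · have := h.right.deg hac h3 (h.symm_B k4)
        have := @h.disj b c
        have := h.symm_B g3
        grind
    · have hd3 := h.distinct g2
      exact (h.not_skew hab hbc hac hd g3 g4 ⟨hd3.2.1, hd3.1.symm⟩
        (Or.inl ⟨d, h1, hd2.2.2.symm, hd2.2.1.symm, h3, h4⟩)).elim
    · exact ⟨e, g1, h.rot (h.swap g2), h.symm_R g4, h.symm_R g3⟩
  · have hd2 := h.distinct h2
    obtain ⟨e, g1, g2, g3, g4⟩ | ⟨e, g1, g2, g3, g4⟩ | ⟨e, g1, g2, g3, g4⟩ :=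
      h.corner ht' (h.symm_R hbc) (h.symm_R hab) (h.symm_B hac)
    · have hd3 := h.distinct g2
      exact (h.not_skew (a := c) (b := b) (c := a) (e := d) (h.symm_R hbc) (h.symm_R hab)
        (h.symm_B hac) (h.distinct ht') h3 h4 ⟨hd2.2.1, hd2.1.symm⟩
        (Or.inl ⟨e, g1, hd3.2.2.symm, hd3.2.1.symm, g3, g4⟩)).elim
    · have hd3 := h.distinct g2
      exact (h.not_skew hab hbc hac hd g3 g4 ⟨hd3.2.1, hd3.1.symm⟩
        (Or.inr ⟨d, hd2.1.symm, hd2.2.1, h3, h4⟩)).elim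
    · exact ⟨e, g1, h.rot (h.swap g2), h.symm_R g4, h.symm_R g3⟩
  · exact hz

theorem angle_unique (h : StuckPure R B t) {a b c z : V} (ht : t a b c) (hab : R a b)
    (hbc : R b c) (hac : B a c) (hz : t a b z) (haz : B a z) : z = c := by
  by_contra hne
  have hbz : B b z := (h.mem (h.rot hz)).resolve_left fun h4 => by
    have := h.left.deg (h.symm_R hab) hbc h4
    have := h.distinct ht
    have := h.distinct hz
    grind
  obtain ⟨f, h1, h2, h3, h4⟩ := h.swapColors.exists_twin (h.swap hz) haz (h.symm_B hbz) hab
  have := h.right.deg hac haz h3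
  have := h.disj (h.symm_R hbc)
  grind

/-- Two triangles forming a red 4-cycle with a blue chord, in conflict with no other triangle. -/
structure Twin {V : Type*} (R B : V → V → Prop) (t : V → V → V → Prop) (a b c e : V) : Prop where
  ne : b ≠ e
  left : t a b c
  right : t a e c
  rab : R a b
  rbc : R b c
  rae : R a e
  rce : R e c
  bac : B a c
  red_a : ∀ z, t a b z → B a z → z = c
  red_c : ∀ z, t c e z → B c z → z = a
  blue_a : ∀ z, R a z → z = b ∨ z = e
  blue_c : ∀ z, R c z → z = b ∨ z = e

theorem exists_twins (h : StuckPure R B t) {a b c : V} (ht : t a b c) (hab : R a b) (hbc : R b c)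
    (hac : B a c) : ∃ e, Twin R B t a b c e := by
  obtain ⟨e, h1, h2, h3, h4⟩ := h.exists_twin ht hab hbc hac
  exact ⟨e, h1.symm, ht, h2, hab, hbc, h3, h4, hac,
    fun z => h.angle_unique ht hab hbc hac,
    fun z => h.angle_unique (h.rot (h.swap h2)) (h.symm_R h4) (h.symm_R h3) (h.symm_B hac),
    fun z hz => by have := h.left.deg hab h3 hz; grind,
    fun z hz => by have := h.left.deg (h.symm_R hbc) (h.symm_R h4) hz; grind⟩

theorem exists_twins_of_left (h : StuckPure R B t) {x y z : V} (ht : t x y z) (hR : R x y) :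
    (∃ a b c e, Twin R B t a b c e) ∨ ∃ a b c e, Twin B R t a b c e := by
  have h1 := h.mem (h.rot ht)
  have h2 := h.mem (h.swap ht)
  have h3 := h.not_left ht
  by_cases h4 : R y z
  · have h5 : B x z := by grind
    exact Or.inl ⟨_, _, _, h.exists_twins ht hR h4 h5⟩
  by_cases h5 : R x z
  · exact Or.inl ⟨_, _, _, h.exists_twins (h.rot (h.rot (h.swap ht))) (h.symm_R hR) h5 (by grind)⟩
  · exact Or.inr ⟨_, _, _, h.swapColors.exists_twins (h.swap ht) (by grind)
      (h.symm_B (h1.resolve_left h4)) hR⟩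

theorem exists_twins_or (h : StuckPure R B t) {x y z : V} (ht : t x y z) :
    (∃ a b c e, Twin R B t a b c e) ∨ ∃ a b c e, Twin B R t a b c e := by
  rcases h.mem ht with h1 | h1
  · exact h.exists_twins_of_left ht h1
  · exact (h.swapColors.exists_twins_of_left ht h1).symm

end StuckPure

theorem DegTwo.diff {V : Type*} {E F : V → V → Prop} (hE : DegTwo E) (hF : ∀ {x y}, F x y → F y x) :
    DegTwo fun x y => E x y ∧ ¬ F x y where
  symm := fun h => ⟨hE.symm h.1, fun h' => h.2 (hF h')⟩
  deg := fun a b c => hE.deg a.1 b.1 c.1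

theorem Stuck.pure {V : Type*} {E F : V → V → Prop} {t : V → V → V → Prop} (h : Stuck E F t) :
    StuckPure (fun x y => E x y ∧ ¬ F x y) (fun x y => F x y ∧ ¬ E x y) t where
  left := h.left.diff h.right.symm
  right := h.right.diff h.left.symm
  disj := by grind
  rot := h.tri.rot
  swap := h.tri.swap
  ne := h.tri.ne
  mem := by
    intro x y z ht
    have h1 := @h.tri.mem
    have h2 := @h.tri.not_left
    have h3 := @h.tri.not_right
    have h4 := @h.tri.rot
    have h5 := @h.tri.swap
    have h6 := @h.left.symm
    have h7 := @h.right.symm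
    have hc := @h.not_common
    simp only [IsAngle] at hc
    by_contra hcon
    have k1 : E x y ∧ F x y := by grind
    have k2 := h1 (h5 ht)
    have k3 := h1 (h4 ht)
    have k4 := h2 ht
    have k5 := h3 ht
    have c1 := @hc z x y
    have c2 := @hc z y x
    grind
  not_left := fun ht h' => h.tri.not_left ht ⟨h'.1.1, h'.2.1.1, h'.2.2.1⟩
  not_right := fun ht h' => h.tri.not_right ht ⟨h'.1.1, h'.2.1.1, h'.2.2.1⟩
  noSwitch := fun a b c d e f g i j k l m => h.noSwitch _ _ _ _ a b c d e f g i j k l m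
  noSwitch' := fun a b c d e f g i j k l m => h.noSwitch' _ _ _ _ a b c d e f g i j k l m
  conflict := by
    intro v x y a b c
    obtain ⟨z, ⟨⟨a, b, c⟩, d⟩ | ⟨⟨a, b, c⟩, d⟩⟩ := h.conflict ⟨a, b, c⟩
    · exact ⟨z, Or.inl ⟨a, c, d⟩⟩
    · exact ⟨z, Or.inr ⟨a, b, d⟩⟩

/-- Adjacency through an edge of `A`. -/
def Adj {V : Type*} (A : Finset (Sym2 V)) (x y : V) : Prop := s(x, y) ∈ A

theorem Adj.symm {V : Type*} {A : Finset (Sym2 V)} {x y : V} (h : Adj A x y) : Adj A y x := by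
  rwa [Adj, Sym2.eq_swap]

section Selection
variable {V : Type*} [DecidableEq V]

/-- The edge set of the triangle with the given vertices. -/
def tri (x y z : V) : Finset (Sym2 V) := {s(x, y), s(y, z), s(x, z)}

theorem tri_rot (x y z : V) : tri x y z = tri y z x := by
  ext e; simp only [tri, Finset.mem_insert, Finset.mem_singleton, Sym2.eq_swap (a := z),
    Sym2.eq_swap (a := y) (b := x)]; tauto

theorem tri_swap (x y z : V) : tri x y z = tri x z y := by
  ext e; simp only [tri, Finset.mem_insert, Finset.mem_singleton, Sym2.eq_swap (a := z)
    (b := y)]; tauto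

/-- The vertex triples spanning a triangle of `S`. -/
def Spans (S : Finset (Finset (Sym2 V))) (x y z : V) : Prop := tri x y z ∈ S

/-- Every triangle in `S` consists of edges of `A ∪ B` and lies neither in `A` nor in `B`. -/
def Mixed (A B : Finset (Sym2 V)) (S : Finset (Finset (Sym2 V))) : Prop :=
  ∀ T ∈ S, IsTriangle T ∧ T ⊆ A ∪ B ∧ ¬ T ⊆ A ∧ ¬ T ⊆ B

theorem tri_subset {A : Finset (Sym2 V)} {x y z : V} :
    tri x y z ⊆ A ↔ Adj A x y ∧ Adj A y z ∧ Adj A x z := by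
  simp [tri, Adj, Finset.insert_subset_iff]

theorem Mixed.mixedTriangles {A B : Finset (Sym2 V)} {S : Finset (Finset (Sym2 V))}
    (h : Mixed A B S) : MixedTriangles (Adj A) (Adj B) (Spans S) where
  rot := fun {x y z} ht => by rwa [Spans, ← tri_rot]
  swap := fun {x y z} ht => by rwa [Spans, ← tri_swap]
  ne := by
    rintro x y z ht rfl
    obtain ⟨a, b, c, h1, h2, h3, h4⟩ := (h _ ht).1
    have h5 : s(x, x) ∈ tri x x z := by simp [tri]
    rw [h4] at h5
    simp at h5
    grind
  mem := fun {x y z} ht => by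
    have := (h _ ht).2.1 (show s(x, y) ∈ tri x y z by simp [tri])
    simpa [Adj] using this
  not_left := fun {x y z} ht hs => (h _ ht).2.2.1 (tri_subset.2 hs)
  not_right := fun {x y z} ht hs => (h _ ht).2.2.2 (tri_subset.2 hs)

/-- One angle can be chosen in every triangle of `S` such that the chosen angles are
pairwise compatible. -/
def Selectable (A B : Finset (Sym2 V)) (S : Finset (Finset (Sym2 V))) : Prop :=
  ∃ Sel : V → V → V → Prop,
    (∀ v x y, Sel v x y → IsAngle (Adj A) (Adj B) (Spans S) v x y) ∧
    (∀ v x y z, Sel v x y → Sel v x z → y = z) ∧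
    (∀ v x y z, Sel v x y → Sel v z y → x = z) ∧
    ∀ T ∈ S, ∃ v x y, Sel v x y ∧ T = tri v x y

theorem Selectable.symm {A B : Finset (Sym2 V)} {S : Finset (Finset (Sym2 V))}
    (h : Selectable A B S) : Selectable B A S := by
  obtain ⟨Sel, h1, h2, h3, h4⟩ := h
  refine ⟨fun v x y => Sel v y x, fun v x y h => ?_, fun v x y z ha hb => h3 v y x z ha hb,
    fun v x y z ha hb => h2 v y x z ha hb, fun T hT => ?_⟩
  · obtain ⟨k1, k2, k3⟩ := h1 _ _ _ h
    exact ⟨by rwa [Spans, ← tri_swap], k3, k2⟩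
  · obtain ⟨v, x, y, k1, k2⟩ := h4 T hT
    exact ⟨v, y, x, k1, by rw [k2, tri_swap]⟩

theorem Mixed.mono {A B : Finset (Sym2 V)} {S S' : Finset (Finset (Sym2 V))}
    (h : Mixed A B S) (h' : S' ⊆ S) : Mixed A B S' := fun T hT => h T (h' hT)

theorem IsAngle.mono {A B : Finset (Sym2 V)} {S S' : Finset (Finset (Sym2 V))}
    (h' : S' ⊆ S) {v x y : V} (h : IsAngle (Adj A) (Adj B) (Spans S') v x y) :
    IsAngle (Adj A) (Adj B) (Spans S) v x y := ⟨h' h.1, h.2⟩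

theorem Selectable.of_erase {A B : Finset (Sym2 V)} {S : Finset (Finset (Sym2 V))} {v x y : V}
    (ha : IsAngle (Adj A) (Adj B) (Spans S) v x y)
    (h1 : ∀ z, IsAngle (Adj A) (Adj B) (Spans S) v x z → z = y)
    (h2 : ∀ z, IsAngle (Adj A) (Adj B) (Spans S) v z y → z = x)
    (h : Selectable A B (S.erase (tri v x y))) : Selectable A B S := by
  obtain ⟨Sel, k1, k2, k3, k4⟩ := h
  have k5 := fun v x y hs => (k1 v x y hs).mono (Finset.erase_subset _ _)
  refine ⟨fun v' x' y' => Sel v' x' y' ∨ (v' = v ∧ x' = x ∧ y' = y), ?_, ?_, ?_, ?_⟩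
  · rintro v' x' y' (hs | ⟨rfl, rfl, rfl⟩)
    · exact k5 _ _ _ hs
    · exact ha
  · rintro v' x' y' z (hs | ⟨rfl, rfl, rfl⟩) (hs' | ⟨k, k', rfl⟩)
    · exact k2 _ _ _ _ hs hs'
    · subst k k'
      exact h1 _ (k5 _ _ _ hs)
    · exact (h1 _ (k5 _ _ _ hs')).symm
    · rfl
  · rintro v' x' y' z (hs | ⟨rfl, rfl, rfl⟩) (hs' | ⟨k, rfl, k'⟩)
    · exact k3 _ _ _ _ hs hs'
    · subst k k'
      exact h2 _ (k5 _ _ _ hs)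
    · exact (h2 _ (k5 _ _ _ hs')).symm
    · rfl
  · intro T hT
    by_cases hT' : T = tri v x y
    · exact ⟨v, x, y, Or.inr ⟨rfl, rfl, rfl⟩, hT'⟩
    · obtain ⟨v', x', y', hs, e⟩ := k4 T (Finset.mem_erase.2 ⟨hT', hT⟩)
      exact ⟨v', x', y', Or.inl hs, e⟩

theorem Selectable.of_twin {A B : Finset (Sym2 V)} {S : Finset (Finset (Sym2 V))} {a b c e : V}
    (hM : Mixed A B S)
    (ht : StuckPure.Twin (fun x y => Adj A x y ∧ ¬ Adj B x y) (fun x y => Adj B x y ∧ ¬ Adj A x y)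
      (Spans S) a b c e)
    (h : Selectable A B ((S.erase (tri a b c)).erase (tri a e c))) : Selectable A B S := by
  obtain ⟨Sel, k1, k2, k3, k4⟩ := h
  have hne : a ≠ c := hM.mixedTriangles.ne (hM.mixedTriangles.swap ht.left)
  have hsub : (S.erase (tri a b c)).erase (tri a e c) ⊆ S :=
    (Finset.erase_subset _ _).trans (Finset.erase_subset _ _)
  have k5 := fun v x y hs => (k1 v x y hs).mono hsub
  have k6 : ∀ x, ¬ Sel a x c := fun x hs => by
    have h1 := (k1 _ _ _ hs).1
    simp only [Spans, Finset.mem_erase] at h1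
    rcases ht.blue_a x (k1 _ _ _ hs).2.1 with rfl | rfl
    · exact h1.2.1 rfl
    · exact h1.1 rfl
  have k7 : ∀ x, ¬ Sel c x a := fun x hs => by
    have h1 := (k1 _ _ _ hs).1
    have h2 : tri c x a = tri a x c := by rw [tri_swap, ← tri_rot, ← tri_rot]
    simp only [Spans, Finset.mem_erase, h2] at h1
    rcases ht.blue_c x (k1 _ _ _ hs).2.1 with rfl | rfl
    · exact h1.2.1 rfl
    · exact h1.1 rfl
  have k8 : ∀ z, Sel a b z → z = c := fun z hs => ht.red_a z (k5 _ _ _ hs).1 (k5 _ _ _ hs).2.2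
  have k9 : ∀ z, Sel c e z → z = a := fun z hs => ht.red_c z (k5 _ _ _ hs).1 (k5 _ _ _ hs).2.2
  refine ⟨fun v' x' y' => Sel v' x' y' ∨ (v' = a ∧ x' = b ∧ y' = c) ∨
    (v' = c ∧ x' = e ∧ y' = a), ?_, ?_, ?_, ?_⟩
  · rintro v' x' y' (hs | ⟨rfl, rfl, rfl⟩ | ⟨rfl, rfl, rfl⟩)
    · exact k5 _ _ _ hs
    · exact ⟨ht.left, ht.rab, ht.bac⟩
    · refine ⟨hM.mixedTriangles.rot (hM.mixedTriangles.swap ht.right), ?_, ?_⟩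
      · exact ⟨ht.rce.1.symm, fun h' => ht.rce.2 h'.symm⟩
      · exact ⟨ht.bac.1.symm, fun h' => ht.bac.2 h'.symm⟩
  · grind
  · grind
  · intro T hT
    by_cases hT' : T = tri a b c
    · exact ⟨a, b, c, by simp, hT'⟩
    by_cases hT2 : T = tri a e c
    · exact ⟨c, e, a, by simp, by rw [hT2, tri_swap, tri_rot, tri_swap]⟩
    · obtain ⟨v', x', y', hs, e⟩ := k4 T (by simp_all)
      exact ⟨v', x', y', Or.inl hs, e⟩

theorem Mixed.exists_angle {A B : Finset (Sym2 V)} {S : Finset (Finset (Sym2 V))}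
    (hM : Mixed A B S) {T : Finset (Sym2 V)} (hT : T ∈ S) :
    ∃ v x y, T = tri v x y ∧ IsAngle (Adj A) (Adj B) (Spans S) v x y := by
  obtain ⟨⟨a, b, c, -, -, -, rfl⟩, -⟩ := hM T hT
  have h0 : Spans S a b c := hT
  obtain ⟨rot, swap, ne, mem, nl, nr⟩ := hM.mixedTriangles
  have m1 := mem h0
  have m2 := mem (rot h0)
  have m3 := mem (swap h0)
  have m4 := nl h0
  have m5 := nr h0
  have s1 : ∀ {A : Finset (Sym2 V)} {x y}, Adj A x y → Adj A y x := fun h => h.symm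
  have key : ∃ v x y, tri a b c = tri v x y ∧ (Adj A v x ∧ ¬ Adj B v x) ∧
      (Adj B v y ∧ ¬ Adj A v y) := by
    have e1 := tri_rot a b c
    have e2 := tri_rot b c a
    have e3 := tri_swap a b c
    have e4 := tri_swap b c a
    have e5 := tri_swap c a b
    have t1 := s1 (A := A) (x := a) (y := b)
    have t2 := s1 (A := A) (x := b) (y := a)
    have t3 := s1 (A := A) (x := a) (y := c)
    have t4 := s1 (A := A) (x := c) (y := a)
    have t5 := s1 (A := A) (x := c) (y := b)
    have t6 := s1 (A := A) (x := b) (y := c)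
    have u1 := s1 (A := B) (x := a) (y := b)
    have u2 := s1 (A := B) (x := b) (y := a)
    have u3 := s1 (A := B) (x := a) (y := c)
    have u4 := s1 (A := B) (x := c) (y := a)
    have u5 := s1 (A := B) (x := c) (y := b)
    have u6 := s1 (A := B) (x := b) (y := c)
    by_contra hcon
    have c1 := fun x y z he h' => hcon ⟨x, y, z, he, h'⟩
    have d1 := c1 a b c rfl
    have d2 := c1 b c a e1
    have d3 := c1 c a b (e1.trans e2)
    have d4 := c1 a c b e3
    have d5 := c1 b a c (e1.trans e4)
    have d6 := c1 c b a (e1.trans (e2.trans e5))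
    clear c1 hcon e1 e2 e3 e4 e5 rot swap ne mem nl nr
    grind
  obtain ⟨v, x, y, h1, h2⟩ := key
  exact ⟨v, x, y, h1, by rw [Spans, ← h1]; exact hT, h2⟩

theorem Mixed.symm {A B : Finset (Sym2 V)} {S : Finset (Finset (Sym2 V))} (h : Mixed A B S) :
    Mixed B A S := fun T hT => by
  obtain ⟨h1, h2, h3, h4⟩ := h T hT
  exact ⟨h1, by rwa [Finset.union_comm], h4, h3⟩

theorem Mixed.selectable {A B : Finset (Sym2 V)} (hA : DegTwo (Adj A)) (hB : DegTwo (Adj B))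
    (hn : NoSwitch (Adj A) (Adj B)) (hn' : NoSwitch (Adj B) (Adj A))
    (S : Finset (Finset (Sym2 V))) (hM : Mixed A B S) : Selectable A B S := by
  induction S using Finset.strongInduction with
  | H S ih =>
  by_cases hS : ∃ v x y, IsAngle (Adj A) (Adj B) (Spans S) v x y ∧
      (∀ z, IsAngle (Adj A) (Adj B) (Spans S) v x z → z = y) ∧
      ∀ z, IsAngle (Adj A) (Adj B) (Spans S) v z y → z = x
  · obtain ⟨v, x, y, h1, h2, h3⟩ := hS
    exact .of_erase h1 h2 h3 (ih _ (Finset.erase_ssubset h1.1) (hM.mono (Finset.erase_subset _ _)))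
  obtain rfl | ⟨T, hT⟩ := S.eq_empty_or_nonempty
  · exact ⟨fun _ _ _ => False, by simp⟩
  obtain ⟨v, x, y, -, ha⟩ := hM.exists_angle hT
  have hst : Stuck (Adj A) (Adj B) (Spans S) :=
    ⟨hA, hB, hM.mixedTriangles, hn, hn', fun {v x y} h1 => by
      by_contra! hcon
      exact hS ⟨v, x, y, h1, fun z hz => (hcon z).1 hz,
        fun z hz => (hcon z).2 hz⟩⟩
  obtain ⟨a, b, c, e, ht⟩ | ⟨a, b, c, e, ht⟩ := hst.pure.exists_twins_or ha.1
  all_goals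
    have hss : (S.erase (tri a b c)).erase (tri a e c) ⊂ S :=
      (Finset.erase_subset _ _).trans_ssubset (Finset.erase_ssubset ht.left)
    have hsel := ih _ hss (hM.mono hss.1)
  · exact .of_twin hM ht hsel
  · exact (Selectable.of_twin hM.symm ht hsel.symm).symm

end Selection

section Runs
variable {D : Type*} (nxt : D → Option D) (v : D → ℚ)

/-- Sum of `v` along the first `n` elements of the `nxt`-orbit of `x`. -/
def runSum : ℕ → D → ℚ
  | 0, _ => 0
  | n + 1, x => v x + (nxt x).elim 0 (runSum n)

variable {nxt v}

theorem runSum_add {f : ℕ → D} (p q : ℕ) (hf : ∀ i < p, nxt (f i) = some (f (i + 1))) :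
    runSum nxt v (p + q) (f 0) = ∑ i ∈ Finset.range p, v (f i) + runSum nxt v q (f p) := by
  induction p generalizing f with
  | zero => simp
  | succ p ih =>
    have := ih (f := fun i => f (i + 1)) fun i hi => hf (i + 1) (by omega)
    simp only [zero_add] at this
    rw [show p + 1 + q = (p + q) + 1 by omega, runSum, hf 0 (by omega), Option.elim_some, this,
      Finset.sum_range_succ']
    ring

theorem exists_run (n : ℕ) (x : D) : ∃ (m : ℕ) (f : ℕ → D), m ≤ n ∧ f 0 = x ∧
    (∀ i, i + 1 < m → nxt (f i) = some (f (i + 1))) ∧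
    runSum nxt v n x = ∑ i ∈ Finset.range m, v (f i) ∧
    (m = n ∨ ∃ i, i + 1 = m ∧ nxt (f i) = none) := by
  induction n generalizing x with
  | zero => exact ⟨0, fun _ => x, by simp [runSum]⟩
  | succ n ih =>
    cases hx : nxt x with
    | none => exact ⟨1, fun _ => x, by simp [runSum, hx]⟩
    | some y =>
      obtain ⟨m, f, h1, h2, h3, h4, h5⟩ := ih y
      refine ⟨m + 1, fun i => if i = 0 then x else f (i - 1), by omega, by simp, ?_, ?_, ?_⟩
      · rintro (_ | i) hi
        · simp [hx, h2]
        · simpa using h3 i (by omega)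
      · simp [runSum, hx, h4, Finset.sum_range_succ', add_comm]
      · refine h5.imp (by omega) ?_
        rintro ⟨i, hi, h⟩
        exact ⟨i + 1, by omega, by simpa using h⟩

theorem shift_eq (hinj : ∀ x y z, nxt x = some z → nxt y = some z → x = y) {m : ℕ} {f : ℕ → D}
    (hf : ∀ i, i + 1 < m → nxt (f i) = some (f (i + 1))) (i d : ℕ) (hd : i + d < m)
    (h : f i = f (i + d)) : f 0 = f d := by
  induction i with
  | zero => simpa using h
  | succ i ih =>
    refine ih (by omega) (hinj _ _ (f (i + 1)) (hf i (by omega)) ?_)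
    rw [hf (i + d) (by omega), h, show i + d + 1 = i + 1 + d by omega]

/-- `x` begins a `nxt`-orbit. -/
def IsStart (nxt : D → Option D) (x : D) : Prop := ∀ y, nxt y ≠ some x

variable [Fintype D] [DecidableEq D] {blue : D → Prop} [DecidablePred blue]

theorem sum_elim_le (hinj : ∀ x y z, nxt x = some z → nxt y = some z → x = y)
    (P Q : D → Prop) [DecidablePred P] [DecidablePred Q]
    (hPQ : ∀ x y, nxt x = some y → (P x ↔ Q y)) (g : D → ℚ)
    (hg : ∀ x, Q x → IsStart nxt x → g x ≤ 0) :
    ∑ x with Q x, g x ≤ ∑ x with P x, (nxt x).elim 0 g := by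
  have h1 : ∀ x, (nxt x).elim 0 g = ∑ y, if nxt x = some y then g y else 0 := by
    intro x
    cases nxt x <;> simp
  simp only [h1]
  rw [Finset.sum_comm]
  simp only [Finset.sum_filter]
  refine Finset.sum_le_sum fun y _ => ?_
  by_cases hy : IsStart nxt y
  · simp only [hy _, if_false, ite_self, Finset.sum_const_zero]
    split_ifs with h
    exacts [hg y h hy, le_rfl]
  · obtain ⟨x, hx⟩ := not_forall_not.1 hy
    rw [Finset.sum_eq_single x]
    · simp [hx, hPQ x y hx]
    · intro z _ hz
      rw [if_neg fun h => hz (hinj _ _ _ h hx), ite_self]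
    · simp

/-- Averaging over all starting points gives an orbit segment of positive sum. -/
theorem exists_runSum_pos (hinj : ∀ x y z, nxt x = some z → nxt y = some z → x = y)
    (halt : ∀ x y, nxt x = some y → (blue x ↔ ¬ blue y)) (k : ℕ)
    (hpos : 0 < (k + 1) * ∑ x with blue x, v x + k * ∑ x with ¬ blue x, v x) :
    ∃ n ≤ 2 * k + 1, ∃ x, ((blue x ∧ Odd n) ∨ (¬ blue x ∧ IsStart nxt x ∧ Even n)) ∧
      0 < runSum nxt v n x := by
  by_contra! hcon
  have key : ∀ j ≤ k, (j + 1) * ∑ x with blue x, v x + j * ∑ x with ¬ blue x, v x ≤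
      ∑ x with blue x, runSum nxt v (2 * j + 1) x := by
    intro j hj
    induction j with
    | zero =>
      refine le_of_eq ?_
      simp only [Nat.cast_zero, zero_add, one_mul, zero_mul, add_zero, runSum]
      refine Finset.sum_congr rfl fun x _ => ?_
      cases nxt x <;> simp
    | succ j ih =>
      have h1 := ih (by omega)
      have h2 := sum_elim_le hinj (fun x => ¬ blue x) blue
        (fun x y h => by have := halt x y h; tauto) (runSum nxt v (2 * j + 1))
        fun x hx _ => hcon _ (by omega) x (Or.inl ⟨hx, by simp⟩)
      have h3 := sum_elim_le hinj blue (fun x => ¬ blue x) halt (runSum nxt v (2 * j + 2))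
        fun x hx hs => hcon _ (by omega) x (Or.inr ⟨hx, hs, by simp [Nat.even_add]⟩)
      rw [show 2 * (j + 1) + 1 = (2 * j + 2) + 1 by ring]
      have hstep : ∀ n (P : D → Prop) [DecidablePred P], ∑ x with P x, runSum nxt v (n + 1) x =
          ∑ x with P x, v x + ∑ x with P x, (nxt x).elim 0 (runSum nxt v n) :=
        fun n P _ => Finset.sum_add_distrib
      rw [hstep] at h3 ⊢
      push_cast
      linarith
  have h1 := key k le_rfl
  have h2 : ∑ x with blue x, runSum nxt v (2 * k + 1) x ≤ 0 :=
    Finset.sum_nonpos fun x hx => hcon _ le_rfl x (Or.inl ⟨(Finset.mem_filter.1 hx).2, by simp⟩)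
  linarith

/-- An orbit segment of positive sum without repetitions that contains both neighbours of each of
its non-blue elements. -/
theorem exists_closed_run (hinj : ∀ x y z, nxt x = some z → nxt y = some z → x = y)
    (halt : ∀ x y, nxt x = some y → (blue x ↔ ¬ blue y)) (k : ℕ)
    (hpos : 0 < (k + 1) * ∑ x with blue x, v x + k * ∑ x with ¬ blue x, v x) :
    ∃ (m : ℕ) (f : ℕ → D), m ≤ 2 * k + 1 ∧
      (∀ i, i + 1 < m → nxt (f i) = some (f (i + 1))) ∧
      (∀ i < m, ∀ j < m, f i = f j → i = j) ∧
      0 < ∑ i ∈ Finset.range m, v (f i) ∧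
      ∀ i < m, ¬ blue (f i) → ∀ y, (nxt (f i) = some y ∨ nxt y = some (f i)) →
        ∃ j < m, f j = y := by
  classical
  have hex := exists_runSum_pos hinj halt k hpos
  have hex' : ∃ n, n ≤ 2 * k + 1 ∧ ∃ x, ((blue x ∧ Odd n) ∨ (¬ blue x ∧ IsStart nxt x ∧ Even n)) ∧
      0 < runSum nxt v n x := hex
  obtain ⟨n, ⟨hn, x, hx, hS⟩, hmin⟩ := Nat.findX hex'
  obtain ⟨m, f, h1, rfl, h3, h4, h5⟩ := exists_run (nxt := nxt) (v := v) n x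
  have hcol : ∀ i < m, (blue (f i) ↔ (blue (f 0) ↔ Even i)) := by
    intro i hi
    induction i with
    | zero => simp
    | succ i ih =>
      have := halt _ _ (h3 i hi)
      have := ih (by omega)
      rw [Nat.even_add_one]
      clear hex hex' hmin hS hx h4 h5
      grind
  by_cases hrep : ∃ p, 1 ≤ p ∧ p < m ∧ f 0 = f p
  · obtain ⟨p, ⟨hp1, hpm, hp⟩, hpmin⟩ := Nat.findX hrep
    have hpe : Even p := by
      have := hcol p hpm
      rw [← hp] at this
      clear hex hex' hmin hS hx h4 h5
      grind
    have hb : blue (f 0) := by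
      rcases hx with hx | hx
      · exact hx.1
      · have := h3 (p - 1) (by omega)
        rw [show p - 1 + 1 = p by omega, ← hp] at this
        exact (hx.2.1 _ this).elim
    have hno : Odd n := by
      rcases hx with hx | hx
      exacts [hx.2, (hx.1 hb).elim]
    have hsum := runSum_add (v := v) (f := f) p (n - p) fun i hi => h3 i (by omega)
    rw [show p + (n - p) = n by omega, ← hp] at hsum
    have hle : runSum nxt v (n - p) (f 0) ≤ 0 := by
      by_contra! hgt
      refine hmin (n - p) (by omega) ⟨by omega, f 0, Or.inl ⟨hb, ?_⟩, hgt⟩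
      rw [Nat.odd_sub (by omega)]
      exact iff_of_true hno hpe
    refine ⟨p, f, by omega, fun i hi => h3 i (by omega), ?_, by linarith, ?_⟩
    · have : ∀ i j, i < j → j < p → f i ≠ f j := fun i j hij hj he =>
        hpmin (j - i) (by omega) ⟨by omega, by omega,
          shift_eq hinj h3 i (j - i) (by omega) (by rwa [show i + (j - i) = j by omega])⟩
      intro i hi j hj he
      rcases lt_trichotomy i j with h | h | h
      · exact (this i j h hj he).elim
      · exact h
      · exact (this j i h hi he.symm).elim
    · rintro i hi - y (hy | hy)
      · by_cases hip : i + 1 = p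
        · refine ⟨0, by omega, ?_⟩
          rw [h3 i (by omega), hip, ← hp] at hy
          exact Option.some_injective _ hy
        · rw [h3 i (by omega)] at hy
          exact ⟨i + 1, by omega, Option.some_injective _ hy⟩
      · obtain _ | i := i
        · refine ⟨p - 1, by omega, hinj _ _ (f 0) ?_ hy⟩
          rw [h3 _ (by omega), show p - 1 + 1 = p by omega, hp]
        · exact ⟨i, by omega, hinj _ _ _ (h3 i (by omega)) hy⟩
  · refine ⟨m, f, by omega, h3, ?_, h4 ▸ hS, ?_⟩
    · have : ∀ i j, i < j → j < m → f i ≠ f j := fun i j hij hj he =>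
        hrep ⟨j - i, by omega, by omega,
          shift_eq hinj h3 i (j - i) (by omega) (by rwa [show i + (j - i) = j by omega])⟩
      intro i hi j hj he
      rcases lt_trichotomy i j with h | h | h
      · exact (this i j h hj he).elim
      · exact h
      · exact (this j i h hi he.symm).elim
    · rintro i hi hr y (hy | hy)
      · by_cases him : i + 1 = m
        · rcases h5 with h5 | h5
          · have h6 := hcol i hi
            have h7 : Even n ↔ ¬ Even i := by rw [← h5, ← him, Nat.even_add_one]
            have h8 := Nat.not_even_iff_odd (n := n)
            clear hex hex' hmin hS h4 h5
            grind
          · obtain ⟨j, hj, h5⟩ := h5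
            obtain rfl : i = j := by omega
            simp [h5] at hy
        · rw [h3 i (by omega)] at hy
          exact ⟨i + 1, by omega, Option.some_injective _ hy⟩
      · obtain _ | i := i
        · rcases hx with hx | hx
          · exact (hr hx.1).elim
          · exact (hx.2.1 _ hy).elim
        · exact ⟨i, by omega, hinj _ _ _ (h3 i (by omega)) hy⟩

end Runs

section Degree
variable {V : Type*} [DecidableEq V]

theorem sym2Deg_mono {F G : Finset (Sym2 V)} (h : F ⊆ G) (v : V) : sym2Deg F v ≤ sym2Deg G v :=
  Finset.sum_le_sum_of_subset h

theorem sym2Deg_union {F G : Finset (Sym2 V)} (h : Disjoint F G) (v : V) :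
    sym2Deg (F ∪ G) v = sym2Deg F v + sym2Deg G v :=
  Finset.sum_union h

theorem IsTwoMatching.degTwo {A : Finset (Sym2 V)} (h : IsTwoMatching A) : DegTwo (Adj A) where
  symm := Adj.symm
  deg := by
    intro v a b c ha hb hc
    by_contra! hcon
    have h1 : ({s(v, a), s(v, b), s(v, c)} : Finset (Sym2 V)) ⊆ A := by
      simp only [Finset.insert_subset_iff, Finset.singleton_subset_iff]
      exact ⟨ha, hb, hc⟩
    have h2 := (sym2Deg_mono h1 v).trans (h v)
    rw [sym2Deg, Finset.sum_insert (by simp; grind), Finset.sum_insert (by simp; grind),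
      Finset.sum_singleton] at h2
    simp only [Sym2.mem_iff, true_or, if_true] at h2
    split_ifs at h2 <;> omega

end Degree

section Darts
variable {V : Type*}

/-- The head of an oriented edge. -/
noncomputable def dartHead (d : Sym2 V × Bool) : V :=
  if d.2 then (Quot.out d.1).1 else (Quot.out d.1).2

/-- The oppositely oriented edge. -/
def dartRev (d : Sym2 V × Bool) : Sym2 V × Bool := (d.1, !d.2)

@[simp] theorem dartRev_rev (d : Sym2 V × Bool) : dartRev (dartRev d) = d := by simp [dartRev]

@[simp] theorem dartRev_fst (d : Sym2 V × Bool) : (dartRev d).1 = d.1 := rfl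

theorem dartRev_ne (d : Sym2 V × Bool) : dartRev d ≠ d := by
  obtain ⟨e, b⟩ := d
  simp [dartRev]

theorem dartRev_injective : Function.Injective (dartRev (V := V)) :=
  Function.LeftInverse.injective dartRev_rev

theorem mk_dartHead (d : Sym2 V × Bool) : s(dartHead (dartRev d), dartHead d) = d.1 := by
  obtain ⟨e, b⟩ := d
  have h : s((Quot.out e).1, (Quot.out e).2) = e := Quot.out_eq e
  cases b
  · simpa [dartHead, dartRev] using h
  · rw [Sym2.eq_swap]
    simpa [dartHead, dartRev] using h

theorem dart_eq_or {d d' : Sym2 V × Bool} (h : d.1 = d'.1) : d = d' ∨ d = dartRev d' := by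
  obtain ⟨e, b⟩ := d
  obtain ⟨e', b'⟩ := d'
  cases b <;> cases b' <;> simp_all [dartRev]

theorem exists_dart {v x : V} : ∃ d : Sym2 V × Bool, d.1 = s(v, x) ∧ dartHead d = v := by
  have h := mk_dartHead (s(v, x), true)
  rw [Sym2.eq_iff] at h
  rcases h with h | h
  · exact ⟨_, rfl, h.1⟩
  · exact ⟨_, rfl, h.2⟩

theorem dart_ext {d d' : Sym2 V × Bool} (h : d.1 = d'.1) (h' : dartHead d = dartHead d')
    {v x : V} (hd : d.1 = s(v, x)) (hne : v ≠ x) : d = d' := by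
  rcases dart_eq_or h with h1 | rfl
  · exact h1
  · have h2 := mk_dartHead d'
    rw [h', ← h, hd, Sym2.eq_iff] at h2
    grind

variable [DecidableEq V]

theorem sym2Deg_eq_card (F : Finset (Sym2 V)) (v : V) :
    sym2Deg F v = #{d ∈ F ×ˢ (Finset.univ : Finset Bool) | dartHead d = v} := by
  rw [Finset.card_filter, Finset.sum_product, sym2Deg]
  refine Finset.sum_congr rfl fun e _ => ?_
  have h : s(dartHead (e, false), dartHead (e, true)) = e := mk_dartHead (e, true)
  rw [Fintype.sum_bool]
  generalize dartHead (e, false) = a at *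
  generalize dartHead (e, true) = b at *
  subst h
  have h1 : s(a, b) = s(v, v) ↔ a = v ∧ b = v := by simp
  simp only [h1, Sym2.mem_iff, eq_comm (a := v)]
  split_ifs <;> simp_all

theorem sym2Deg_le_of_inj {F G : Finset (Sym2 V)} {v : V}
    (R : Sym2 V × Bool → Sym2 V × Bool → Prop)
    (h : ∀ d, d.1 ∈ F → dartHead d = v → ∃ d', R d d' ∧ d'.1 ∈ G ∧ dartHead d' = v)
    (hR : ∀ a b c, R a c → R b c → a = b) : sym2Deg F v ≤ sym2Deg G v := by
  classical
  rw [sym2Deg_eq_card, sym2Deg_eq_card]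
  choose! f hf using h
  refine Finset.card_le_card_of_injOn f (fun d hd => ?_) fun a ha b hb hab => ?_
  · simp only [Finset.coe_filter, Finset.mem_product, Finset.mem_univ, and_true,
      Set.mem_ofPred_eq] at hd ⊢
    exact (hf d hd.1 hd.2).2
  · simp only [Finset.coe_filter, Finset.mem_product, Finset.mem_univ, and_true,
      Set.mem_ofPred_eq] at ha hb
    have h1 := (hf a ha.1 ha.2).1
    rw [hab] at h1
    exact hR _ _ _ h1 (hf b hb.1 hb.2).1

/-- A matching between the ends of edges in `A \ B` and the ends of edges in `B \ A` at the same
vertices. -/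
structure IsPairing (A B : Finset (Sym2 V)) (N : Set ((Sym2 V × Bool) × (Sym2 V × Bool))) :
    Prop where
  left : ∀ {r b}, (r, b) ∈ N → r.1 ∈ A \ B
  right : ∀ {r b}, (r, b) ∈ N → b.1 ∈ B \ A
  head : ∀ {r b}, (r, b) ∈ N → dartHead r = dartHead b
  inj : ∀ {r b b'}, (r, b) ∈ N → (r, b') ∈ N → b = b'
  inj' : ∀ {r s b}, (r, b) ∈ N → (s, b) ∈ N → r = s

/-- `P` contains with the first also the second member of every pair. -/
def Respects (N : Set ((Sym2 V × Bool) × (Sym2 V × Bool))) (P : Finset (Sym2 V)) : Prop :=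
  ∀ {r b}, (r, b) ∈ N → r.1 ∈ P → b.1 ∈ P

theorem IsPairing.exists_maximal [Finite V] {A B : Finset (Sym2 V)}
    {N₀ : Set ((Sym2 V × Bool) × (Sym2 V × Bool))} (h₀ : IsPairing A B N₀) :
    ∃ N, N₀ ⊆ N ∧ IsPairing A B N ∧ ∀ r b, r.1 ∈ A \ B → b.1 ∈ B \ A → dartHead r = dartHead b →
      (∃ b', (r, b') ∈ N) ∨ ∃ r', (r', b) ∈ N := by
  obtain ⟨N, h1, h2⟩ := (Set.toFinite {N | IsPairing A B N}).exists_le_maximal h₀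
  refine ⟨N, h1, h2.1, fun r b hr hb hh => ?_⟩
  by_contra! hcon
  obtain ⟨l, g, k, i, i'⟩ := h2.1
  have h3 : IsPairing A B (insert (r, b) N) := by
    constructor <;> simp only [Set.mem_insert_iff, Prod.mk.injEq]
    · rintro r' b' (⟨rfl, rfl⟩ | h)
      exacts [hr, l h]
    · rintro r' b' (⟨rfl, rfl⟩ | h)
      exacts [hb, g h]
    · rintro r' b' (⟨rfl, rfl⟩ | h)
      exacts [hh, k h]
    · rintro r' b' b'' (⟨rfl, rfl⟩ | h) (⟨h'', rfl⟩ | h')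
      exacts [rfl, (hcon.1 _ h').elim, (hcon.1 _ (h'' ▸ h)).elim, i h h']
    · rintro r' b' b'' (⟨rfl, rfl⟩ | h) (⟨rfl, h''⟩ | h')
      exacts [rfl, (hcon.2 _ h').elim, (hcon.2 _ (h'' ▸ h)).elim, i' h h']
  exact hcon.1 b (h2.le_of_ge h3 (Set.subset_insert _ _) (Set.mem_insert _ _))

theorem IsPairing.isTwoMatching {A B : Finset (Sym2 V)}
    {N : Set ((Sym2 V × Bool) × (Sym2 V × Bool))} (hN : IsPairing A B N)
    (hmax : ∀ r b, r.1 ∈ A \ B → b.1 ∈ B \ A → dartHead r = dartHead b →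
      (∃ b', (r, b') ∈ N) ∨ ∃ r', (r', b) ∈ N) {P : Finset (Sym2 V)} (hP : P ⊆ symmDiff A B)
    (hr : Respects N P) (hA : IsTwoMatching A) (hB : IsTwoMatching B) :
    IsTwoMatching (symmDiff B P) := by
  intro v
  have hP' : ∀ e ∈ P, (e ∈ A ∧ e ∉ B) ∨ (e ∈ B ∧ e ∉ A) := fun e he =>
    Finset.mem_symmDiff.1 (hP he)
  have e1 : symmDiff B P = (B \ P) ∪ (P ∩ (A \ B)) := by
    ext e
    have := hP' e
    simp only [Finset.mem_symmDiff, Finset.mem_union, Finset.mem_sdiff, Finset.mem_inter]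
    tauto
  by_cases hv : ∀ r, r.1 ∈ A \ B → dartHead r = v → ∃ b, (r, b) ∈ N
  · have h1 : sym2Deg (P ∩ (A \ B)) v ≤ sym2Deg (P ∩ B) v := by
      refine sym2Deg_le_of_inj (fun r b => (r, b) ∈ N) (fun r h h' => ?_) fun a b c => hN.inj'
      obtain ⟨b, hb⟩ := hv r (Finset.mem_inter.1 h).2 h'
      exact ⟨b, hb, Finset.mem_inter.2 ⟨hr hb (Finset.mem_inter.1 h).1,
        (Finset.mem_sdiff.1 (hN.right hb)).1⟩, by rw [← hN.head hb, h']⟩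
    have e2 : B = (B \ P) ∪ (P ∩ B) := by
      rw [Finset.inter_comm, Finset.sdiff_union_inter]
    have h2 := hB v
    rw [e2, sym2Deg_union (by rw [Finset.inter_comm]; exact Finset.disjoint_sdiff_inter _ _)] at h2
    rw [e1, sym2Deg_union]
    · omega
    · exact Finset.disjoint_left.2 fun e => by simp; tauto
  · push Not at hv
    obtain ⟨r₀, hr₀, hr₀', hr₁⟩ := hv
    have h1 : sym2Deg ((B \ A) \ P) v ≤ sym2Deg ((A \ B) \ P) v := by
      refine sym2Deg_le_of_inj (fun b r => (r, b) ∈ N) (fun b h h' => ?_) fun a b c => hN.inj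
      obtain ⟨b', hb'⟩ | ⟨r, hr'⟩ :=
        hmax r₀ b hr₀ (Finset.mem_sdiff.1 h).1 (by rw [hr₀', h'])
      · exact (hr₁ _ hb').elim
      · exact ⟨r, hr', Finset.mem_sdiff.2 ⟨hN.left hr', fun hrP =>
          (Finset.mem_sdiff.1 h).2 (hr hr' hrP)⟩, by rw [hN.head hr', h']⟩
    have e2 : A = (A ∩ B) ∪ (((A \ B) \ P) ∪ (P ∩ (A \ B))) := by
      ext e
      simp only [Finset.mem_union, Finset.mem_sdiff, Finset.mem_inter]
      tauto
    have e3 : B \ P = (A ∩ B) ∪ ((B \ A) \ P) := by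
      ext e
      have := hP' e
      simp only [Finset.mem_union, Finset.mem_sdiff, Finset.mem_inter]
      tauto
    have h2 := hA v
    rw [e2, sym2Deg_union, sym2Deg_union] at h2
    · rw [e1, sym2Deg_union, e3, sym2Deg_union]
      · omega
      all_goals
        exact Finset.disjoint_left.2 fun e => by
          simp only [Finset.mem_sdiff, Finset.mem_inter]; tauto
    all_goals
      exact Finset.disjoint_left.2 fun e => by
        simp only [Finset.mem_union, Finset.mem_sdiff, Finset.mem_inter]; tauto

/-- A selection of angles induces a maximal pairing which respects the angles. -/
theorem Selectable.exists_pairing [Finite V] {A B : Finset (Sym2 V)}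
    {S : Finset (Finset (Sym2 V))} (hM : Mixed A B S) (h : Selectable A B S) :
    ∃ N, IsPairing A B N ∧ (∀ r b, r.1 ∈ A \ B → b.1 ∈ B \ A → dartHead r = dartHead b →
      (∃ b', (r, b') ∈ N) ∨ ∃ r', (r', b) ∈ N) ∧
      ∀ P, Respects N P → ∀ T ∈ S, ∃ r ∈ T, ∃ b ∈ T, r ∈ A \ B ∧ b ∈ B \ A ∧ (r ∈ P → b ∈ P) := by
  obtain ⟨Sel, h1, h2, h3, h4⟩ := h
  have hmt := hM.mixedTriangles
  have h₀ : IsPairing A B {p | ∃ v x y, Sel v x y ∧ dartHead p.1 = v ∧ dartHead p.2 = v ∧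
      p.1.1 = s(v, x) ∧ p.2.1 = s(v, y)} := by
    constructor
    · rintro r b ⟨v, x, y, hs, -, -, hr, -⟩
      exact hr ▸ Finset.mem_sdiff.2 (h1 _ _ _ hs).2.1
    · rintro r b ⟨v, x, y, hs, -, -, -, hb⟩
      exact hb ▸ Finset.mem_sdiff.2 (h1 _ _ _ hs).2.2
    · rintro r b ⟨v, x, y, hs, hr, hb, -⟩
      exact hr.trans hb.symm
    · rintro r b b' ⟨v, x, y, hs, hr, hb, er, eb⟩ ⟨v', x', y', hs', hr', hb', er', eb'⟩
      simp only at *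
      obtain rfl : v = v' := hr.symm.trans hr'
      obtain rfl : x = x' := Sym2.congr_right.1 (er.symm.trans er')
      obtain rfl : y = y' := h2 _ _ _ _ hs hs'
      exact dart_ext (eb.trans eb'.symm) (hb.trans hb'.symm) eb (hmt.ne (hmt.swap (h1 _ _ _ hs).1))
    · rintro r r' b ⟨v, x, y, hs, hr, hb, er, eb⟩ ⟨v', x', y', hs', hr', hb', er', eb'⟩
      simp only at *
      obtain rfl : v = v' := hb.symm.trans hb'
      obtain rfl : y = y' := Sym2.congr_right.1 (eb.symm.trans eb')
      obtain rfl : x = x' := h3 _ _ _ _ hs hs'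
      exact dart_ext (er.trans er'.symm) (hr.trans hr'.symm) er (hmt.ne (h1 _ _ _ hs).1)
  obtain ⟨N, hN₀, hN, hmax⟩ := h₀.exists_maximal
  refine ⟨N, hN, hmax, fun P hP T hT => ?_⟩
  obtain ⟨v, x, y, hs, rfl⟩ := h4 T hT
  obtain ⟨r, hr, hr'⟩ := exists_dart (v := v) (x := x)
  obtain ⟨b, hb, hb'⟩ := exists_dart (v := v) (x := y)
  have hrb : (r, b) ∈ N := hN₀ ⟨v, x, y, hs, hr', hb', hr, hb⟩
  have := hP hrb
  rw [hr, hb] at this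
  exact ⟨s(v, x), by simp [tri], s(v, y), by simp [tri], hr ▸ hN.left hrb, hb ▸ hN.right hrb,
    this⟩

end Darts

section Trails
variable {V : Type*}

theorem exists_option_graph {α β : Type*} (R : α → β → Prop)
    (h : ∀ a b b', R a b → R a b' → b = b') : ∃ f : α → Option β, ∀ a b, f a = some b ↔ R a b := by
  classical
  refine ⟨fun a => if h' : ∃ b, R a b then some h'.choose else none, fun a b => ?_⟩
  dsimp only
  split_ifs with h'
  · rw [Option.some_inj]
    exact ⟨fun e => e ▸ h'.choose_spec, fun hb => h _ _ _ h'.choose_spec hb⟩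
  · exact iff_of_false (by simp) fun hb => h' ⟨b, hb⟩

/-- The darts `f i`, `i < m`, of an orbit contain no edge in both orientations. -/
theorem ne_dartRev {nxt : Sym2 V × Bool → Option (Sym2 V × Bool)}
    (hrev : ∀ x y, nxt x = some y → nxt (dartRev y) = some (dartRev x))
    (hne : ∀ x, nxt x ≠ some (dartRev x)) {m : ℕ} {f : ℕ → Sym2 V × Bool}
    (hf : ∀ i, i + 1 < m → nxt (f i) = some (f (i + 1)))
    (d i : ℕ) (hid : i + d < m) :
    f i ≠ dartRev (f (i + d)) := by
  induction d using Nat.twoStepInduction generalizing i with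
  | zero => exact (dartRev_ne _).symm
  | one =>
    intro h
    have h1 := hf i hid
    rw [← dartRev_rev (f (i + 1)), ← h] at h1
    exact hne _ h1
  | more d ih _ =>
    intro h
    refine ih (i + 1) (by omega) ?_
    have h1 := hf (i + 1 + d) (by omega)
    rw [show i + 1 + d + 1 = i + (d + 2) by omega, ← dartRev_rev (f (i + (d + 2))), ← h] at h1
    have h2 := hrev _ _ h1
    rw [dartRev_rev, hf i (by omega)] at h2
    exact Option.some_injective _ h2

theorem card_le_of_no_consecutive (m : ℕ) (L : Finset ℕ) (hL : ∀ i ∈ L, i < m)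
    (h : ∀ i ∈ L, i + 1 ∉ L) : 2 * #L ≤ m + 1 := by
  have h1 : Disjoint L (L.map (addRightEmbedding 1)) := by
    rw [Finset.disjoint_left]
    intro i hi hi'
    obtain ⟨j, hj, rfl⟩ := Finset.mem_map.1 hi'
    exact h j hj hi
  have h2 : L ∪ L.map (addRightEmbedding 1) ⊆ Finset.range (m + 1) := by
    intro i hi
    rw [Finset.mem_range]
    rcases Finset.mem_union.1 hi with hi | hi
    · have := hL i hi
      omega
    · obtain ⟨j, hj, rfl⟩ := Finset.mem_map.1 hi
      have := hL j hj
      simp only [addRightEmbedding_apply]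
      omega
  have h3 := Finset.card_le_card h2
  rw [Finset.card_union_of_disjoint h1, Finset.card_map, Finset.card_range] at h3
  omega

variable [DecidableEq V]

theorem IsTrail.add_two_mul_trailSl_le {E : Finset (Sym2 V)} {m : ℕ} {u : ℕ → V}
    (h : IsTrail E m u) : m + 2 * trailSl m u ≤ 2 * m + 1 := by
  have h1 := card_le_of_no_consecutive m ((Finset.range m).filter fun i => u i = u (i + 1))
    (fun i hi => Finset.mem_range.1 (Finset.mem_filter.1 hi).1) fun i hi hi' => by
      simp only [Finset.mem_filter, Finset.mem_range] at hi hi'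
      have := h.2 i hi.1 (i + 1) hi'.1 (by rw [← hi'.2, ← hi.2])
      omega
  rw [trailSl]
  omega

end Trails

section Exchange
variable {V : Type*} [DecidableEq V]

theorem wSum_symmDiff_s1 (w : Sym2 V → ℚ) (B P : Finset (Sym2 V)) :
    wSum w (symmDiff B P) = wSum w B + ∑ e ∈ P, if e ∈ B then -w e else w e := by
  have h1 : symmDiff B P = (B \ P) ∪ (P \ B) := rfl
  have h2 := Finset.sum_sdiff_eq_sub (f := w) (Finset.inter_subset_left (s₁ := B) (s₂ := P))
  have h3 : ∑ e ∈ P with e ∈ B, -w e = - ∑ e ∈ B ∩ P, w e := by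
    rw [Finset.sum_neg_distrib, Finset.filter_mem_eq_inter, Finset.inter_comm]
  have h4 : ∑ e ∈ P with e ∉ B, w e = ∑ e ∈ P \ B, w e := by
    rw [Finset.filter_notMem_eq_sdiff]
  rw [wSum, wSum, Finset.sum_ite, h3, h4, h1, Finset.sum_union disjoint_sdiff_sdiff,
    ← Finset.sdiff_inter_self_left, h2]
  ring

/-- The triangles of `𝒯` in `A ∪ B`, none of which is contained in `A` or `B`. -/
def mixedPart (A B : Finset (Sym2 V)) (𝒯 : Finset (Finset (Sym2 V))) : Finset (Finset (Sym2 V)) :=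
  𝒯.filter (· ⊆ A ∪ B)

theorem mixed_mixedPart {A B : Finset (Sym2 V)} {𝒯 : Finset (Finset (Sym2 V))}
    (h𝒯 : ∀ T ∈ 𝒯, IsTriangle T) (hA : TFree 𝒯 A) (hB : TFree 𝒯 B) :
    Mixed A B (mixedPart A B 𝒯) := by
  intro T hT
  obtain ⟨h1, h2⟩ := Finset.mem_filter.1 hT
  exact ⟨h𝒯 T h1, h2, hA T h1, hB T h1⟩

theorem sum_darts_s1 [Fintype V] (F : Finset (Sym2 V)) (g : Sym2 V → ℚ) :
    ∑ d : Sym2 V × Bool with d.1 ∈ F, g d.1 = 2 * ∑ e ∈ F, g e := by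
  have : ({d | d.1 ∈ F} : Finset (Sym2 V × Bool)) = F ×ˢ Finset.univ := by
    ext d
    simp
  rw [this, Finset.sum_product, Finset.mul_sum]
  simp

theorem Selectable.exists_trail [Fintype V] {A B : Finset (Sym2 V)} (w : Sym2 V → ℚ)
    {𝒯 : Finset (Finset (Sym2 V))} (h𝒯 : ∀ T ∈ 𝒯, IsTriangle T)
    (hA : IsTwoMatching A) (hB : IsTwoMatching B) (hAf : TFree 𝒯 A) (hBf : TFree 𝒯 B)
    (hsel : Selectable A B (mixedPart A B 𝒯)) (k : ℕ)
    (hpos : (k + 1) * wSum w (B \ A) < k * wSum w (A \ B)) :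
    ∃ (m : ℕ) (u : ℕ → V), IsAltTrail A B m u ∧
      IsTwoMatching (symmDiff B (trailEdges m u)) ∧
      TFree 𝒯 (symmDiff B (trailEdges m u)) ∧
      wSum w B < wSum w (symmDiff B (trailEdges m u)) ∧ m + 2 * trailSl m u ≤ 4 * k + 3 := by
  classical
  obtain ⟨N, hN, hmax, hT⟩ := hsel.exists_pairing (mixed_mixedPart h𝒯 hAf hBf)
  have dis : ∀ e, e ∈ A \ B → e ∈ B \ A → False := fun e h h' =>
    (Finset.mem_sdiff.1 h).2 (Finset.mem_sdiff.1 h').1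
  let R : Sym2 V × Bool → Sym2 V × Bool → Prop := fun x y => (x, y) ∈ N ∨ (y, x) ∈ N
  have Rsymm : ∀ x y, R x y → R y x := fun x y h => h.symm
  have Rfun : ∀ x y z, R x y → R x z → y = z := by
    rintro x y z (h | h) (h' | h')
    exacts [hN.inj h h', (dis _ (hN.left h) (hN.right h')).elim,
      (dis _ (hN.left h') (hN.right h)).elim, hN.inj' h h']
  have Rcol : ∀ x y, R x y → (x.1 ∈ A \ B ∧ y.1 ∈ B \ A) ∨ (x.1 ∈ B \ A ∧ y.1 ∈ A \ B) := by
    rintro x y (h | h)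
    exacts [Or.inl ⟨hN.left h, hN.right h⟩, Or.inr ⟨hN.right h, hN.left h⟩]
  have Rhead : ∀ x y, R x y → dartHead x = dartHead y := by
    rintro x y (h | h)
    exacts [hN.head h, (hN.head h).symm]
  obtain ⟨nxt, hnxt⟩ := exists_option_graph (fun x y => R x (dartRev y))
    fun x y z h h' => dartRev_injective (Rfun _ _ _ h h')
  have hinj : ∀ x y z, nxt x = some z → nxt y = some z → x = y := fun x y z h h' =>
    Rfun (dartRev z) _ _ (Rsymm _ _ ((hnxt _ _).1 h)) (Rsymm _ _ ((hnxt _ _).1 h'))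
  have hrev : ∀ x y, nxt x = some y → nxt (dartRev y) = some (dartRev x) := fun x y h => by
    rw [hnxt, dartRev_rev]
    exact Rsymm _ _ ((hnxt _ _).1 h)
  have hne : ∀ x, nxt x ≠ some (dartRev x) := fun x h => by
    rw [hnxt, dartRev_rev] at h
    rcases Rcol _ _ h with h | h
    exacts [dis _ h.1 h.2, dis _ h.2 h.1]
  have hcol : ∀ x y, nxt x = some y → (x.1 ∈ A \ B ∧ y.1 ∈ B \ A) ∨ (x.1 ∈ B \ A ∧ y.1 ∈ A \ B) :=
    fun x y h => Rcol x (dartRev y) ((hnxt _ _).1 h)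
  have halt : ∀ x y, nxt x = some y → (x.1 ∈ B \ A ↔ ¬ y.1 ∈ B \ A) := fun x y h => by
    rcases hcol x y h with h | h
    · exact iff_of_false (fun h' => dis _ h.1 h') (not_not.2 h.2)
    · exact iff_of_true h.1 fun h' => dis _ h.2 h'
  let g : Sym2 V → ℚ := fun e => if e ∈ symmDiff A B then (if e ∈ B then -w e else w e) else 0
  have hred : ∑ x : Sym2 V × Bool with ¬ x.1 ∈ B \ A, g x.1 = 2 * wSum w (A \ B) := by
    rw [wSum, ← sum_darts_s1]
    simp only [Finset.sum_filter]
    refine Finset.sum_congr rfl fun x _ => ?_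
    simp only [g, Finset.mem_symmDiff, Finset.mem_sdiff]
    split_ifs <;> first | rfl | tauto
  have hblue : ∑ x : Sym2 V × Bool with x.1 ∈ B \ A, g x.1 = -(2 * wSum w (B \ A)) := by
    rw [wSum, ← sum_darts_s1, ← Finset.sum_neg_distrib]
    simp only [Finset.sum_filter]
    refine Finset.sum_congr rfl fun x _ => ?_
    simp only [g, Finset.mem_symmDiff, Finset.mem_sdiff]
    split_ifs <;> first | rfl | tauto
  obtain ⟨m, f, hm, hf, hfinj, hsum, hclosed⟩ :=
    exists_closed_run (v := fun x => g x.1) (blue := fun x => x.1 ∈ B \ A) hinj halt k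
      (by rw [hred, hblue]; linarith)
  have hmem : ∀ i < m, (f i).1 ∈ symmDiff A B := by
    intro i hi
    rw [Finset.mem_symmDiff, ← Finset.mem_sdiff, ← Finset.mem_sdiff]
    by_cases h1 : i + 1 < m
    · rcases hcol _ _ (hf i h1) with h | h
      exacts [Or.inl h.1, Or.inr h.1]
    obtain _ | i := i
    · obtain rfl : m = 1 := by omega
      by_contra h2
      rw [Finset.mem_sdiff, Finset.mem_sdiff, ← Finset.mem_symmDiff] at h2
      simp [g, h2] at hsum
    · rcases hcol _ _ (hf i hi) with h | h
      exacts [Or.inr h.2, Or.inl h.2]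
  have hedge : ∀ i < m, ∀ j < m, (f i).1 = (f j).1 → i = j := by
    intro i hi j hj h
    rcases dart_eq_or h with h | h
    · exact hfinj i hi j hj h
    · rcases le_total i j with hij | hij
      · have := ne_dartRev hrev hne hf (j - i) i (by omega)
        rw [show i + (j - i) = j by omega] at this
        exact (this h).elim
      · have := ne_dartRev hrev hne hf (i - j) j (by omega)
        rw [show j + (i - j) = i by omega, h, dartRev_rev] at this
        exact (this rfl).elim
  obtain ⟨u, hu⟩ : ∃ u : ℕ → V, ∀ i < m, s(u i, u (i + 1)) = (f i).1 := by
    refine ⟨fun i => if i = 0 then dartHead (dartRev (f 0)) else dartHead (f (i - 1)), ?_⟩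
    rintro (_ | i) hi
    · simpa using mk_dartHead (f 0)
    · have h1 := Rhead _ _ ((hnxt _ _).1 (hf i hi))
      simpa [h1] using mk_dartHead (f (i + 1))
  have htrail : IsTrail (symmDiff A B) m u :=
    ⟨fun i hi => hu i hi ▸ hmem i hi,
      fun i hi j hj h => hedge i hi j hj (by rwa [← hu i hi, ← hu j hj])⟩
  have hP : trailEdges m u = (Finset.range m).image fun i => (f i).1 :=
    Finset.image_congr fun i hi => hu i (Finset.mem_range.1 hi)
  have hPsub : trailEdges m u ⊆ symmDiff A B := by
    rw [hP, Finset.image_subset_iff]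
    exact fun i hi => hmem i (Finset.mem_range.1 hi)
  have hresp : Respects N (trailEdges m u) := by
    intro r b hrb hr
    rw [hP, Finset.mem_image] at hr ⊢
    obtain ⟨i, hi, hir⟩ := hr
    have hi' := Finset.mem_range.1 hi
    have hnb : ¬ (f i).1 ∈ B \ A := fun h => dis _ (hN.left hrb) (hir ▸ h)
    rcases dart_eq_or hir with h | h
    · obtain ⟨j, hj, hjb⟩ := hclosed i hi' hnb (dartRev b) (Or.inl (by
        rw [hnxt, dartRev_rev, h]
        exact Or.inl hrb))
      exact ⟨j, Finset.mem_range.2 hj, by rw [hjb, dartRev_fst]⟩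
    · obtain ⟨j, hj, hjb⟩ := hclosed i hi' hnb b (Or.inr (by
        rw [hnxt, h, dartRev_rev]
        exact Or.inr hrb))
      exact ⟨j, Finset.mem_range.2 hj, by rw [hjb]⟩
  refine ⟨m, u, ⟨htrail, fun i hi => ?_⟩, hN.isTwoMatching hmax hPsub hresp hA hB, ?_, ?_, ?_⟩
  · have h1 := hu (i + 1) hi
    rw [hu i (by omega), show i + 2 = i + 1 + 1 from rfl, h1]
    rcases hcol _ _ (hf i hi) with h | h
    · exact iff_of_true h.1 h.2
    · exact iff_of_false (fun h' => dis _ h' h.1) fun h' => dis _ h.2 h'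
  · intro T hT𝒯 hTsub
    have hTS : T ∈ mixedPart A B 𝒯 := by
      refine Finset.mem_filter.2 ⟨hT𝒯, fun e he => ?_⟩
      have h1 := hTsub he
      rw [Finset.mem_symmDiff] at h1
      have h2 := @hPsub e
      rw [Finset.mem_symmDiff] at h2
      rw [Finset.mem_union]
      tauto
    obtain ⟨r, hr, b, hb, hrA, hbB, himp⟩ := hT _ hresp T hTS
    have h1 := hTsub hr
    have h2 := hTsub hb
    rw [Finset.mem_symmDiff] at h1 h2
    rw [Finset.mem_sdiff] at hrA hbB
    tauto
  · rw [wSum_symmDiff_s1, hP, Finset.sum_image fun i hi j hj h =>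
      hedge i (Finset.mem_range.1 hi) j (Finset.mem_range.1 hj) h]
    have : ∑ i ∈ Finset.range m, g (f i).1 =
        ∑ i ∈ Finset.range m, if (f i).1 ∈ B then -w (f i).1 else w (f i).1 :=
      Finset.sum_congr rfl fun i hi => if_pos (hmem i (Finset.mem_range.1 hi))
    linarith
  · have := htrail.add_two_mul_trailSl_le
    omega

end Exchange

section Switch
variable {V : Type*} [DecidableEq V]

theorem IsAltTrail.symm {A B : Finset (Sym2 V)} {k : ℕ} {u : ℕ → V} (h : IsAltTrail A B k u) :
    IsAltTrail B A k u := by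
  obtain ⟨⟨h1, h2⟩, h3⟩ := h
  refine ⟨⟨symmDiff_comm A B ▸ h1, h2⟩, fun i hi => ?_⟩
  have a1 := h1 i (by omega)
  have a2 : s(u (i + 1), u (i + 2)) ∈ symmDiff A B := h1 (i + 1) (by omega)
  have a3 := h3 i hi
  simp only [Finset.mem_symmDiff, Finset.mem_sdiff] at *
  tauto

/-- The closed sequence through four vertices. -/
def fourCycle (p₀ p₁ p₂ p₃ : V) : ℕ → V
  | 1 => p₁
  | 2 => p₂
  | 3 => p₃
  | _ => p₀

theorem trailEdges_fourCycle (p₀ p₁ p₂ p₃ : V) :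
    trailEdges 4 (fourCycle p₀ p₁ p₂ p₃) = {s(p₀, p₁), s(p₂, p₃)} ∪ {s(p₁, p₂), s(p₃, p₀)} := by
  ext e
  simp only [trailEdges, show Finset.range 4 = {0, 1, 2, 3} by rfl, Finset.image_insert,
    Finset.image_singleton, fourCycle, Finset.mem_insert, Finset.mem_union, Finset.mem_singleton,
    Nat.reduceAdd]
  tauto

/-- Two opposite edges `p₀ p₁`, `p₂ p₃` of a 4-cycle lie in `F`, the other two do not. -/
structure Switchable (F : Finset (Sym2 V)) (p₀ p₁ p₂ p₃ : V) : Prop where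
  ne₀₁ : p₀ ≠ p₁
  ne₀₂ : p₀ ≠ p₂
  ne₀₃ : p₀ ≠ p₃
  ne₁₂ : p₁ ≠ p₂
  ne₁₃ : p₁ ≠ p₃
  ne₂₃ : p₂ ≠ p₃
  h₀₁ : s(p₀, p₁) ∈ F
  h₂₃ : s(p₂, p₃) ∈ F
  h₁₂ : s(p₁, p₂) ∉ F
  h₃₀ : s(p₃, p₀) ∉ F

namespace Switchable
variable {F : Finset (Sym2 V)} {p₀ p₁ p₂ p₃ : V}

theorem symmDiff_eq (h : Switchable F p₀ p₁ p₂ p₃) :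
    symmDiff F (trailEdges 4 (fourCycle p₀ p₁ p₂ p₃)) =
      (F \ {s(p₀, p₁), s(p₂, p₃)}) ∪ {s(p₁, p₂), s(p₃, p₀)} := by
  obtain ⟨-, -, -, -, -, -, h1, h2, h3, h4⟩ := h
  ext e
  simp only [trailEdges_fourCycle, Finset.mem_symmDiff, Finset.mem_sdiff, Finset.mem_insert,
    Finset.mem_union, Finset.mem_singleton]
  grind

theorem disjoint_new (h : Switchable F p₀ p₁ p₂ p₃) :
    Disjoint (F \ {s(p₀, p₁), s(p₂, p₃)}) {s(p₁, p₂), s(p₃, p₀)} := by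
  rw [Finset.disjoint_left]
  rintro e h1 h2
  simp only [Finset.mem_insert, Finset.mem_singleton] at h2
  rcases h2 with rfl | rfl
  exacts [h.h₁₂ (Finset.mem_sdiff.1 h1).1, h.h₃₀ (Finset.mem_sdiff.1 h1).1]

theorem subset (h : Switchable F p₀ p₁ p₂ p₃) : {s(p₀, p₁), s(p₂, p₃)} ⊆ F := by
  simp [Finset.insert_subset_iff, h.h₀₁, h.h₂₃]

theorem sum_symmDiff {M : Type*} [AddCommMonoid M] (h : Switchable F p₀ p₁ p₂ p₃)
    (g : Sym2 V → M) :
    ∑ e ∈ symmDiff F (trailEdges 4 (fourCycle p₀ p₁ p₂ p₃)), g e + (g s(p₀, p₁) + g s(p₂, p₃)) =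
      ∑ e ∈ F, g e + (g s(p₁, p₂) + g s(p₃, p₀)) := by
  have h1 : s(p₀, p₁) ≠ s(p₂, p₃) := by simp [h.ne₀₂, h.ne₀₃]
  have h2 : s(p₁, p₂) ≠ s(p₃, p₀) := by simp [h.ne₁₃, h.ne₀₁.symm]
  rw [h.symmDiff_eq, Finset.sum_union h.disjoint_new, Finset.sum_pair h2,
    ← Finset.sum_sdiff h.subset, Finset.sum_pair h1]
  abel

theorem isTwoMatching (h : Switchable F p₀ p₁ p₂ p₃) (hF : IsTwoMatching F) :
    IsTwoMatching (symmDiff F (trailEdges 4 (fourCycle p₀ p₁ p₂ p₃))) := by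
  intro v
  have h1 := h.sum_symmDiff fun e => if e = s(v, v) then 2 else if v ∈ e then 1 else 0
  have h2 := hF v
  rw [sym2Deg] at h2 ⊢
  obtain ⟨n01, n02, n03, n12, n13, n23, -, -, -, -⟩ := h
  have e1 : ∀ a b : V, a ≠ b → s(a, b) ≠ s(v, v) := by
    intro a b hab
    simp
    grind
  simp only [e1 _ _ n01, e1 _ _ n23, e1 _ _ n12, e1 _ _ n03.symm, if_false, Sym2.mem_iff] at h1
  have h3 : ((if v = p₀ ∨ v = p₁ then 1 else 0) + if v = p₂ ∨ v = p₃ then 1 else 0) =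
      ((if v = p₁ ∨ v = p₂ then 1 else 0) + if v = p₃ ∨ v = p₀ then 1 else 0) := by
    grind
  omega

theorem tFree (h : Switchable F p₀ p₁ p₂ p₃) {𝒯 : Finset (Finset (Sym2 V))}
    (h𝒯 : ∀ T ∈ 𝒯, IsTriangle T) (hF : TFree 𝒯 F)
    (h1 : ∀ z, z ≠ p₁ → z ≠ p₂ → Adj (symmDiff F (trailEdges 4 (fourCycle p₀ p₁ p₂ p₃))) p₁ z →
      ¬ Adj (symmDiff F (trailEdges 4 (fourCycle p₀ p₁ p₂ p₃))) p₂ z)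
    (h2 : ∀ z, z ≠ p₃ → z ≠ p₀ → Adj (symmDiff F (trailEdges 4 (fourCycle p₀ p₁ p₂ p₃))) p₃ z →
      ¬ Adj (symmDiff F (trailEdges 4 (fourCycle p₀ p₁ p₂ p₃))) p₀ z) :
    TFree 𝒯 (symmDiff F (trailEdges 4 (fourCycle p₀ p₁ p₂ p₃))) := by
  intro T hT hsub
  have key : ∀ x y, s(x, y) ∈ T → ∃ z, z ≠ x ∧ z ≠ y ∧ s(x, z) ∈ T ∧ s(y, z) ∈ T := by
    intro x y hxy
    obtain ⟨a, b, c, hab, hac, hbc, rfl⟩ := h𝒯 T hT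
    simp only [Finset.mem_insert, Finset.mem_singleton, Sym2.eq_iff] at hxy
    have hba : s(b, a) = s(a, b) := Sym2.eq_swap
    have hca : s(c, a) = s(a, c) := Sym2.eq_swap
    have hcb : s(c, b) = s(b, c) := Sym2.eq_swap
    rcases hxy with (⟨rfl, rfl⟩ | ⟨rfl, rfl⟩) | (⟨rfl, rfl⟩ | ⟨rfl, rfl⟩) |
      (⟨rfl, rfl⟩ | ⟨rfl, rfl⟩)
    · exact ⟨c, hac.symm, hbc.symm, by simp, by simp⟩
    · exact ⟨c, hbc.symm, hac.symm, by simp, by simp⟩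
    · exact ⟨a, hab, hac, by simp, by simp [hca]⟩
    · exact ⟨a, hac, hab, by simp [hca], by simp⟩
    · exact ⟨b, hab.symm, hbc, by simp, by simp [hcb]⟩
    · exact ⟨b, hbc, hab.symm, by simp [hcb], by simp⟩
  have hnew : s(p₁, p₂) ∈ T ∨ s(p₃, p₀) ∈ T := by
    by_contra! hcon
    refine hF T hT fun e he => ?_
    have h3 := hsub he
    rw [h.symmDiff_eq] at h3
    simp only [Finset.mem_union, Finset.mem_sdiff, Finset.mem_insert, Finset.mem_singleton] at h3
    rcases h3 with h3 | rfl | rfl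
    exacts [h3.1, (hcon.1 he).elim, (hcon.2 he).elim]
  rcases hnew with hn | hn
  · obtain ⟨z, z1, z2, z3, z4⟩ := key _ _ hn
    exact h1 z z1 z2 (hsub z3) (hsub z4)
  · obtain ⟨z, z1, z2, z3, z4⟩ := key _ _ hn
    exact h2 z z1 z2 (hsub z3) (hsub z4)

theorem adj_iff (h : Switchable F p₀ p₁ p₂ p₃) (x y : V) :
    Adj (symmDiff F (trailEdges 4 (fourCycle p₀ p₁ p₂ p₃))) x y ↔
      (Adj F x y ∧ ¬ (x = p₀ ∧ y = p₁) ∧ ¬ (x = p₁ ∧ y = p₀) ∧ ¬ (x = p₂ ∧ y = p₃) ∧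
        ¬ (x = p₃ ∧ y = p₂)) ∨ (x = p₁ ∧ y = p₂) ∨ (x = p₂ ∧ y = p₁) ∨ (x = p₃ ∧ y = p₀) ∨
        (x = p₀ ∧ y = p₃) := by
  rw [Adj, h.symmDiff_eq]
  simp only [Finset.mem_union, Finset.mem_sdiff, Finset.mem_insert, Finset.mem_singleton, Adj,
    Sym2.eq_iff, not_or, or_assoc]

end Switchable

theorem fourCycle_rotate (p₀ p₁ p₂ p₃ : V) :
    trailEdges 4 (fourCycle p₁ p₂ p₃ p₀) = trailEdges 4 (fourCycle p₀ p₁ p₂ p₃) := by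
  rw [trailEdges_fourCycle, trailEdges_fourCycle, Finset.union_comm, Finset.pair_comm s(p₂, p₃)]

theorem exists_switch (w : Sym2 V → ℚ) {A B : Finset (Sym2 V)} {𝒯 : Finset (Finset (Sym2 V))}
    (h𝒯 : ∀ T ∈ 𝒯, IsTriangle T) (hA : IsTwoMatching A) (hB : IsTwoMatching B)
    (hAf : TFree 𝒯 A) (hBf : TFree 𝒯 B) (hn : ¬ NoSwitch (Adj A) (Adj B)) :
    ∃ u : ℕ → V, IsAltTrail A B 4 u ∧ trailSl 4 u = 0 ∧
      IsTwoMatching (symmDiff A (trailEdges 4 u)) ∧ IsTwoMatching (symmDiff B (trailEdges 4 u)) ∧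
      TFree 𝒯 (symmDiff A (trailEdges 4 u)) ∧ TFree 𝒯 (symmDiff B (trailEdges 4 u)) ∧
      wSum w (symmDiff A (trailEdges 4 u)) + wSum w (symmDiff B (trailEdges 4 u)) =
        wSum w A + wSum w B := by
  unfold NoSwitch at hn
  push Not at hn
  obtain ⟨p₀, p₁, p₂, p₃, n01, n02, n03, n12, n13, n23, ⟨a01, b01⟩, ⟨b12, a12⟩, ⟨a23, b23⟩,
    ⟨b30, a30⟩, ⟨b02, a02⟩, hor⟩ := hn
  have sA : Switchable A p₀ p₁ p₂ p₃ := ⟨n01, n02, n03, n12, n13, n23, a01, a23, a12, a30⟩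
  have sB : Switchable B p₁ p₂ p₃ p₀ :=
    ⟨n12, n13, n01.symm, n23, n02.symm, n03.symm, b12, b30, b23, b01⟩
  have hrot := fourCycle_rotate p₀ p₁ p₂ p₃
  have mA := sA.isTwoMatching hA
  have mB := sB.isTwoMatching hB
  have fB : TFree 𝒯 (symmDiff B (trailEdges 4 (fourCycle p₁ p₂ p₃ p₀))) := by
    refine sB.tFree h𝒯 hBf (fun z z1 z2 k1 k2 => ?_) (fun z z1 z2 k1 k2 => ?_)
    · have d1 := (sB.adj_iff p₂ p₃).2 (by grind)
      have d2 := (sB.adj_iff p₂ p₀).2 (by have := Adj.symm b02; grind)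
      have c1 := mB.degTwo.deg d1 d2 k1
      rw [sB.adj_iff] at k2
      grind
    · have d1 := (sB.adj_iff p₀ p₁).2 (by grind)
      have d2 := (sB.adj_iff p₀ p₂).2 (by grind)
      have c1 := mB.degTwo.deg d1 d2 k1
      rw [sB.adj_iff] at k2
      grind
  have fA : TFree 𝒯 (symmDiff A (trailEdges 4 (fourCycle p₀ p₁ p₂ p₃))) := by
    have d1 := (sA.adj_iff p₁ p₂).2 (by grind)
    have d2 := (sA.adj_iff p₃ p₀).2 (by grind)
    rcases hor with ⟨a13, -⟩ | ⟨b, ⟨a0b, -⟩, ⟨ab2, -⟩⟩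
    · have d3 := (sA.adj_iff p₁ p₃).2 (by grind)
      refine sA.tFree h𝒯 hAf (fun z z1 z2 k1 k2 => ?_) (fun z z1 z2 k1 k2 => ?_)
      · have c1 := mA.degTwo.deg d1 d3 k1
        rw [sA.adj_iff] at k2
        grind
      · have c1 := mA.degTwo.deg d2 d3.symm k1
        rw [sA.adj_iff] at k2
        grind
    · have e1 : b ≠ p₀ := by rintro rfl; exact a02 ab2
      have e2 : b ≠ p₂ := by rintro rfl; exact a02 a0b
      have e3 : b ≠ p₁ := by rintro rfl; exact a12 ab2
      have e4 : b ≠ p₃ := by rintro rfl; exact a30 (Adj.symm a0b)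
      have d3 := (sA.adj_iff p₀ b).2 (by grind)
      have d4 := (sA.adj_iff b p₂).2 (by grind)
      refine sA.tFree h𝒯 hAf (fun z z1 z2 k1 k2 => ?_) (fun z z1 z2 k1 k2 => ?_)
      · have c1 := mA.degTwo.deg d1.symm d4.symm k2
        obtain rfl : z = b := by grind
        have c2 := mA.degTwo.deg d3.symm d4 k1.symm
        grind
      · have c1 := mA.degTwo.deg d2.symm d3 k2
        obtain rfl : z = b := by grind
        have c2 := mA.degTwo.deg d3.symm d4 k1.symm
        grind
  have hw : wSum w (symmDiff A (trailEdges 4 (fourCycle p₀ p₁ p₂ p₃))) +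
      wSum w (symmDiff B (trailEdges 4 (fourCycle p₁ p₂ p₃ p₀))) = wSum w A + wSum w B := by
    have e1 := sA.sum_symmDiff w
    have e2 := sB.sum_symmDiff w
    simp only [wSum]
    linarith
  rw [hrot] at mB fB hw
  refine ⟨fourCycle p₀ p₁ p₂ p₃, ⟨⟨?_, ?_⟩, ?_⟩, ?_, mA, mB, fA, fB, hw⟩
  · intro i hi
    interval_cases i <;> simp only [fourCycle, Finset.mem_symmDiff]
    exacts [Or.inl ⟨a01, b01⟩, Or.inr ⟨b12, a12⟩, Or.inl ⟨a23, b23⟩, Or.inr ⟨b30, a30⟩]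
  · intro i hi j hj
    interval_cases i <;> interval_cases j <;> simp [fourCycle] <;> grind
  · intro i hi
    have hi' : i < 3 := by omega
    interval_cases i <;> simp only [fourCycle, Finset.mem_sdiff, Nat.reduceAdd]
    · exact iff_of_true ⟨a01, b01⟩ ⟨b12, a12⟩
    · exact iff_of_false (fun h => a12 h.1) (fun h => b23 h.1)
    · exact iff_of_true ⟨a23, b23⟩ ⟨b30, a30⟩
  · rw [trailSl, Finset.card_eq_zero, Finset.filter_eq_empty_iff]
    intro i hi
    rw [Finset.mem_range] at hi
    interval_cases i <;> simp [fourCycle, n01, n12, n23, n03.symm]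

end Switch

section Reduction
variable {V : Type*} [DecidableEq V]

theorem IsAltTrail.trailEdges_subset {A B : Finset (Sym2 V)} {k : ℕ} {u : ℕ → V}
    (h : IsAltTrail A B k u) : trailEdges k u ⊆ symmDiff A B := by
  rw [trailEdges, Finset.image_subset_iff]
  exact fun i hi => h.1.1 i (Finset.mem_range.1 hi)

theorem symmDiff_symmDiff_of_subset {A B Q : Finset (Sym2 V)} (hQ : Q ⊆ symmDiff A B) :
    symmDiff (symmDiff A Q) B = symmDiff A B \ Q := by
  ext e
  have := @hQ e
  simp only [Finset.mem_symmDiff, Finset.mem_sdiff] at this ⊢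
  tauto

theorem IsAltTrail.of_symmDiff {A B Q : Finset (Sym2 V)} (hQ : Q ⊆ symmDiff A B) {k : ℕ}
    {u : ℕ → V} (h : IsAltTrail (symmDiff A Q) B k u) : IsAltTrail A B k u := by
  obtain ⟨⟨h1, h2⟩, h3⟩ := h
  rw [symmDiff_symmDiff_of_subset hQ] at h1
  refine ⟨⟨fun i hi => (Finset.mem_sdiff.1 (h1 i hi)).1, h2⟩, fun i hi => ?_⟩
  have a1 := h1 i (by omega)
  have a2 : s(u (i + 1), u (i + 2)) ∈ symmDiff A B \ Q := h1 (i + 1) (by omega)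
  have a3 := h3 i hi
  simp only [Finset.mem_symmDiff, Finset.mem_sdiff] at a1 a2 a3 ⊢
  tauto

theorem exists_trail [Fintype V] (w : Sym2 V → ℚ) (hw : ∀ e, 0 ≤ w e)
    {𝒯 : Finset (Finset (Sym2 V))} (h𝒯 : ∀ T ∈ 𝒯, IsTriangle T) {A B : Finset (Sym2 V)}
    (hA : IsTwoMatching A) (hB : IsTwoMatching B) (hAf : TFree 𝒯 A) (hBf : TFree 𝒯 B) (k : ℕ)
    (hk : (k + 1) * wSum w B < k * wSum w A) :
    ∃ m u, IsAltTrail A B m u ∧ IsTwoMatching (symmDiff B (trailEdges m u)) ∧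
      TFree 𝒯 (symmDiff B (trailEdges m u)) ∧
      wSum w B < wSum w (symmDiff B (trailEdges m u)) ∧ m + 2 * trailSl m u ≤ 4 * k + 3 := by
  induction hn : #(symmDiff A B) using Nat.strong_induction_on generalizing A with
  | _ n ih =>
  by_cases hsw : NoSwitch (Adj A) (Adj B) ∧ NoSwitch (Adj B) (Adj A)
  · have hsel := Mixed.selectable hA.degTwo hB.degTwo hsw.1 hsw.2 (mixedPart A B 𝒯)
      (mixed_mixedPart h𝒯 hAf hBf)
    refine hsel.exists_trail w h𝒯 hA hB hAf hBf k ?_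
    have h1 : wSum w A = wSum w (A \ B) + wSum w (A ∩ B) := by
      rw [← Finset.sdiff_inter_self_left A B]
      exact (Finset.sum_sdiff Finset.inter_subset_left).symm
    have h2 : wSum w B = wSum w (B \ A) + wSum w (A ∩ B) := by
      rw [← Finset.sdiff_inter_self_left B A, Finset.inter_comm A B]
      exact (Finset.sum_sdiff Finset.inter_subset_left).symm
    have h3 : 0 ≤ wSum w (A ∩ B) := Finset.sum_nonneg fun e _ => hw e
    rw [h1, h2] at hk
    linarith
  · obtain ⟨u, hu, hsl, mA, mB, fA, fB, hsum⟩ : ∃ u : ℕ → V, IsAltTrail A B 4 u ∧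
        trailSl 4 u = 0 ∧
        IsTwoMatching (symmDiff A (trailEdges 4 u)) ∧
        IsTwoMatching (symmDiff B (trailEdges 4 u)) ∧
        TFree 𝒯 (symmDiff A (trailEdges 4 u)) ∧ TFree 𝒯 (symmDiff B (trailEdges 4 u)) ∧
        wSum w (symmDiff A (trailEdges 4 u)) + wSum w (symmDiff B (trailEdges 4 u)) =
          wSum w A + wSum w B := by
      rcases not_and_or.1 hsw with h | h
      · exact exists_switch w h𝒯 hA hB hAf hBf h
      · obtain ⟨u, h1, h2, h3, h4, h5, h6, h7⟩ := exists_switch w h𝒯 hB hA hBf hAf h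
        exact ⟨u, h1.symm, h2, h4, h3, h6, h5, by linarith⟩
    by_cases hlt : wSum w B < wSum w (symmDiff B (trailEdges 4 u))
    · refine ⟨4, u, hu, mB, fB, hlt, ?_⟩
      have : k ≠ 0 := by
        rintro rfl
        have : 0 ≤ wSum w B := Finset.sum_nonneg fun e _ => hw e
        norm_num at hk
        linarith
      omega
    · have hQ := hu.trailEdges_subset
      have hle : wSum w A ≤ wSum w (symmDiff A (trailEdges 4 u)) := by linarith
      have hcard : #(symmDiff (symmDiff A (trailEdges 4 u)) B) < n := by
        rw [symmDiff_symmDiff_of_subset hQ, ← hn]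
        refine Finset.card_lt_card (Finset.sdiff_ssubset hQ ?_)
        simp [trailEdges]
      obtain ⟨m, v, h1, h2⟩ := ih _ hcard mA fA
        (hk.trans_le (mul_le_mul_of_nonneg_left hle k.cast_nonneg)) rfl
      exact ⟨m, v, h1.of_symmDiff hQ, h2⟩

end Reduction

/-- Theorem 4 of the paper: given a finite edge-weighted graph (self-loops
allowed, no parallel edges), a set `𝒯` of triangles of `G`, and two `𝒯`-free 2-matchings
`A₁, A₂` with `(1-ε) w(A₁) > w(A₂)`, there is an alternating trail `P` w.r.t. `(A₁, A₂)` such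
that `A₂ Δ P` is a `𝒯`-free 2-matching, `w(A₂ Δ P) > w(A₂)`, and `|P| + 2 sl(P) ≤ 7/ε`. -/
theorem stmt1 [Fintype V] [DecidableEq V]
    (E : Finset (Sym2 V)) (w : Sym2 V → ℚ) (hw : ∀ e, 0 ≤ w e)
    (𝒯 : Finset (Finset (Sym2 V))) (h𝒯 : ∀ T ∈ 𝒯, IsTriangle T ∧ T ⊆ E)
    (A₁ A₂ : Finset (Sym2 V)) (hA₁E : A₁ ⊆ E) (hA₂E : A₂ ⊆ E)
    (hA₁m : IsTwoMatching A₁) (hA₂m : IsTwoMatching A₂)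
    (hA₁f : TFree 𝒯 A₁) (hA₂f : TFree 𝒯 A₂)
    (ε : ℚ) (hε0 : 0 < ε) (hε1 : ε ≤ 1)
    (hgap : (1 - ε) * wSum w A₁ > wSum w A₂) :
    ∃ (k : ℕ) (u : ℕ → V), IsAltTrail A₁ A₂ k u ∧
      IsTwoMatching (symmDiff A₂ (trailEdges k u)) ∧
      TFree 𝒯 (symmDiff A₂ (trailEdges k u)) ∧
      wSum w A₂ < wSum w (symmDiff A₂ (trailEdges k u)) ∧
      (k : ℚ) + 2 * (trailSl k u : ℚ) ≤ 7 / ε := by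
  obtain ⟨k, hk⟩ : ∃ k : ℕ, ⌈1 / ε⌉₊ = k + 1 :=
    Nat.exists_eq_succ_of_ne_zero (Nat.ceil_pos.2 (one_div_pos.2 hε0)).ne'
  have h1 : 1 / ε ≤ k + 1 := by exact_mod_cast hk ▸ Nat.le_ceil (1 / ε)
  have h2 : (k : ℚ) + 1 < 1 / ε + 1 := by
    exact_mod_cast hk ▸ Nat.ceil_lt_add_one (one_div_pos.2 hε0).le
  have hA : 0 ≤ wSum w A₁ := Finset.sum_nonneg fun e _ => hw e
  have h3 : ((k : ℚ) + 1) * (1 - ε) ≤ k := by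
    rw [div_le_iff₀ hε0] at h1
    linarith
  have h4 : ((k : ℚ) + 1) * wSum w A₂ < k * wSum w A₁ :=
    calc ((k : ℚ) + 1) * wSum w A₂ < (k + 1) * ((1 - ε) * wSum w A₁) := by gcongr
      _ = ((k + 1) * (1 - ε)) * wSum w A₁ := by ring
      _ ≤ k * wSum w A₁ := by gcongr
  obtain ⟨m, u, h5, h6, h7, h8, h9⟩ :=
    exists_trail w hw (fun T hT => (h𝒯 T hT).1) hA₁m hA₂m hA₁f hA₂f k h4
  refine ⟨m, u, h5, h6, h7, h8, ?_⟩
  have h10 : (m : ℚ) + 2 * trailSl m u ≤ 4 * k + 3 := by exact_mod_cast h9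
  have h11 : 1 ≤ 1 / ε := (one_le_div hε0).2 hε1
  have h12 : 7 / ε = 7 * (1 / ε) := by ring
  linarith
end
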